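/- arXiv:math/9402205 — 3 statements merged into one kernel-verified Lean document; each statement's English description precedes it below -/
import Mathlib

section
/- Let 1 < p₁, …, p_N < ∞ and let A range over nonempty subsets of {1, …, N}, with r_A defined by 1/r_A = min{1, Σ_{i ∈ A} 1/p_i}. Then for 1 ≤ p < ∞, the space ℓ_p embeds isomorphically into the projective tensor product ℓ_{p₁} ⊗̂ ⋯ ⊗̂ ℓ_{p_N} if and only if p = r_A for some nonempty A ⊆ {1, …, N}. -/
open scoped TensorProduct ENNReal
open PiTensorProduct

noncomputable section

variable (ι : Type*) [Fintype ι] (E : ι → Type*)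
  [∀ i, NormedAddCommGroup (E i)] [∀ i, NormedSpace ℝ (E i)]

/-- The projective tensor seminorm on the algebraic tensor product, as a seminormed group
structure. -/
instance : SeminormedAddCommGroup (⨂[ℝ] i, E i) :=
  (projectiveSeminorm (𝕜 := ℝ) (E := E)).toSeminormedAddCommGroup

instance : NormedSpace ℝ (⨂[ℝ] i, E i) where
  norm_smul_le a x := le_of_eq (map_smul_eq_mul projectiveSeminorm a x)

/-- The (completed) projective tensor product `E 0 ⊗̂ ⋯ ⊗̂ E (N-1)`. -/
abbrev ProjTensor : Type _ := UniformSpace.Completion (⨂[ℝ] i, E i)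

variable {ι E} in
/-- The canonical elementary tensor `m 0 ⊗ ⋯ ⊗ m (N-1)` in the completed projective tensor
product. -/
def tprodC (m : Π i, E i) : ProjTensor ι E :=
  ((⨂ₜ[ℝ] i, m i : ⨂[ℝ] i, E i) : UniformSpace.Completion _)

/-- The space `ℓ_p` of `p`-summable real sequences. -/
abbrev Lp' (p : ℝ≥0∞) : Type := lp (fun _ : ℕ => ℝ) p

/-- The standard unit vector basis of `ℓ_p`. -/
def e' (p : ℝ≥0∞) (n : ℕ) : Lp' p := lp.single p n 1

/-- The completed projective tensor product `ℓ_{p 0} ⊗̂ ⋯ ⊗̂ ℓ_{p (N-1)}`. -/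
abbrev LpT {N : ℕ} (p : Fin N → ℝ) [∀ i, Fact (1 ≤ ENNReal.ofReal (p i))] : Type :=
  ProjTensor (Fin N) (fun i => Lp' (ENNReal.ofReal (p i)))

/-- The basis tensors `e_α = e_{α 0} ⊗ ⋯ ⊗ e_{α (N-1)}` of the projective tensor product of
`ℓ_p`-spaces. -/
def eT {N : ℕ} (p : Fin N → ℝ) [∀ i, Fact (1 ≤ ENNReal.ofReal (p i))] (α : Fin N → ℕ) : LpT p :=
  tprodC (fun i => e' (ENNReal.ofReal (p i)) (α i))

/-- Two normed spaces are isomorphic (linearly homeomorphic). -/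
def IsoBanach (X Y : Type*) [NormedAddCommGroup X] [NormedSpace ℝ X]
    [NormedAddCommGroup Y] [NormedSpace ℝ Y] : Prop :=
  Nonempty (X ≃L[ℝ] Y)

/-- `X` is isomorphic to a complemented subspace of `Y`: there are bounded linear maps
`f : X → Y` and `g : Y → X` with `g ∘ f = id` (so `f ∘ g` is a bounded projection of `Y`
onto a subspace isomorphic to `X`). -/
def ComplementablyEmbedsIn (X Y : Type*) [NormedAddCommGroup X] [NormedSpace ℝ X]
    [NormedAddCommGroup Y] [NormedSpace ℝ Y] : Prop :=
  ∃ (f : X →L[ℝ] Y) (g : Y →L[ℝ] X), g.comp f = ContinuousLinearMap.id ℝ X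

/-- `X` embeds isomorphically into `Y`: a bounded linear map bounded below (hence an
isomorphism onto its closed image). -/
def EmbedsIn (X Y : Type*) [NormedAddCommGroup X] [NormedSpace ℝ X]
    [NormedAddCommGroup Y] [NormedSpace ℝ Y] : Prop :=
  ∃ f : X →L[ℝ] Y, ∃ c : ℝ, 0 < c ∧ ∀ x, c * ‖x‖ ≤ ‖f x‖

section Generic

variable {I : Type*} [Fintype I] {F : I → Type*}
  [∀ i, NormedAddCommGroup (F i)] [∀ i, NormedSpace ℝ (F i)]

lemma pn_tprod_le (w : Π i, F i) : ‖(tprod ℝ w : ⨂[ℝ] i, F i)‖ ≤ ∏ i, ‖w i‖ :=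
  PiTensorProduct.projectiveSeminorm_tprod_le (𝕜 := ℝ) w

lemma exists_rep (t : ⨂[ℝ] i, F i) (C : ℝ) (h : ‖t‖ < C) :
    ∃ l : List (ℝ × Π i, F i), t = (l.map fun x => x.1 • tprod ℝ x.2).sum ∧
      (l.map fun x => |x.1| * ∏ i, ‖x.2 i‖).sum < C := by
  have h' : iInf (fun (p : lifts t) ↦ projectiveSeminormAux p.val) < C := h
  have : Nonempty (lifts t) := (nonempty_lifts t).to_subtype
  obtain ⟨p, hp⟩ := exists_lt_of_ciInf_lt h'
  refine ⟨p.1.toList, ?_, hp⟩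
  exact ((mem_lifts_iff t p.1).mp p.2).symm

lemma dominate (q : (⨂[ℝ] i, F i) → ℝ) (C : ℝ) (hC : 0 ≤ C) (h0 : q 0 ≤ 0)
    (hadd : ∀ x y, q (x + y) ≤ q x + q y)
    (hq : ∀ (a : ℝ) (w : Π i, F i), q (a • tprod ℝ w) ≤ |a| * (C * ∏ i, ‖w i‖))
    (t : ⨂[ℝ] i, F i) : q t ≤ C * ‖t‖ := by
  have key : ∀ l : List (ℝ × Π i, F i), q (l.map fun x => x.1 • tprod ℝ x.2).sum ≤
      C * (l.map fun x => |x.1| * ∏ i, ‖x.2 i‖).sum := by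
    intro l
    induction l with
    | nil => simpa using h0
    | cons x l ih =>
      simp only [List.map_cons, List.sum_cons]
      calc _ ≤ _ := hadd _ _
        _ ≤ _ := add_le_add (hq _ _) ih
        _ = _ := by ring
  refine le_of_forall_pos_le_add fun ε hε => ?_
  obtain ⟨l, rfl, hl⟩ := exists_rep t (‖t‖ + ε / (C + 1)) (lt_add_of_pos_right _ (by positivity))
  refine (key l).trans ((mul_le_mul_of_nonneg_left hl.le hC).trans ?_)
  rw [mul_add]
  gcongr
  rw [mul_div_assoc', div_le_iff₀ (by positivity)]
  nlinarith

/-- signed elementary tensors of unit vectors -/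
def elemSet (F : I → Type*) [∀ i, NormedAddCommGroup (F i)] [∀ i, NormedSpace ℝ (F i)] :
    Set (⨂[ℝ] i, F i) :=
  {t | ∃ (b : ℝ) (w : Π i, F i), |b| ≤ 1 ∧ (∀ i, ‖w i‖ ≤ 1) ∧ t = b • tprod ℝ w}

lemma smul_tprod_mem (a : ℝ) (w : Π i, F i) :
    ∃ s ∈ elemSet F, a • tprod ℝ w = (|a| * ∏ i, ‖w i‖) • s := by
  refine ⟨(SignType.sign a : ℝ) • tprod ℝ (fun i => ‖w i‖⁻¹ • w i), ⟨_, _, ?_, ?_, rfl⟩, ?_⟩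
  · rcases lt_trichotomy a 0 with h | h | h <;> simp [h]
  · intro i
    rw [norm_smul, norm_inv, norm_norm]
    exact inv_mul_le_one
  · have : tprod ℝ w = (∏ i, ‖w i‖) • tprod ℝ (fun i => ‖w i‖⁻¹ • w i) := by
      rw [← MultilinearMap.map_smul_univ]
      congr 1
      ext i
      by_cases h : w i = 0
      · simp [h]
      · rw [smul_smul, mul_inv_cancel₀ (by simpa using h), one_smul]
    rw [this, smul_smul, smul_smul]
    congr 1
    rw [mul_right_comm, mul_comm |a|, sign_mul_abs]

lemma ball_subset (t : ⨂[ℝ] i, F i) (h : ‖t‖ < 1) : t ∈ convexHull ℝ (elemSet F) := by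
  obtain ⟨l, rfl, hl⟩ := exists_rep t 1 h
  clear h
  have h0 : (0 : ⨂[ℝ] i, F i) ∈ convexHull ℝ (elemSet F) :=
    subset_convexHull _ _ ⟨0, 0, by simp⟩
  have hcv := convex_convexHull ℝ (elemSet F)
  have key : ∀ l : List (ℝ × Π i, F i),
     ∃ s ∈ convexHull ℝ (elemSet F), (l.map fun x => x.1 • tprod ℝ x.2).sum =
      ((l.map fun x => |x.1| * ∏ i, ‖x.2 i‖).sum) • s := by
    intro l
    induction l with
    | nil => exact ⟨0, h0, by simp⟩
    | cons x l ih =>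
      obtain ⟨s, hs, e⟩ := ih
      obtain ⟨s', hs', e'⟩ := smul_tprod_mem x.1 x.2
      simp only [List.map_cons, List.sum_cons, e, e']
      set α := |x.1| * ∏ i, ‖x.2 i‖
      set β := (l.map fun x => |x.1| * ∏ i, ‖x.2 i‖).sum
      have hα : 0 ≤ α := by positivity
      have hβ : 0 ≤ β := List.sum_nonneg (by
        intro y hy
        simp only [List.mem_map] at hy
        obtain ⟨z, _, rfl⟩ := hy
        positivity)
      rcases eq_or_lt_of_le (add_nonneg hα hβ) with h | h
      · have h1 : α = 0 := by linarith
        have h2 : β = 0 := by linarith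
        exact ⟨0, h0, by simp [h1, h2]⟩
      · refine ⟨(α / (α + β)) • s' + (β / (α + β)) • s, hcv (subset_convexHull _ _ hs') hs
          (by positivity) (by positivity) (by field_simp), ?_⟩
        rw [smul_add, smul_smul, smul_smul, mul_div_cancel₀ _ h.ne', mul_div_cancel₀ _ h.ne']
  obtain ⟨s, hs, e⟩ := key l
  rw [e]
  have hβ : 0 ≤ (l.map fun x => |x.1| * ∏ i, ‖x.2 i‖).sum := List.sum_nonneg (by
        intro y hy
        simp only [List.mem_map] at hy
        obtain ⟨z, _, rfl⟩ := hy
        positivity)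
  exact hcv.smul_mem_of_zero_mem h0 hs ⟨hβ, hl.le⟩

end Generic

section Rademacher

variable {κ : Type*} [Fintype κ] [DecidableEq κ]

lemma sum_signs (n m : κ) : ∑ ε : κ → ℤˣ, (((ε n : ℤ) : ℝ) * ((ε m : ℤ) : ℝ)) =
    if n = m then (Fintype.card (κ → ℤˣ) : ℝ) else 0 := by
  split_ifs with h
  · subst h
    have : ∀ ε : κ → ℤˣ, (((ε n : ℤ) : ℝ) * ((ε n : ℤ) : ℝ)) = 1 := by
      intro ε
      rcases Int.units_eq_one_or (ε n) with h | h <;> simp [h]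
    simp [this]
  · have hinv : Function.Involutive (fun ε : κ → ℤˣ => Function.update ε n (-ε n)) := by
      intro ε
      simp
    have := Equiv.sum_comp hinv.toPerm (fun ε : κ → ℤˣ => (((ε n : ℤ) : ℝ) * ((ε m : ℤ) : ℝ)))
    simp only [Function.Involutive.coe_toPerm, Function.update_self,
      Function.update_of_ne (Ne.symm h), Units.val_neg, Int.cast_neg, neg_mul,
      Finset.sum_neg_distrib] at this
    linarith

lemma rad_step {V : Type*} [AddCommGroup V] [Module ℝ V] (q : Seminorm ℝ V) (B : κ → κ → V) :
    ∃ ε : κ → ℤˣ, q (∑ n, B n n) ≤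
      q (∑ n, ((ε n : ℤ) : ℝ) • ∑ m, ((ε m : ℤ) : ℝ) • B n m) := by
  by_contra hcon
  push Not at hcon
  have h1 : ∑ ε : κ → ℤˣ, ∑ n, ((ε n : ℤ) : ℝ) • ∑ m, ((ε m : ℤ) : ℝ) • B n m =
      (Fintype.card (κ → ℤˣ) : ℝ) • ∑ n, B n n := by
    rw [Finset.sum_comm, Finset.smul_sum]
    refine Finset.sum_congr rfl fun n _ => ?_
    simp_rw [Finset.smul_sum, smul_smul]
    rw [Finset.sum_comm]
    simp_rw [← Finset.sum_smul, sum_signs]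
    simp
  have h2 : ∑ ε : κ → ℤˣ, q (∑ n, ((ε n : ℤ) : ℝ) • ∑ m, ((ε m : ℤ) : ℝ) • B n m) <
      ∑ ε : κ → ℤˣ, q (∑ n, B n n) :=
    Finset.sum_lt_sum_of_nonempty Finset.univ_nonempty (fun ε _ => hcon ε)
  have h3 : q (∑ ε : κ → ℤˣ, ∑ n, ((ε n : ℤ) : ℝ) • ∑ m, ((ε m : ℤ) : ℝ) • B n m) ≤
    ∑ ε : κ → ℤˣ, q (∑ n, ((ε n : ℤ) : ℝ) • ∑ m, ((ε m : ℤ) : ℝ) • B n m) :=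
      Finset.le_sum_of_subadditive q (map_zero q).le (map_add_le_add q) _ _
  rw [h1, map_smul_eq_mul] at h3
  simp only [Finset.sum_const, Finset.card_univ, nsmul_eq_mul] at h2
  simp only [Real.norm_eq_abs, Nat.abs_cast] at h3
  linarith

lemma rad_multi {I : Type*} [DecidableEq I] {F : I → Type*}
    [∀ i, AddCommGroup (F i)] [∀ i, Module ℝ (F i)]
    {V : Type*} [AddCommGroup V] [Module ℝ V] (q : Seminorm ℝ V) (φ : MultilinearMap ℝ F V)
    (n0 : κ) (i0 : I) (A' : Finset I) : i0 ∉ A' → ∀ u : κ → Π i, F i,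
    (∀ i, i ∉ A' → i ≠ i0 → ∀ n, u n i = u n0 i) →
    ∃ ε : I → κ → ℤˣ, q (∑ n, φ (u n)) ≤ q (φ (fun i =>
      if i ∈ A' ∨ i = i0 then ∑ n, ((ε i n : ℤ) : ℝ) • u n i else u n0 i)) := by
  induction A' using Finset.induction_on with
  | empty =>
    intro _ u hu
    refine ⟨fun _ _ => 1, le_of_eq ?_⟩
    have h1 : ∀ n, u n = Function.update (u n0) i0 (u n i0) := by
      intro n
      ext i
      by_cases h : i = i0
      · subst h; simp
      · simp [h, hu i (by simp) h n]
    have h2 : (fun i => if i ∈ (∅ : Finset I) ∨ i = i0 then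
        ∑ n, (((1 : ℤˣ) : ℤ) : ℝ) • u n i else u n0 i) =
        Function.update (u n0) i0 (∑ n, u n i0) := by
      ext i
      by_cases h : i = i0
      · subst h; simp
      · simp [h]
    rw [h2, MultilinearMap.map_update_sum]
    congr 1
    exact Finset.sum_congr rfl fun n _ => congrArg φ (h1 n)
  | insert j A' hj ih =>
    intro hi0 u hu
    have hji : i0 ≠ j := fun h => hi0 (by simp [h])
    have hi0' : i0 ∉ A' := fun h => hi0 (by simp [h])
    obtain ⟨ε, hε⟩ := rad_step q (fun n m => φ (Function.update (u n) j (u m j)))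
    simp only [Function.update_eq_self] at hε
    set wj := ∑ m, ((ε m : ℤ) : ℝ) • u m j with hwj
    let u' : κ → Π i, F i := fun n => Function.update (Function.update (u n) j wj) i0
      (((ε n : ℤ) : ℝ) • u n i0)
    have e1 : ∀ n, ((ε n : ℤ) : ℝ) • ∑ m, ((ε m : ℤ) : ℝ) • φ (Function.update (u n) j (u m j)) =
        φ (u' n) := by
      intro n
      simp_rw [← MultilinearMap.map_update_smul]
      rw [← MultilinearMap.map_update_sum, ← hwj]
      show _ = φ (Function.update (Function.update (u n) j wj) i0 (((ε n : ℤ) : ℝ) • u n i0))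
      rw [MultilinearMap.map_update_smul]
      congr 2
      ext i
      by_cases h : i = i0
      · subst h; simp [hji]
      · simp [h]
    simp_rw [e1] at hε
    obtain ⟨ε', hε'⟩ := ih hi0' u' (by
      intro i hi hne n
      by_cases h : i = j
      · subst h; simp [u', hne]
      · simp [u', hne, h, hu i (by simp [h, hi]) hne n])
    refine ⟨fun i n => if i = j then ε n else if i = i0 then ε' i n * ε n else ε' i n,
      hε.trans (hε'.trans (le_of_eq ?_))⟩
    congr 2
    ext i
    by_cases h : i = j
    · subst h
      simp [hj, hji.symm, u', hwj]
    · by_cases h' : i = i0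
      · subst h'
        simp [h, u', smul_smul]
      · simp [h, h', u']

end Rademacher

section LpFacts

variable {q : ℝ}

lemma toReal_ofReal' (hq : 0 < q) : (ENNReal.ofReal q).toReal = q := ENNReal.toReal_ofReal hq.le

lemma lp_hasSum (hq : 0 < q) (f : Lp' (ENNReal.ofReal q)) :
    HasSum (fun k => |f k| ^ q) (‖f‖ ^ q) := by
  have := lp.hasSum_norm (p := ENNReal.ofReal q) (by rw [toReal_ofReal' hq]; exact hq) f
  rw [toReal_ofReal' hq] at this
  simpa using this

lemma res_mem (S : Set ℕ) (f : Lp' (ENNReal.ofReal q)) :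
    Memℓp (E := fun _ : ℕ => ℝ) (S.indicator (f : ℕ → ℝ)) (ENNReal.ofReal q) := by
  refine (lp.memℓp f).mono' fun i => ?_
  exact norm_indicator_le_norm_self _ _

/-- Restriction of a sequence to a set of coordinates. -/
def res (q : ℝ) (S : Set ℕ) : Lp' (ENNReal.ofReal q) →ₗ[ℝ] Lp' (ENNReal.ofReal q) where
  toFun f := ⟨S.indicator (f : ℕ → ℝ), res_mem S f⟩
  map_add' f g := by
    apply lp.ext
    exact Set.indicator_add S (f : ℕ → ℝ) (g : ℕ → ℝ)
  map_smul' c f := by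
    apply lp.ext
    exact Set.indicator_const_smul S c (f : ℕ → ℝ)

lemma res_apply (S : Set ℕ) (f : Lp' (ENNReal.ofReal q)) (k : ℕ) :
    (res q S f) k = S.indicator (f : ℕ → ℝ) k := rfl

lemma res_norm_le (hq : 0 < q) (S : Set ℕ) (f : Lp' (ENNReal.ofReal q)) :
    ‖res q S f‖ ≤ ‖f‖ := by
  refine (Real.rpow_le_rpow_iff (lp.norm_nonneg' _) (lp.norm_nonneg' _) hq).1 ?_
  refine hasSum_le (fun k => ?_) (lp_hasSum hq _) (lp_hasSum hq f)
  refine Real.rpow_le_rpow (abs_nonneg _) ?_ hq.le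
  exact norm_indicator_le_norm_self (f : ℕ → ℝ) k

lemma res_sum_le {κ : Type*} [Fintype κ] (hq : 0 < q) (S : κ → Set ℕ)
    (hS : Pairwise (fun n m => Disjoint (S n) (S m))) (f : Lp' (ENNReal.ofReal q)) :
    ∑ n, ‖res q (S n) f‖ ^ q ≤ ‖f‖ ^ q := by
  classical
  have h := hasSum_sum (s := Finset.univ) (fun (n : κ) _ => lp_hasSum hq (res q (S n) f))
  refine hasSum_le (fun k => ?_) h (lp_hasSum hq f)
  by_cases hk : ∃ n, k ∈ S n
  · obtain ⟨n, hn⟩ := hk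
    rw [Finset.sum_eq_single n]
    · rw [res_apply, Set.indicator_of_mem hn]
    · intro m _ hm
      have : k ∉ S m := fun h => Set.disjoint_left.1 (hS hm) h hn
      rw [res_apply, Set.indicator_of_notMem this]
      simp [hq.ne']
    · simp
  · push Not at hk
    have : ∀ n, |(res q (S n) f) k| ^ q = 0 := by
      intro n
      rw [res_apply, Set.indicator_of_notMem (hk n)]
      simp [hq.ne']
    simp only [this, Finset.sum_const_zero]
    positivity

lemma lp_sum_apply {κ : Type*} [Fintype κ] (c : κ → ℝ) (v : κ → Lp' (ENNReal.ofReal q)) (k : ℕ) :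
    (∑ n, c n • v n : Lp' (ENNReal.ofReal q)) k = ∑ n, c n * v n k := by
  rw [lp.coeFn_sum, Finset.sum_apply]
  rfl

lemma disj_eq {κ : Type*} [Fintype κ] (hq : 0 < q) (c : κ → ℝ) (v : κ → Lp' (ENNReal.ofReal q))
    (hv : ∀ n m k, n ≠ m → v n k = 0 ∨ v m k = 0) :
    ‖∑ n, c n • v n‖ ^ q = ∑ n, |c n| ^ q * ‖v n‖ ^ q := by
  classical
  refine (lp_hasSum hq (∑ n, c n • v n)).unique ?_
  have h := hasSum_sum (s := Finset.univ)
    (fun (n : κ) _ => (lp_hasSum hq (v n)).mul_left (|c n| ^ q))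
  suffices e : ∀ k, |(∑ n, c n • v n : Lp' (ENNReal.ofReal q)) k| ^ q =
      ∑ n, |c n| ^ q * |v n k| ^ q by
    rw [funext e]
    exact h
  intro k
  rw [lp_sum_apply]
  by_cases hk : ∃ n, v n k ≠ 0
  · obtain ⟨n, hn⟩ := hk
    have h0 : ∀ m, m ≠ n → v m k = 0 := fun m hm => (hv m n k hm).resolve_right hn
    rw [Finset.sum_eq_single n, Finset.sum_eq_single n, abs_mul,
      Real.mul_rpow (abs_nonneg _) (abs_nonneg _)]
    · intro m _ hm; simp [h0 m hm, hq.ne']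
    · simp
    · intro m _ hm; simp [h0 m hm]
    · simp
  · push Not at hk
    simp [hk, hq.ne']

lemma disj_le {κ : Type*} [Fintype κ] (hq : 0 < q) (c : κ → ℝ) (v : κ → Lp' (ENNReal.ofReal q))
    (hv : ∀ n m k, n ≠ m → v n k = 0 ∨ v m k = 0) (hv1 : ∀ n, ‖v n‖ ≤ 1) :
    ‖∑ n, c n • v n‖ ≤ (∑ n, |c n| ^ q) ^ (1 / q) := by
  rw [one_div, Real.le_rpow_inv_iff_of_pos (lp.norm_nonneg' _) (by positivity) hq, disj_eq hq c v hv]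
  refine Finset.sum_le_sum fun n _ => ?_
  refine mul_le_of_le_one_right (Real.rpow_nonneg (abs_nonneg _) _) ?_
  exact Real.rpow_le_one (lp.norm_nonneg' _) (hv1 n) hq.le

lemma e'_apply (n k : ℕ) : (e' (ENNReal.ofReal q) n) k = if k = n then 1 else 0 := by
  unfold e'
  by_cases h : k = n
  · subst h; simp
  · rw [lp.single_apply_ne _ _ _ h, if_neg h]

lemma e'_norm (hq : 0 < q) (n : ℕ) : ‖e' (ENNReal.ofReal q) n‖ = 1 := by
  unfold e'
  rw [lp.norm_single (by simpa using hq)]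
  simp

lemma res_singleton (g : ℕ) (f : Lp' (ENNReal.ofReal q)) :
    res q {g} f = (f g) • e' (ENNReal.ofReal q) g := by
  apply lp.ext
  ext k
  rw [res_apply, lp.coeFn_smul, Pi.smul_apply, e'_apply]
  by_cases h : k = g
  · subst h; simp
  · simp [h]

lemma res_e' (S : Set ℕ) (n : ℕ) [Decidable (n ∈ S)] : res q S (e' (ENNReal.ofReal q) n) =
    if n ∈ S then e' (ENNReal.ofReal q) n else 0 := by
  apply lp.ext
  ext k
  rw [res_apply]
  by_cases h : k = n
  · subst h
    by_cases hk : k ∈ S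
    · simp [hk]
    · simp [hk]
  · split_ifs
    · simp [e'_apply, h]
    · simp [e'_apply, h]

end LpFacts

section Hoelder

lemma hoelder_aux {I κ : Type*} [Fintype κ] (A : Finset I) (hA : A.Nonempty) (pp : I → ℝ)
    (hpp : ∀ i, 1 < pp i) (w : κ → ℝ) (hw : ∀ n, 0 ≤ w n) (hw1 : ∑ n, w n ≤ 1)
    (a : I → κ → ℝ) (ha : ∀ i n, 0 ≤ a i n) (ha1 : ∀ i ∈ A, ∑ n, a i n ^ pp i ≤ 1) :
    ∑ n, w n ^ (1 - min 1 (∑ i ∈ A, 1 / pp i)) * ∏ i ∈ A, a i n ≤ 1 := by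
  have hp0 : ∀ i, 0 < pp i := fun i => lt_trans one_pos (hpp i)
  set s := ∑ i ∈ A, 1 / pp i with hs
  have hspos : 0 < s := Finset.sum_pos (fun i _ => by have := hp0 i; positivity) hA
  have hsum : ∀ c : ℝ, 0 ≤ c → ∑ i ∈ A, (c * (1 / pp i)) * ∑ n, a i n ^ pp i ≤ c * s := by
    intro c hc
    rw [hs, Finset.mul_sum]
    refine Finset.sum_le_sum fun i hi => ?_
    refine mul_le_of_le_one_right (by have := hp0 i; positivity) (ha1 i hi)
  by_cases h : s ≤ 1
  · rw [min_eq_right h]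
    have key : ∀ n, w n ^ (1 - s) * ∏ i ∈ A, a i n ≤
        (1 - s) * w n + ∑ i ∈ A, (1 * (1 / pp i)) * a i n ^ pp i := by
      intro n
      have := Real.geom_mean_le_arith_mean_weighted (Finset.insertNone A)
        (fun o => o.elim (1 - s) (fun i => 1 / pp i))
        (fun o => o.elim (w n) (fun i => a i n ^ pp i)) (by
          rintro (_ | i) _
          · simpa using h
          · have := hp0 i
            simp only [Option.elim]; positivity) (by simp [hs]) (by
          rintro (_ | i) _
          · exact hw n
          · exact Real.rpow_nonneg (ha i n) _)
      rw [Finset.prod_insertNone, Finset.sum_insertNone] at this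
      simp only [Option.elim] at this
      simp only [one_mul]
      refine le_trans (le_of_eq ?_) this
      congr 1
      refine Finset.prod_congr rfl fun i _ => ?_
      rw [← Real.rpow_mul (ha i n), mul_one_div_cancel (hp0 i).ne', Real.rpow_one]
    calc _ ≤ _ := Finset.sum_le_sum fun n _ => key n
      _ = (1 - s) * ∑ n, w n + ∑ i ∈ A, (1 * (1 / pp i)) * ∑ n, a i n ^ pp i := by
        rw [Finset.sum_add_distrib, ← Finset.mul_sum, Finset.sum_comm]
        simp_rw [Finset.mul_sum]
      _ ≤ (1 - s) * 1 + 1 * s := add_le_add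
        (mul_le_mul_of_nonneg_left hw1 (by linarith)) (hsum 1 zero_le_one)
      _ = 1 := by ring
  · push Not at h
    rw [min_eq_left h.le]
    have hle1 : ∀ i ∈ A, ∀ n, a i n ^ pp i ≤ 1 := fun i hi n =>
      (Finset.single_le_sum (f := fun n => a i n ^ pp i)
        (fun m _ => Real.rpow_nonneg (ha i m) _) (Finset.mem_univ n)).trans (ha1 i hi)
    have key : ∀ n, w n ^ ((1 : ℝ) - 1) * ∏ i ∈ A, a i n ≤
        ∑ i ∈ A, (s⁻¹ * (1 / pp i)) * a i n ^ pp i := by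
      intro n
      have := Real.geom_mean_le_arith_mean_weighted A (fun i => s⁻¹ * (1 / pp i))
        (fun i => a i n ^ pp i) (fun i _ => by have := hp0 i; positivity)
        (by rw [← Finset.mul_sum, ← hs, inv_mul_cancel₀ hspos.ne'])
        (fun i _ => Real.rpow_nonneg (ha i n) _)
      refine le_trans ?_ this
      rw [sub_self, Real.rpow_zero, one_mul]
      refine Finset.prod_le_prod (fun i _ => ha i n) fun i hi => ?_
      have h1 : a i n = (a i n ^ pp i) ^ (1 / pp i) := by
        rw [← Real.rpow_mul (ha i n), mul_one_div_cancel (hp0 i).ne', Real.rpow_one]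
      conv_lhs => rw [h1]
      refine Real.rpow_le_rpow_of_exponent_ge' (Real.rpow_nonneg (ha i n) _) (hle1 i hi n)
        (by have := hp0 i; positivity) ?_
      exact mul_le_of_le_one_left (by have := hp0 i; positivity) (inv_le_one_of_one_le₀ h.le)
    calc _ ≤ _ := Finset.sum_le_sum fun n _ => key n
      _ = ∑ i ∈ A, (s⁻¹ * (1 / pp i)) * ∑ n, a i n ^ pp i := by
        rw [Finset.sum_comm]
        simp_rw [Finset.mul_sum]
      _ ≤ s⁻¹ * s := hsum _ (by positivity)
      _ = 1 := inv_mul_cancel₀ hspos.ne'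

lemma hoelder {I κ : Type*} [Fintype κ] (A : Finset I) (hA : A.Nonempty) (pp : I → ℝ)
    (hpp : ∀ i, 1 < pp i) (w : κ → ℝ) (hw : ∀ n, 0 ≤ w n) (hw1 : ∑ n, w n ≤ 1)
    (a : I → κ → ℝ) (ha : ∀ i n, 0 ≤ a i n) (b : I → ℝ) (hb : ∀ i, 0 ≤ b i)
    (hab : ∀ i ∈ A, ∑ n, a i n ^ pp i ≤ b i ^ pp i) :
    ∑ n, w n ^ (1 - min 1 (∑ i ∈ A, 1 / pp i)) * ∏ i ∈ A, a i n ≤ ∏ i ∈ A, b i := by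
  have hp0 : ∀ i, 0 < pp i := fun i => lt_trans one_pos (hpp i)
  by_cases h0 : ∃ i ∈ A, b i = 0
  · obtain ⟨i, hi, hbi⟩ := h0
    have h1 := hab i hi
    rw [hbi, Real.zero_rpow (hp0 i).ne'] at h1
    have h2 : ∀ n, a i n = 0 := by
      intro n
      have := (Finset.single_le_sum (f := fun n => a i n ^ pp i)
        (fun m _ => Real.rpow_nonneg (ha i m) _) (Finset.mem_univ n)).trans h1
      exact (Real.rpow_eq_zero (ha i n) (hp0 i).ne').1
        (le_antisymm this (Real.rpow_nonneg (ha i n) _))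
    have h3 : ∀ n, ∏ i ∈ A, a i n = 0 := fun n => Finset.prod_eq_zero hi (h2 n)
    simp only [h3, mul_zero, Finset.sum_const_zero]
    exact Finset.prod_nonneg fun i _ => hb i
  · push Not at h0
    have hbpos : ∀ i ∈ A, 0 < b i := fun i hi => lt_of_le_of_ne (hb i) (Ne.symm (h0 i hi))
    have := hoelder_aux A hA pp hpp w hw hw1 (fun i n => a i n / b i)
      (fun i n => div_nonneg (ha i n) (hb i)) (by
        intro i hi
        simp_rw [Real.div_rpow (ha _ _) (hb _)]
        rw [← Finset.sum_div, div_le_one (Real.rpow_pos_of_pos (hbpos i hi) _)]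
        exact hab i hi)
    simp_rw [Finset.prod_div_distrib, ← mul_div_assoc] at this
    rwa [← Finset.sum_div, div_le_one (Finset.prod_pos hbpos)] at this

end Hoelder

section Tensor

variable {N : ℕ} {pp : Fin N → ℝ} [∀ i, Fact (1 ≤ ENNReal.ofReal (pp i))]

/-- algebraic tensor product -/
abbrev TT (pp : Fin N → ℝ) : Type := ⨂[ℝ] i, Lp' (ENNReal.ofReal (pp i))

/-- the exponent `1 / r_A` -/
def theta (pp : Fin N → ℝ) (A : Finset (Fin N)) : ℝ := min 1 (∑ i ∈ A, 1 / pp i)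

lemma theta_pos (hpp : ∀ i, 1 < pp i) {A : Finset (Fin N)} (hA : A.Nonempty) :
    0 < theta pp A := by
  refine lt_min one_pos (Finset.sum_pos (fun i _ => ?_) hA)
  have := lt_trans one_pos (hpp i)
  positivity

lemma theta_le_one {A : Finset (Fin N)} : theta pp A ≤ 1 := min_le_left _ _

/-- the projective seminorm -/
def nu (pp : Fin N → ℝ) [∀ i, Fact (1 ≤ ENNReal.ofReal (pp i))] : Seminorm ℝ (TT pp) :=
  projectiveSeminorm (𝕜 := ℝ) (E := fun i => Lp' (ENNReal.ofReal (pp i)))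

lemma nu_tprod_le (w : Π i, Lp' (ENNReal.ofReal (pp i))) :
    nu pp (tprod ℝ w) ≤ ∏ i, ‖w i‖ := pn_tprod_le w

lemma nu_dominate (q : TT pp → ℝ) (C : ℝ) (hC : 0 ≤ C) (h0 : q 0 ≤ 0)
    (hadd : ∀ x y, q (x + y) ≤ q x + q y)
    (hq : ∀ (a : ℝ) (w : Π i, Lp' (ENNReal.ofReal (pp i))),
      q (a • tprod ℝ w) ≤ |a| * (C * ∏ i, ‖w i‖)) (t : TT pp) : q t ≤ C * nu pp t :=
  dominate q C hC h0 hadd hq t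

/-- Box projection. -/
def boxP (pp : Fin N → ℝ) (S : Fin N → Set ℕ) : TT pp →ₗ[ℝ] TT pp :=
  PiTensorProduct.map (fun i => res (pp i) (S i))

lemma boxP_tprod (S : Fin N → Set ℕ) (w : Π i, Lp' (ENNReal.ofReal (pp i))) :
    boxP pp S (tprod ℝ w) = tprod ℝ (fun i => res (pp i) (S i) (w i)) :=
  PiTensorProduct.map_tprod _ _

lemma norm_smul_tprod_le (a : ℝ) (w : Π i, Lp' (ENNReal.ofReal (pp i))) :
    nu pp (a • (tprod ℝ w : TT pp)) ≤ |a| * ∏ i, ‖w i‖ := by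
  rw [map_smul_eq_mul, Real.norm_eq_abs]
  exact mul_le_mul_of_nonneg_left (nu_tprod_le w) (abs_nonneg _)

lemma boxP_norm_le (hpp : ∀ i, 1 < pp i) (S : Fin N → Set ℕ) (t : TT pp) :
    nu pp (boxP pp S t) ≤ nu pp t := by
  have := nu_dominate (fun t : TT pp => nu pp (boxP pp S t)) 1 zero_le_one (by simp)
    (fun x y => by rw [map_add]; exact map_add_le_add _ _ _) (fun a w => by
      rw [map_smul, boxP_tprod, one_mul]
      refine (norm_smul_tprod_le _ _).trans ?_
      gcongr with i
      exact res_norm_le (lt_trans one_pos (hpp i)) _ _) t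
  simpa using this

/-- the sets defining the diagonal blocks -/
def blk (A : Finset (Fin N)) (S : Set ℕ) (SC : Fin N → Set ℕ) (i : Fin N) : Set ℕ :=
  if i ∈ A then S else SC i

lemma lower_est (hpp : ∀ i, 1 < pp i) {κ : Type*} [Fintype κ] (A : Finset (Fin N))
    (hA : A.Nonempty) (S : κ → Set ℕ) (hS : Pairwise (fun n m => Disjoint (S n) (S m)))
    (SC : Fin N → Set ℕ) (w : κ → ℝ) (hw : ∀ n, 0 ≤ w n) (hw1 : ∑ n, w n ≤ 1) (t : TT pp) :
    ∑ n, w n ^ (1 - theta pp A) * nu pp (boxP pp (blk A (S n) SC) t) ≤ nu pp t := by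
  have hp0 : ∀ i, 0 < pp i := fun i => lt_trans one_pos (hpp i)
  have := nu_dominate (fun t : TT pp => ∑ n, w n ^ (1 - theta pp A) * nu pp (boxP pp (blk A (S n) SC) t))
    1 zero_le_one (by simp)
    (fun x y => by
      rw [← Finset.sum_add_distrib]
      refine Finset.sum_le_sum fun n _ => ?_
      rw [← mul_add, map_add]
      exact mul_le_mul_of_nonneg_left (map_add_le_add _ _ _) (Real.rpow_nonneg (hw n) _))
    (fun a v => by
      have h1 : ∀ n, nu pp (boxP pp (blk A (S n) SC) (a • tprod ℝ v)) ≤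
          |a| * ((∏ i ∈ A, ‖res (pp i) (S n) (v i)‖) * ∏ i ∈ Aᶜ, ‖v i‖) := by
        intro n
        rw [map_smul, boxP_tprod]
        refine (norm_smul_tprod_le _ _).trans ?_
        rw [← Finset.prod_mul_prod_compl A]
        refine mul_le_mul_of_nonneg_left ?_ (abs_nonneg _)
        refine mul_le_mul (le_of_eq ?_) ?_ (by positivity) (by positivity)
        · exact Finset.prod_congr rfl fun i hi => by simp [blk, hi]
        · exact Finset.prod_le_prod (fun i _ => norm_nonneg _)
            fun i _ => res_norm_le (hp0 i) _ _
      have h2 := hoelder A hA pp hpp w hw hw1 (fun i n => ‖res (pp i) (S n) (v i)‖)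
        (fun i n => norm_nonneg _) (fun i => ‖v i‖) (fun i => norm_nonneg _)
        (fun i _ => res_sum_le (hp0 i) S hS (v i))
      calc _ ≤ ∑ n, w n ^ (1 - theta pp A) *
            (|a| * ((∏ i ∈ A, ‖res (pp i) (S n) (v i)‖) * ∏ i ∈ Aᶜ, ‖v i‖)) :=
            Finset.sum_le_sum fun n _ =>
              mul_le_mul_of_nonneg_left (h1 n) (Real.rpow_nonneg (hw n) _)
        _ = |a| * ((∑ n, w n ^ (1 - theta pp A) * ∏ i ∈ A, ‖res (pp i) (S n) (v i)‖) *
              ∏ i ∈ Aᶜ, ‖v i‖) := by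
            rw [Finset.sum_mul, Finset.mul_sum]
            exact Finset.sum_congr rfl fun n _ => by ring
        _ ≤ |a| * ((∏ i ∈ A, ‖v i‖) * ∏ i ∈ Aᶜ, ‖v i‖) :=
            mul_le_mul_of_nonneg_left (mul_le_mul_of_nonneg_right h2 (by positivity))
              (abs_nonneg _)
        _ = _ := by rw [Finset.prod_mul_prod_compl, one_mul]) t
  simpa using this

lemma base_est (hpp : ∀ i, 1 < pp i) {κ : Type*} [Fintype κ] (A : Finset (Fin N))
    (hA : A.Nonempty) (x : κ → ℝ) (v : κ → Π i, Lp' (ENNReal.ofReal (pp i)))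
    (hv1 : ∀ n i, ‖v n i‖ ≤ 1)
    (hdisj : ∀ i ∈ A, ∀ n m k, n ≠ m → v n i k = 0 ∨ v m i k = 0)
    (hconst : ∀ i, i ∉ A → ∀ n m, v n i = v m i) :
    nu pp (∑ n, x n • (tprod ℝ (v n) : TT pp)) ≤
      (∑ n, |x n| ^ (1 / theta pp A)) ^ (theta pp A) := by
  classical
  have hp0 : ∀ i, 0 < pp i := fun i => lt_trans one_pos (hpp i)
  rcases isEmpty_or_nonempty κ with hκ | ⟨⟨n0⟩⟩
  · simp only [Finset.univ_eq_empty, Finset.sum_empty, map_zero]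
    exact Real.rpow_nonneg le_rfl _
  by_cases h : 1 ≤ ∑ i ∈ A, 1 / pp i
  · have ht : theta pp A = 1 := min_eq_left h
    rw [ht]
    simp only [div_one, Real.rpow_one]
    refine (Finset.le_sum_of_subadditive (nu pp) (map_zero _).le (map_add_le_add _) _ _).trans
      (Finset.sum_le_sum fun n _ => ?_)
    refine (norm_smul_tprod_le _ _).trans (mul_le_of_le_one_right (abs_nonneg _) ?_)
    exact Finset.prod_le_one (fun i _ => norm_nonneg _) fun i _ => hv1 n i
  · push Not at h
    have ht : theta pp A = ∑ i ∈ A, 1 / pp i := min_eq_right h.le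
    have htp := theta_pos hpp hA
    set θ := theta pp A with hθ
    obtain ⟨i0, hi0⟩ := hA
    let c : κ → Fin N → ℝ := fun n i =>
      if i ∈ A then (if i = i0 then (SignType.sign (x n) : ℝ) else 1) * |x n| ^ (1 / θ / pp i)
      else 1
    let u : κ → Π i, Lp' (ENNReal.ofReal (pp i)) := fun n i => c n i • v n i
    have hc : ∀ n, ∏ i, c n i = x n := by
      intro n
      rw [← Finset.prod_mul_prod_compl A]
      have h1 : ∏ i ∈ Aᶜ, c n i = 1 := Finset.prod_eq_one fun i hi => by
        simp only [Finset.mem_compl] at hi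
        simp [c, hi]
      have h2 : ∏ i ∈ A, c n i = ∏ i ∈ A, ((if i = i0 then (SignType.sign (x n) : ℝ) else 1) *
          |x n| ^ (1 / θ / pp i)) := Finset.prod_congr rfl fun i hi => by simp [c, hi]
      rw [h1, h2, mul_one, Finset.prod_mul_distrib, Finset.prod_ite_eq' A i0, if_pos hi0]
      by_cases hx : x n = 0
      · simp [hx]
      · rw [← Real.rpow_sum_of_pos (by positivity)]
        have : ∑ i ∈ A, 1 / θ / pp i = 1 := by
          have : ∀ i ∈ A, 1 / θ / pp i = 1 / θ * (1 / pp i) := fun i _ => by ring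
          rw [Finset.sum_congr rfl this, ← Finset.mul_sum, ← ht, one_div_mul_cancel htp.ne']
        rw [this, Real.rpow_one, sign_mul_abs]
    have hu : ∀ n, x n • (tprod ℝ (v n) : TT pp) = tprod ℝ (u n) := by
      intro n
      rw [← hc n, ← MultilinearMap.map_smul_univ]
    simp_rw [hu]
    obtain ⟨ε, hε⟩ := rad_multi (nu pp) (tprod ℝ) n0 i0 (A.erase i0) (by simp) u
      (by
        intro i hi hne n
        have : i ∉ A := fun h => hi (Finset.mem_erase.2 ⟨hne, h⟩)
        simp only [u, c, this, if_false]
        rw [hconst i this n n0])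
    refine le_trans hε ((nu_tprod_le _).trans ?_)
    set X := ∑ n, |x n| ^ (1 / θ) with hX
    have hX0 : 0 ≤ X := by positivity
    have hcabs : ∀ i ∈ A, ∀ n, |c n i| ≤ |x n| ^ (1 / θ / pp i) := by
      intro i hi n
      simp only [c, hi, if_true, abs_mul]
      rw [abs_of_nonneg (Real.rpow_nonneg (abs_nonneg (x n)) _)]
      refine mul_le_of_le_one_left (by positivity) ?_
      split_ifs
      · rcases lt_trichotomy (x n) 0 with h | h | h <;> simp [h]
      · simp
    have hA' : ∀ i ∈ A, ‖(if i ∈ A.erase i0 ∨ i = i0 then ∑ n, ((ε i n : ℤ) : ℝ) • u n i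
        else u n0 i)‖ ≤ X ^ (1 / pp i) := by
      intro i hi
      have : i ∈ A.erase i0 ∨ i = i0 := by
        by_cases h : i = i0
        · exact Or.inr h
        · exact Or.inl (Finset.mem_erase.2 ⟨h, hi⟩)
      rw [if_pos this]
      simp only [u, smul_smul]
      refine (disj_le (hp0 i) _ _ (hdisj i hi) (fun n => hv1 n i)).trans ?_
      refine Real.rpow_le_rpow (by positivity) ?_ (by have := hp0 i; positivity)
      refine Finset.sum_le_sum fun n _ => ?_
      have e1 : |((ε i n : ℤ) : ℝ) * c n i| = |c n i| := by
        rcases Int.units_eq_one_or (ε i n) with h | h <;> simp [h]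
      rw [e1]
      calc _ ≤ (|x n| ^ (1 / θ / pp i)) ^ pp i :=
            Real.rpow_le_rpow (abs_nonneg _) (hcabs i hi n) (hp0 i).le
        _ = _ := by
          rw [← Real.rpow_mul (abs_nonneg _), div_mul_cancel₀ _ (hp0 i).ne']
    rw [← Finset.prod_mul_prod_compl A]
    calc _ ≤ (∏ i ∈ A, X ^ (1 / pp i)) * 1 := by
          refine mul_le_mul (Finset.prod_le_prod (fun i _ => norm_nonneg _) hA') ?_
            (Finset.prod_nonneg fun i _ => norm_nonneg _)
            (Finset.prod_nonneg fun i _ => Real.rpow_nonneg hX0 _)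
          refine Finset.prod_le_one (fun i _ => norm_nonneg _) fun i hi => ?_
          have hi' : i ∉ A := Finset.mem_compl.1 hi
          have : ¬ (i ∈ A.erase i0 ∨ i = i0) := by
            rintro (h | h)
            · exact hi' (Finset.mem_of_mem_erase h)
            · exact hi' (h ▸ hi0)
          rw [if_neg this]
          simp only [u, c, hi', if_false, one_smul]
          exact hv1 n0 i
      _ = X ^ θ := by
          rw [mul_one, ht]
          rcases hX0.eq_or_lt with h0 | h0
          · rw [← h0, Real.zero_rpow (by rw [← ht]; exact htp.ne')]
            exact Finset.prod_eq_zero hi0 (Real.zero_rpow (by have := hp0 i0; positivity))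
          · rw [Real.rpow_sum_of_pos h0]

lemma upper_est (hpp : ∀ i, 1 < pp i) {κ : Type*} [Fintype κ] (A : Finset (Fin N))
    (hA : A.Nonempty) (S : κ → Set ℕ) (hS : Pairwise (fun n m => Disjoint (S n) (S m)))
    (γ : Fin N → ℕ) (t : κ → TT pp) (C : ℝ) (hC : 0 < C) (ht : ∀ n, nu pp (t n) < C) :
    nu pp (∑ n, boxP pp (blk A (S n) (fun i => {γ i})) (t n)) ≤
      C * (Fintype.card κ : ℝ) ^ theta pp A := by
  classical
  have hp0 : ∀ i, 0 < pp i := fun i => lt_trans one_pos (hpp i)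
  let L : (κ → TT pp) →ₗ[ℝ] TT pp :=
    ∑ n, (boxP pp (blk A (S n) (fun i => {γ i}))).comp (LinearMap.proj n)
  have hL : ∀ t, L t = ∑ n, boxP pp (blk A (S n) (fun i => {γ i})) (t n) := by
    intro t; simp [L]
  let K : ℝ := (Fintype.card κ : ℝ) ^ theta pp A
  have hcv : Convex ℝ {t : κ → TT pp | nu pp (L t) ≤ K} := by
    simpa using ((nu pp).comp L).convexOn.convex_le K
  have hbase : Set.pi Set.univ (fun _ : κ => elemSet (fun i => Lp' (ENNReal.ofReal (pp i)))) ⊆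
      {t : κ → TT pp | nu pp (L t) ≤ K} := by
    intro t ht
    simp only [Set.mem_pi, Set.mem_univ, true_imp_iff, elemSet, Set.mem_setOf_eq] at ht
    choose b w hb hw ht using ht
    show nu pp (L t) ≤ K
    rw [hL]
    let c : κ → Fin N → ℝ := fun n i => if i ∈ A then 1 else w n i (γ i)
    let v : κ → Π i, Lp' (ENNReal.ofReal (pp i)) := fun n i =>
      if i ∈ A then res (pp i) (S n) (w n i) else e' _ (γ i)
    have hc : ∀ n i, |c n i| ≤ 1 := by
      intro n i
      simp only [c]
      split_ifs
      · simp
      · exact (lp.norm_apply_le_norm (by simpa using hp0 i) (w n i) (γ i)).trans (hw n i)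
    have e1 : ∀ n, boxP pp (blk A (S n) (fun i => {γ i})) (t n) =
        (b n * ∏ i, c n i) • tprod ℝ (v n) := by
      intro n
      rw [ht n, map_smul, boxP_tprod, mul_smul, ← MultilinearMap.map_smul_univ]
      congr 2
      ext1 i
      by_cases hi : i ∈ A
      · simp [blk, c, v, hi]
      · simp only [blk, c, v, hi, if_false]
        exact res_singleton _ _
    simp_rw [e1]
    refine (base_est hpp A hA _ v ?_ ?_ ?_).trans ?_
    · intro n i
      simp only [v]
      split_ifs
      · exact (res_norm_le (hp0 i) _ _).trans (hw n i)
      · exact (e'_norm (hp0 i) _).le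
    · intro i hi n m k hnm
      simp only [v, hi, if_true, res_apply]
      by_cases hk : k ∈ S n
      · right
        exact Set.indicator_of_notMem (fun h => Set.disjoint_left.1 (hS hnm) hk h) _
      · left
        exact Set.indicator_of_notMem hk _
    · intro i hi n m
      simp [v, hi]
    · have htp := theta_pos hpp hA
      refine Real.rpow_le_rpow (by positivity) ?_ htp.le
      calc _ ≤ ∑ n : κ, (1 : ℝ) := by
            refine Finset.sum_le_sum fun n _ => Real.rpow_le_one (abs_nonneg _) ?_ (by positivity)
            rw [abs_mul, Finset.abs_prod]
            exact mul_le_one₀ (hb n) (by positivity)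
              (Finset.prod_le_one (fun i _ => abs_nonneg _) fun i _ => hc n i)
        _ = _ := by simp
  have h1 : (fun n => C⁻¹ • t n) ∈ {t : κ → TT pp | nu pp (L t) ≤ K} := by
    refine convexHull_min hbase hcv ?_
    rw [convexHull_pi]
    intro n _
    refine ball_subset _ ?_
    show nu pp (C⁻¹ • t n) < 1
    rw [map_smul_eq_mul, norm_inv, Real.norm_eq_abs, abs_of_pos hC, inv_mul_lt_iff₀ hC, mul_one]
    exact ht n
  have h2 : L (fun n => C⁻¹ • t n) = C⁻¹ • L t := by
    rw [← map_smul]; rfl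
  simp only [Set.mem_setOf_eq] at h1
  rw [h2, map_smul_eq_mul, norm_inv, Real.norm_eq_abs, abs_of_pos hC, inv_mul_le_iff₀ hC, hL] at h1
  exact h1

end Tensor

section Suff

lemma embed_of_eq {X : Type*} [NormedAddCommGroup X] [NormedSpace ℝ X] [CompleteSpace X]
    (p : ℝ) (hp : 1 ≤ p) [Fact (1 ≤ ENNReal.ofReal p)] (u : ℕ → X)
    (hu : ∀ (s : Finset ℕ) (x : ℕ → ℝ), ‖∑ n ∈ s, x n • u n‖ ^ p = ∑ n ∈ s, |x n| ^ p) :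
    EmbedsIn (Lp' (ENNReal.ofReal p)) X := by
  have hp0 : 0 < p := lt_of_lt_of_le one_pos hp
  have hsum : ∀ x : Lp' (ENNReal.ofReal p), Summable (fun n => x n • u n) := by
    intro x
    rw [summable_iff_vanishing_norm]
    intro ε hε
    obtain ⟨s, hs⟩ := summable_iff_vanishing_norm.1 (lp_hasSum hp0 x).summable (ε ^ p)
      (Real.rpow_pos_of_pos hε _)
    refine ⟨s, fun t ht => ?_⟩
    have := hs t ht
    rw [Real.norm_of_nonneg (Finset.sum_nonneg fun n _ => Real.rpow_nonneg (abs_nonneg _) _),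
      ← hu t (fun n => x n)] at this
    exact (Real.rpow_lt_rpow_iff (norm_nonneg _) hε.le hp0).1 this
  have hnorm : ∀ x : Lp' (ENNReal.ofReal p), ‖∑' n, x n • u n‖ = ‖x‖ := by
    intro x
    have h1 : Filter.Tendsto (fun s : Finset ℕ => ‖∑ n ∈ s, x n • u n‖ ^ p) Filter.atTop
        (nhds (‖∑' n, x n • u n‖ ^ p)) :=
      ((hsum x).hasSum.norm).rpow_const (Or.inr hp0.le)
    have h2 : Filter.Tendsto (fun s : Finset ℕ => ‖∑ n ∈ s, x n • u n‖ ^ p) Filter.atTop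
        (nhds (‖x‖ ^ p)) := by
      refine Filter.Tendsto.congr (fun s => (hu s (fun n => x n)).symm) (lp_hasSum hp0 x)
    have := tendsto_nhds_unique h1 h2
    exact Real.rpow_left_injOn hp0.ne' (norm_nonneg _) (lp.norm_nonneg' _) this
  let f : Lp' (ENNReal.ofReal p) →ₗ[ℝ] X :=
    { toFun := fun x => ∑' n, x n • u n
      map_add' := fun x y => by
        rw [← (hsum x).tsum_add (hsum y)]
        exact tsum_congr fun n => by rw [lp.coeFn_add, Pi.add_apply, add_smul]
      map_smul' := fun c x => by
        rw [RingHom.id_apply, ← (hsum x).tsum_const_smul]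
        exact tsum_congr fun n => by rw [lp.coeFn_smul, Pi.smul_apply, smul_eq_mul, mul_smul] }
  refine ⟨f.mkContinuous 1 (fun x => ?_), 1, one_pos, fun x => ?_⟩
  · rw [one_mul]; exact (hnorm x).le
  · rw [one_mul]; exact (hnorm x).ge

variable {N : ℕ} {pp : Fin N → ℝ} [∀ i, Fact (1 ≤ ENNReal.ofReal (pp i))]

/-- algebraic basis tensors -/
def bT (pp : Fin N → ℝ) (α : Fin N → ℕ) : TT pp :=
  tprod ℝ (fun i => e' (ENNReal.ofReal (pp i)) (α i))

/-- evaluation functional -/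
def evl (q : ℝ) (k : ℕ) : Lp' (ENNReal.ofReal q) →ₗ[ℝ] ℝ where
  toFun f := f k
  map_add' f g := rfl
  map_smul' c f := rfl

/-- coordinate functional -/
def coef (pp : Fin N → ℝ) (α : Fin N → ℕ) : TT pp →ₗ[ℝ] ℝ :=
  PiTensorProduct.lift ((MultilinearMap.mkPiAlgebra ℝ (Fin N) ℝ).compLinearMap
    (fun i => evl (pp i) (α i)))

lemma coef_tprod (α : Fin N → ℕ) (w : Π i, Lp' (ENNReal.ofReal (pp i))) :
    coef pp α (tprod ℝ w) = ∏ i, w i (α i) := by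
  simp only [coef, PiTensorProduct.lift.tprod, MultilinearMap.compLinearMap_apply,
    MultilinearMap.mkPiAlgebra_apply]
  rfl

lemma coef_le (hpp : ∀ i, 1 < pp i) (α : Fin N → ℕ) (t : TT pp) : |coef pp α t| ≤ nu pp t := by
  have := nu_dominate (fun t : TT pp => |coef pp α t|) 1 zero_le_one (by simp)
    (fun x y => by rw [map_add]; exact abs_add_le _ _) (fun a w => by
      rw [map_smul, coef_tprod, smul_eq_mul, abs_mul, one_mul, Finset.abs_prod]
      gcongr with i
      exact lp.norm_apply_le_norm (by simpa using lt_trans one_pos (hpp i)) (w i) (α i)) t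
  simpa using this

lemma nu_bT_ge (hpp : ∀ i, 1 < pp i) (α : Fin N → ℕ) : 1 ≤ nu pp (bT pp α) := by
  have := coef_le hpp α (bT pp α)
  have h2 : coef pp α (bT pp α) = 1 := by
    rw [bT, coef_tprod]
    simp [e'_apply]
  rwa [h2, abs_one] at this

lemma boxP_bT (S : Fin N → Set ℕ) (α : Fin N → ℕ) [Decidable (∀ i, α i ∈ S i)] :
    boxP pp S (bT pp α) = if ∀ i, α i ∈ S i then bT pp α else 0 := by
  classical
  rw [bT, boxP_tprod]
  split_ifs with h
  · congr 1
    ext1 i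
    rw [res_e', if_pos (h i)]
  · push Not at h
    obtain ⟨i, hi⟩ := h
    exact (PiTensorProduct.tprod ℝ).map_coord_zero i (by rw [res_e', if_neg hi])

lemma diag_eq (hpp : ∀ i, 1 < pp i) (A : Finset (Fin N)) (hA : A.Nonempty) (p : ℝ) (hp : 1 ≤ p)
    (hpA : 1 / p = theta pp A) (s : Finset ℕ) (x : ℕ → ℝ) :
    nu pp (∑ n ∈ s, x n • bT pp (fun i => if i ∈ A then n else 0)) ^ p = ∑ n ∈ s, |x n| ^ p := by
  have hp0 : 0 < p := lt_of_lt_of_le one_pos hp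
  have hpi : ∀ i, 0 < pp i := fun i => lt_trans one_pos (hpp i)
  have hpt : 1 / theta pp A = p := by rw [← hpA]; simp
  set X := ∑ n ∈ s, |x n| ^ p with hX
  have hX0 : 0 ≤ X := Finset.sum_nonneg fun n _ => Real.rpow_nonneg (abs_nonneg _) _
  have hup : nu pp (∑ n ∈ s, x n • bT pp (fun i => if i ∈ A then n else 0)) ≤ X ^ (theta pp A) := by
    have := base_est hpp A hA (κ := s) (fun n => x n)
      (fun n i => e' (ENNReal.ofReal (pp i)) (if i ∈ A then (n : ℕ) else 0))
      (fun n i => (e'_norm (hpi i) _).le)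
      (fun i hi n m k hnm => by
        simp only [hi, if_true, e'_apply]
        by_cases h : k = n
        · right
          rw [if_neg]
          intro h2
          exact hnm (Subtype.ext (h.symm.trans h2))
        · left; rw [if_neg h])
      (fun i hi n m => by simp [hi])
    rw [hpt] at this
    rw [Finset.sum_coe_sort s (fun n => |x n| ^ p)] at this
    refine le_trans (le_of_eq ?_) this
    rw [← Finset.sum_coe_sort s]
    rfl
  have hlow : X ^ (theta pp A) ≤ nu pp (∑ n ∈ s, x n • bT pp (fun i => if i ∈ A then n else 0)) := by
    rcases hX0.eq_or_lt with h0 | h0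
    · rw [← h0, Real.zero_rpow (theta_pos hpp hA).ne']
      exact apply_nonneg _ _
    have := lower_est hpp A hA (κ := s) (fun n => {(n : ℕ)})
      (fun n m hnm => by
        refine Set.disjoint_singleton.2 ?_
        exact fun h => hnm (Subtype.ext h)) (fun _ => {0})
      (fun n => |x n| ^ p / X) (fun n => by positivity)
      (by
        rw [Finset.sum_coe_sort s (fun n => |x n| ^ p / X), ← Finset.sum_div, div_self h0.ne'])
      (∑ n ∈ s, x n • bT pp (fun i => if i ∈ A then n else 0))
    refine le_trans ?_ this
    have hbox : ∀ n : s, boxP pp (blk A {(n : ℕ)} (fun _ => {0}))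
        (∑ n ∈ s, x n • bT pp (fun i => if i ∈ A then n else 0)) =
        x n • bT pp (fun i => if i ∈ A then (n : ℕ) else 0) := by
      classical
      intro n
      rw [map_sum, Finset.sum_eq_single (n : ℕ)]
      · rw [map_smul, boxP_bT, if_pos]
        intro i
        by_cases hi : i ∈ A <;> simp [blk, hi]
      · intro m hm hmn
        rw [map_smul, boxP_bT, if_neg, smul_zero]
        intro h
        obtain ⟨i, hi⟩ := hA
        have := h i
        simp only [blk, hi, if_true, Set.mem_singleton_iff] at this
        exact hmn this
      · intro h; exact absurd n.2 h
    have hterm : ∀ n : s, |x n| ^ p * X ^ (theta pp A - 1) ≤ (|x n| ^ p / X) ^ (1 - theta pp A) *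
        nu pp (boxP pp (blk A {(n : ℕ)} (fun _ => {0}))
          (∑ n ∈ s, x n • bT pp (fun i => if i ∈ A then n else 0))) := by
      intro n
      rw [hbox n, map_smul_eq_mul, Real.norm_eq_abs]
      have e1 : |x n| ^ p * X ^ (theta pp A - 1) = (|x n| ^ p / X) ^ (1 - theta pp A) * |x n| := by
        rw [Real.div_rpow (by positivity) hX0, ← neg_sub, Real.rpow_neg hX0]
        rcases (abs_nonneg (x n)).eq_or_lt with h | h
        · rw [← h, Real.zero_rpow hp0.ne']; simp
        · rw [← Real.rpow_mul h.le, ← hpA]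
          have : |x n| ^ p = |x n| ^ (p * (1 - 1 / p)) * |x n| := by
            rw [← Real.rpow_add_one h.ne']
            congr 1
            field_simp
            ring
          rw [this]
          ring
      rw [e1]
      refine mul_le_mul_of_nonneg_left ?_ (by positivity)
      exact le_mul_of_one_le_right (abs_nonneg _) (nu_bT_ge hpp _)
    refine le_trans ?_ (Finset.sum_le_sum fun n _ => hterm n)
    rw [Finset.sum_coe_sort s (fun n => |x n| ^ p * X ^ (theta pp A - 1)), ← Finset.sum_mul, ← hX,
      Real.rpow_sub_one h0.ne']
    field_simp
    exact le_rfl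
  rw [le_antisymm hup hlow, ← Real.rpow_mul hX0, ← hpA, one_div_mul_cancel hp0.ne', Real.rpow_one]

/-- the canonical linear map into the completion -/
def cN (pp : Fin N → ℝ) [∀ i, Fact (1 ≤ ENNReal.ofReal (pp i))] : TT pp →ₗ[ℝ] LpT pp :=
  (UniformSpace.Completion.toComplL (𝕜 := ℝ) (E := TT pp)).toLinearMap

lemma norm_cN (t : TT pp) : ‖cN pp t‖ = nu pp t := UniformSpace.Completion.norm_coe _

lemma suff (hpp : ∀ i, 1 < pp i) (A : Finset (Fin N)) (hA : A.Nonempty) (p : ℝ) (hp : 1 ≤ p)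
    [Fact (1 ≤ ENNReal.ofReal p)] (hpA : 1 / p = theta pp A) :
    EmbedsIn (Lp' (ENNReal.ofReal p)) (LpT pp) := by
  refine embed_of_eq p hp (fun n => cN pp (bT pp (fun i => if i ∈ A then n else 0))) ?_
  intro s x
  rw [← diag_eq hpp A hA p hp hpA s x, ← norm_cN, map_sum]
  simp_rw [map_smul]
  rfl

end Suff

section Small

/-- finitely supported sequences -/
abbrev C00 : Type := ℕ →₀ ℝ

lemma geo (s : Finset ℕ) : ∑ n ∈ s, (1 / 2 : ℝ) ^ (n + 1) ≤ 1 := by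
  have h : Summable (fun n : ℕ => (1 / 2 : ℝ) ^ (n + 1)) :=
    (summable_nat_add_iff 1).2 summable_geometric_two
  refine (h.sum_le_tsum s (fun n _ => by positivity)).trans ?_
  simp_rw [pow_succ]
  rw [tsum_mul_right, tsum_geometric_two]
  norm_num

/-- inclusion of finitely supported sequences in `ℓ_p` -/
def iota (p : ℝ) : C00 →ₗ[ℝ] Lp' (ENNReal.ofReal p) :=
  Finsupp.linearCombination ℝ (fun n => e' (ENNReal.ofReal p) n)

variable {p : ℝ}

lemma iota_apply (x : C00) (k : ℕ) : iota p x k = x k := by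
  rw [iota, Finsupp.linearCombination_apply, Finsupp.sum, lp.coeFn_sum, Finset.sum_apply]
  simp only [lp.coeFn_smul, Pi.smul_apply, e'_apply, smul_eq_mul, mul_ite, mul_one, mul_zero]
  rw [Finset.sum_ite_eq]
  split_ifs with h
  · rfl
  · exact (Finsupp.notMem_support_iff.1 h).symm

/-- the `ℓ_p` norm -/
def ln (p : ℝ) (x : C00) : ℝ := ‖iota p x‖

lemma ln_nonneg (x : C00) : 0 ≤ ln p x := lp.norm_nonneg' _

lemma ln_mono (hp : 0 < p) {x y : C00} (h : ∀ k, |x k| ≤ |y k|) : ln p x ≤ ln p y := by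
  refine (Real.rpow_le_rpow_iff (ln_nonneg _) (ln_nonneg _) hp).1 ?_
  refine hasSum_le (fun k => ?_) (lp_hasSum hp (iota p x)) (lp_hasSum hp (iota p y))
  rw [iota_apply, iota_apply]
  exact Real.rpow_le_rpow (abs_nonneg _) (h k) hp.le

lemma ln_coord (hp : 0 < p) (x : C00) (k : ℕ) : |x k| ≤ ln p x := by
  have := lp.norm_apply_le_norm (by simpa using hp) (iota p x) k
  rwa [iota_apply] at this

lemma ln_pos (hp : 0 < p) {x : C00} (h : x ≠ 0) : 0 < ln p x := by
  obtain ⟨k, hk⟩ := Finsupp.ne_iff.1 h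
  exact (abs_pos.2 hk).trans_le (ln_coord hp x k)

lemma ln_smul (hp : 1 ≤ p) (a : ℝ) (x : C00) : ln p (a • x) = |a| * ln p x := by
  have : Fact (1 ≤ ENNReal.ofReal p) := ⟨by simpa using hp⟩
  rw [ln, map_smul, norm_smul, Real.norm_eq_abs, ln]

/-- block sequences -/
def IsBlock (k : ℕ → ℕ) (x : ℕ → C00) : Prop :=
  StrictMono k ∧ ∀ n j, x n j ≠ 0 → k n ≤ j ∧ j < k (n + 1)

lemma IsBlock.disj {k : ℕ → ℕ} {x : ℕ → C00} (h : IsBlock k x) {n m j : ℕ} (hnm : n ≠ m) :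
    x n j = 0 ∨ x m j = 0 := by
  by_contra hc
  push Not at hc
  have h1 := h.2 n j hc.1
  have h2 := h.2 m j hc.2
  rcases lt_or_gt_of_ne hnm with h3 | h3
  · have := h.1.monotone (Nat.succ_le_of_lt h3)
    simp only [Nat.succ_eq_add_one] at this
    omega
  · have := h.1.monotone (Nat.succ_le_of_lt h3)
    simp only [Nat.succ_eq_add_one] at this
    omega

lemma IsBlock.coord (hp : 1 ≤ p) {k : ℕ → ℕ} {x : ℕ → C00} (h : IsBlock k x)
    (h1 : ∀ n, ln p (x n) = 1) (s : Finset ℕ) (a : ℕ → ℝ) {n : ℕ} (hn : n ∈ s) :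
    |a n| ≤ ln p (∑ m ∈ s, a m • x m) := by
  have : |a n| = ln p (a n • x n) := by rw [ln_smul hp, h1, mul_one]
  rw [this]
  refine ln_mono (by linarith) fun j => ?_
  by_cases hj : x n j = 0
  · simp [hj]
  · rw [Finsupp.finset_sum_apply, Finset.sum_eq_single n]
    · intro m _ hm
      rw [Finsupp.smul_apply, (h.disj hm).resolve_right hj, smul_zero]
    · intro h; exact absurd hn h

lemma IsBlock.sum (hp : 1 ≤ p) {k : ℕ → ℕ} {x : ℕ → C00} (h : IsBlock k x)
    (h1 : ∀ n, ln p (x n) = 1) (M : ℕ) :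
    ln p (∑ m ∈ Finset.range M, x m) = (M : ℝ) ^ (1 / p) := by
  have hp0 : 0 < p := by linarith
  have := disj_eq (κ := Fin M) hp0 (fun _ => 1) (fun n => iota p (x n)) (fun n m j hnm => by
    rw [iota_apply, iota_apply]
    exact h.disj (fun hh => hnm (Fin.ext hh)))
  have h2 : ∀ n, ‖iota p (x n)‖ = 1 := h1
  simp only [one_smul, h2, abs_one, Real.one_rpow, mul_one, Finset.sum_const, Finset.card_univ,
    Fintype.card_fin, nsmul_eq_mul] at this
  rw [← map_sum, Fin.sum_univ_eq_sum_range (fun n => x n)] at this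
  rw [← this, ← ln, ← Real.rpow_mul (ln_nonneg _), mul_one_div_cancel hp0.ne', Real.rpow_one]

/-- big subspaces -/
def Big (W : Submodule ℝ C00) : Prop := ∀ k : ℕ, ∃ x ∈ W, x ≠ 0 ∧ ∀ j < k, x j = 0

lemma exists_bd (x : C00) : ∃ k : ℕ, ∀ j, x j ≠ 0 → j < k := by
  refine ⟨x.support.sup id + 1, fun j hj => Nat.lt_succ_of_le ?_⟩
  exact Finset.le_sup (f := id) (Finsupp.mem_support_iff.2 hj)

lemma Big.ker {W : Submodule ℝ C00} (hW : Big W) (g : C00 →ₗ[ℝ] ℝ) : Big (W ⊓ LinearMap.ker g) := by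
  intro k
  obtain ⟨x, hxW, hx0, hxk⟩ := hW k
  by_cases hg : g x = 0
  · exact ⟨x, ⟨hxW, hg⟩, hx0, hxk⟩
  obtain ⟨k2, hk2⟩ := exists_bd x
  obtain ⟨y, hyW, hy0, hyk⟩ := hW (max k k2)
  refine ⟨g y • x - g x • y, ⟨W.sub_mem (W.smul_mem _ hxW) (W.smul_mem _ hyW), ?_⟩, ?_, ?_⟩
  · show g (g y • x - g x • y) = 0
    rw [map_sub, map_smul, map_smul, smul_eq_mul, smul_eq_mul]
    ring
  · obtain ⟨j, hj⟩ := Finsupp.ne_iff.1 hy0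
    have hxj : x j = 0 := by
      by_contra h
      exact hj (hyk j (lt_max_of_lt_right (hk2 j h)))
    intro h0
    have := DFunLike.congr_fun h0 j
    have h3 : g y * x j - g x * y j = 0 := this
    rw [hxj, mul_zero, zero_sub, neg_eq_zero, mul_eq_zero] at h3
    exact h3.elim hg hj
  · intro j hj
    simp [hxk j hj, hyk j (lt_max_of_lt_left hj)]

lemma Big.ker_finset {I : Type*} {W : Submodule ℝ C00} (hW : Big W) (g : I → C00 →ₗ[ℝ] ℝ)
    (s : Finset I) : ∃ W' ≤ W, Big W' ∧ ∀ i ∈ s, ∀ x ∈ W', g i x = 0 := by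
  classical
  induction s using Finset.induction_on with
  | empty => exact ⟨W, le_rfl, hW, by simp⟩
  | insert i s _ ih =>
    obtain ⟨W', h1, h2, h3⟩ := ih
    refine ⟨W' ⊓ LinearMap.ker (g i), inf_le_left.trans h1, h2.ker _, ?_⟩
    intro j hj x hx
    rcases Finset.mem_insert.1 hj with rfl | hj
    · exact hx.2
    · exact h3 j hj x hx.1

/-- vectors supported in `[k,∞)` -/
def tailS (k : ℕ) : Submodule ℝ C00 where
  carrier := {x | ∀ j < k, x j = 0}
  add_mem' {x y} hx hy := fun j hj => by simp [hx j hj, hy j hj]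
  zero_mem' := fun j _ => rfl
  smul_mem' c x hx := fun j hj => by simp [hx j hj]

lemma Big.tail {W : Submodule ℝ C00} (hW : Big W) (k : ℕ) : Big (W ⊓ tailS k) := by
  intro k2
  obtain ⟨x, hxW, hx0, hxk⟩ := hW (max k k2)
  exact ⟨x, ⟨hxW, fun j hj => hxk j (lt_max_of_lt_left hj)⟩, hx0,
    fun j hj => hxk j (lt_max_of_lt_right hj)⟩

/-- seminorms that can be made small on big subspaces -/
def SmallS (p : ℝ) (f : Seminorm ℝ C00) : Prop :=
  ∀ W, Big W → ∀ ε : ℝ, 0 < ε → ∃ W' ≤ W, Big W' ∧ ∀ x ∈ W', f x ≤ ε * ln p x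

lemma small_finset {I : Type*} (f : I → Seminorm ℝ C00) (s : Finset I)
    (h : ∀ i ∈ s, SmallS p (f i)) {W : Submodule ℝ C00} (hW : Big W) {ε : ℝ} (hε : 0 < ε) :
    ∃ W' ≤ W, Big W' ∧ ∀ i ∈ s, ∀ x ∈ W', f i x ≤ ε * ln p x := by
  classical
  induction s using Finset.induction_on with
  | empty => exact ⟨W, le_rfl, hW, by simp⟩
  | insert i s _ ih =>
    obtain ⟨W', h1, h2, h3⟩ := ih fun j hj => h j (Finset.mem_insert_of_mem hj)
    obtain ⟨W'', h4, h5, h6⟩ := h i (Finset.mem_insert_self _ _) W' h2 ε hε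
    refine ⟨W'', h4.trans h1, h5, ?_⟩
    intro j hj x hx
    rcases Finset.mem_insert.1 hj with rfl | hj
    · exact h6 x hx
    · exact h3 j hj x (h4 hx)

/-- extraction of block sequences -/
lemma extract (g : ℕ → C00) (hg : ∀ k j, j < k → g k j = 0) (b : C00 → ℕ) :
    ∃ k : ℕ → ℕ, IsBlock k (fun n => g (k n)) ∧ (∀ n, n ≤ k n) ∧ ∀ n, b (g (k n)) ≤ k (n + 1) := by
  choose bd hbd using exists_bd
  let k : ℕ → ℕ := fun n => Nat.rec 0 (fun _ m => max (m + 1) (max (bd (g m)) (b (g m)))) n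
  have hk : ∀ n, k (n + 1) = max (k n + 1) (max (bd (g (k n))) (b (g (k n)))) := fun n => rfl
  have hmono : StrictMono k := strictMono_nat_of_lt_succ fun n => by
    rw [hk]; exact lt_of_lt_of_le (Nat.lt_succ_self _) (le_max_left _ _)
  refine ⟨k, ⟨hmono, fun n j hj => ⟨?_, ?_⟩⟩, fun n => hmono.id_le n, fun n => ?_⟩
  · by_contra h
    exact hj (hg _ _ (not_le.1 h))
  · rw [hk]
    exact lt_of_lt_of_le (hbd _ j hj) ((le_max_left _ _).trans (le_max_right _ _))
  · rw [hk]
    exact (le_max_right _ _).trans (le_max_right _ _)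

lemma exists_unit (hp : 1 ≤ p) {W : Submodule ℝ C00} {f : Seminorm ℝ C00} {c : ℝ} {x : C00}
    (hx : x ∈ W) (hx0 : x ≠ 0) (hf : f x ≤ c * ln p x) :
    ∃ y ∈ W, ln p y = 1 ∧ f y ≤ c := by
  have h0 := ln_pos (p := p) (by linarith) hx0
  refine ⟨(ln p x)⁻¹ • x, W.smul_mem _ hx, ?_, ?_⟩
  · rw [ln_smul hp, abs_of_pos (inv_pos.2 h0), inv_mul_cancel₀ h0.ne']
  · rw [map_smul_eq_mul, Real.norm_eq_abs, abs_of_pos (inv_pos.2 h0), inv_mul_le_iff₀ h0]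
    linarith

lemma not_small (hp : 1 ≤ p) {f : Seminorm ℝ C00} (hf : ¬ SmallS p f) :
    ∃ W, Big W ∧ ∃ c : ℝ, 0 < c ∧ ∀ x ∈ W, c * ln p x ≤ f x := by
  have hp0 : 0 < p := by linarith
  by_contra hcon
  push Not at hcon
  refine hf fun W hW ε hε => ?_
  have : ∀ k : ℕ, ∃ y ∈ W ⊓ tailS k, ln p y = 1 ∧ f y ≤ ε * (1 / 2) ^ (k + 1) := by
    intro k
    obtain ⟨x, hx, hxf⟩ := hcon _ (hW.tail k) (ε * (1 / 2) ^ (k + 1)) (by positivity)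
    refine exists_unit hp hx ?_ hxf.le
    rintro rfl
    rw [map_zero, ln, map_zero, lp.norm_zero, mul_zero] at hxf
    exact lt_irrefl _ hxf
  choose g hgW hg1 hgf using this
  obtain ⟨k, hblk, hk, -⟩ := extract g (fun k j hj => (hgW k).2 j hj) (fun _ => 0)
  refine ⟨Submodule.span ℝ (Set.range fun n => g (k n)), ?_, ?_, ?_⟩
  · rw [Submodule.span_le]
    rintro _ ⟨n, rfl⟩
    exact (hgW (k n)).1
  · intro m
    refine ⟨g (k m), Submodule.subset_span ⟨m, rfl⟩, ?_, ?_⟩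
    · intro h0
      have := hg1 (k m)
      rw [h0, ln, map_zero, lp.norm_zero] at this
      exact zero_ne_one this
    · intro j hj
      exact (hgW (k m)).2 j (lt_of_lt_of_le hj (hk m))
  · intro x hx
    rw [Finsupp.mem_span_range_iff_exists_finsupp] at hx
    obtain ⟨a, rfl⟩ := hx
    have hb := fun n (hn : n ∈ a.support) => hblk.coord hp (fun n => hg1 (k n)) a.support a hn
    rw [Finsupp.sum]
    set X := ln p (∑ i ∈ a.support, a i • g (k i)) with hX
    calc f (∑ i ∈ a.support, a i • g (k i)) ≤ ∑ i ∈ a.support, f (a i • g (k i)) :=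
          Finset.le_sum_of_subadditive f (map_zero _).le (map_add_le_add _) _ _
      _ ≤ ∑ i ∈ a.support, (ε * X) * (1 / 2) ^ (i + 1) := by
          refine Finset.sum_le_sum fun i hi => ?_
          rw [map_smul_eq_mul, Real.norm_eq_abs]
          have h1 : f (g (k i)) ≤ ε * (1 / 2) ^ (i + 1) := by
            refine (hgf (k i)).trans (mul_le_mul_of_nonneg_left ?_ hε.le)
            exact pow_le_pow_of_le_one (by norm_num) (by norm_num) (Nat.succ_le_succ (hk i))
          calc _ ≤ X * (ε * (1 / 2) ^ (i + 1)) :=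
                mul_le_mul (hb i hi) h1 (apply_nonneg _ _) (ln_nonneg _)
            _ = _ := by ring
      _ ≤ ε * X := by
          rw [← Finset.mul_sum]
          exact mul_le_of_le_one_right (mul_nonneg hε.le (ln_nonneg _)) (geo _)

end Small

section Coord

variable {N : ℕ} {pp : Fin N → ℝ} [∀ i, Fact (1 ≤ ENNReal.ofReal (pp i))]

/-- finitely supported coefficient arrays -/
abbrev ZZ (N : ℕ) : Type := (Fin N → ℕ) →₀ ℝ

/-- the tensor with given coefficients -/
def JJ (pp : Fin N → ℝ) : ZZ N →ₗ[ℝ] TT pp := Finsupp.linearCombination ℝ (bT pp)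

/-- the induced seminorm on coefficient arrays -/
def nZ (pp : Fin N → ℝ) [∀ i, Fact (1 ≤ ENNReal.ofReal (pp i))] : Seminorm ℝ (ZZ N) :=
  (nu pp).comp (JJ pp)

lemma nZ_eq (z : ZZ N) : nZ pp z = nu pp (JJ pp z) := rfl

open Classical in
/-- restriction to a box -/
def flt (S : Fin N → Set ℕ) : ZZ N →ₗ[ℝ] ZZ N where
  toFun z := z.filter (fun α => ∀ i, α i ∈ S i)
  map_add' _ _ := Finsupp.filter_add
  map_smul' _ _ := Finsupp.filter_smul

lemma flt_pos {S : Fin N → Set ℕ} {z : ZZ N} {α : Fin N → ℕ} (h : ∀ i, α i ∈ S i) :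
    flt S z α = z α := by
  classical exact Finsupp.filter_apply_pos _ _ h

lemma flt_neg {S : Fin N → Set ℕ} {z : ZZ N} {α : Fin N → ℕ} (h : ¬ ∀ i, α i ∈ S i) :
    flt S z α = 0 := by
  classical exact Finsupp.filter_apply_neg _ _ h

lemma flt_flt (S S' : Fin N → Set ℕ) (z : ZZ N) :
    flt S (flt S' z) = flt (fun i => S i ∩ S' i) z := by
  ext α
  by_cases h : ∀ i, α i ∈ S i
  · rw [flt_pos h]
    by_cases h' : ∀ i, α i ∈ S' i
    · rw [flt_pos h', flt_pos (S := fun i => S i ∩ S' i) fun i => ⟨h i, h' i⟩]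
    · rw [flt_neg h', flt_neg (S := fun i => S i ∩ S' i) fun h2 => h' fun i => (h2 i).2]
  · rw [flt_neg h, flt_neg (S := fun i => S i ∩ S' i) fun h2 => h fun i => (h2 i).1]

lemma JJ_flt (S : Fin N → Set ℕ) (z : ZZ N) : JJ pp (flt S z) = boxP pp S (JJ pp z) := by
  classical
  have : (JJ pp).comp (flt S) = (boxP pp S).comp (JJ pp) := by
    refine Finsupp.lhom_ext fun α a => ?_
    rw [LinearMap.comp_apply, LinearMap.comp_apply, JJ, Finsupp.linearCombination_single, map_smul,
      boxP_bT]
    by_cases h : ∀ i, α i ∈ S i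
    · rw [if_pos h]
      have : flt S (Finsupp.single α a) = Finsupp.single α a :=
        Finsupp.filter_single_of_pos _ h
      rw [this, Finsupp.linearCombination_single]
    · rw [if_neg h]
      have : flt S (Finsupp.single α a) = 0 :=
        Finsupp.filter_single_of_neg _ h
      rw [this, map_zero, smul_zero]
  exact LinearMap.congr_fun this z

lemma nZ_flt_le (hpp : ∀ i, 1 < pp i) (S : Fin N → Set ℕ) (z : ZZ N) :
    nZ pp (flt S z) ≤ nZ pp z := by
  rw [nZ_eq, nZ_eq, JJ_flt]
  exact boxP_norm_le hpp _ _

lemma trunc_mem (w : Π i, Lp' (ENNReal.ofReal (pp i))) (n : ℕ) :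
    (tprod ℝ (fun i => ∑ k ∈ Finset.range n, w i k • e' (ENNReal.ofReal (pp i)) k) : TT pp) ∈
      LinearMap.range (JJ pp) := by
  classical
  rw [MultilinearMap.map_sum_finset]
  refine Submodule.sum_mem _ fun r _ => ?_
  rw [MultilinearMap.map_smul_univ]
  refine Submodule.smul_mem _ _ ⟨Finsupp.single r 1, ?_⟩
  rw [JJ, Finsupp.linearCombination_single, one_smul]
  rfl

lemma e'_single (q : ℝ) (k : ℕ) (a : ℝ) :
    a • e' (ENNReal.ofReal q) k = lp.single (ENNReal.ofReal q) k a := by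
  rw [e', ← lp.single_smul, smul_eq_mul, mul_one]

variable {Y : Type*} [NormedAddCommGroup Y] [NormedSpace ℝ Y] (j : TT pp →ₗ[ℝ] Y)

/-- elementary tensors as a continuous multilinear map -/
def tpC (hj : ∀ t, ‖j t‖ = nu pp t) :
    ContinuousMultilinearMap ℝ (fun i => Lp' (ENNReal.ofReal (pp i))) Y :=
  (j.compMultilinearMap (tprod ℝ)).mkContinuous 1 (fun w => by
    rw [one_mul, LinearMap.compMultilinearMap_apply, hj]
    exact nu_tprod_le w)

lemma tprod_mem_closure (hj : ∀ t, ‖j t‖ = nu pp t) (w : Π i, Lp' (ENNReal.ofReal (pp i))) :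
    j (tprod ℝ w) ∈ (LinearMap.range (j.comp (JJ pp))).topologicalClosure := by
  have h1 : Filter.Tendsto (fun n : ℕ => (fun i => ∑ k ∈ Finset.range n,
      w i k • e' (ENNReal.ofReal (pp i)) k)) Filter.atTop (nhds w) := by
    rw [tendsto_pi_nhds]
    intro i
    have := (lp.hasSum_single (p := ENNReal.ofReal (pp i)) ENNReal.ofReal_ne_top (w i)).tendsto_sum_nat
    simp_rw [e'_single]
    exact this
  have h2 := ((tpC j hj).cont.tendsto w).comp h1
  refine mem_closure_of_tendsto h2 (Filter.Eventually.of_forall fun n => ?_)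
  obtain ⟨z, hz⟩ := trunc_mem w n
  refine ⟨z, ?_⟩
  rw [LinearMap.comp_apply, hz]
  rfl

lemma dense_JJ (hj : ∀ t, ‖j t‖ = nu pp t) (hd : DenseRange j) (u : Y) (ε : ℝ) (hε : 0 < ε) : ∃ z : ZZ N, ‖u - j (JJ pp z)‖ ≤ ε := by
  have h1 : ∀ t : TT pp, j t ∈
      (LinearMap.range (j.comp (JJ pp))).topologicalClosure := by
    intro t
    induction t using PiTensorProduct.induction_on with
    | smul_tprod r f =>
      rw [map_smul]
      exact Submodule.smul_mem _ _ (tprod_mem_closure j hj f)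
    | add x y hx hy =>
      rw [map_add]
      exact Submodule.add_mem _ hx hy
  have h2 : u ∈ (LinearMap.range (j.comp (JJ pp))).topologicalClosure := by
    have hc : IsClosed ((LinearMap.range (j.comp (JJ pp))).topologicalClosure : Set Y) :=
      Submodule.isClosed_topologicalClosure _
    exact hd.induction_on u hc h1
  obtain ⟨_, ⟨z, rfl⟩, hz⟩ := Metric.mem_closure_iff.1 h2 ε hε
  refine ⟨z, ?_⟩
  rw [dist_eq_norm] at hz
  exact hz.le

lemma discretize (hj : ∀ t, ‖j t‖ = nu pp t) (hd : DenseRange j) (p : ℝ) (hp : 1 ≤ p) [Fact (1 ≤ ENNReal.ofReal p)]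
    (h : EmbedsIn (Lp' (ENNReal.ofReal p)) Y) :
    ∃ (T : C00 →ₗ[ℝ] ZZ N) (c C : ℝ), 0 < c ∧ 0 < C ∧
      ∀ x, c * ln p x ≤ nZ pp (T x) ∧ nZ pp (T x) ≤ C * ln p x := by
  obtain ⟨f, c, hc, hf⟩ := h
  have hp0 : 0 < p := by linarith
  choose z hz using fun n : ℕ => dense_JJ j hj hd (f (e' (ENNReal.ofReal p) n)) (c / 2 * (1 / 2) ^ (n + 1))
    (by positivity)
  refine ⟨Finsupp.linearCombination ℝ z, c / 2, ‖f‖ + c / 2, by positivity, by positivity, ?_⟩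
  intro x
  have h1 : ‖f (iota p x) - j (JJ pp (Finsupp.linearCombination ℝ z x))‖ ≤ c / 2 * ln p x := by
    have e1 : f (iota p x) - j (JJ pp (Finsupp.linearCombination ℝ z x)) =
        ∑ n ∈ x.support, x n • (f (e' (ENNReal.ofReal p) n) - j (JJ pp (z n))) := by
      simp only [iota, Finsupp.linearCombination_apply, Finsupp.sum, map_sum, map_smul, smul_sub,
        Finset.sum_sub_distrib]
    rw [e1]
    calc _ ≤ ∑ n ∈ x.support, ‖x n • (f (e' (ENNReal.ofReal p) n) - j (JJ pp (z n)))‖ :=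
          norm_sum_le _ _
      _ ≤ ∑ n ∈ x.support, (c / 2 * ln p x) * (1 / 2) ^ (n + 1) := by
          refine Finset.sum_le_sum fun n _ => ?_
          rw [norm_smul, Real.norm_eq_abs]
          calc _ ≤ ln p x * (c / 2 * (1 / 2) ^ (n + 1)) :=
                mul_le_mul (ln_coord hp0 x n) (hz n) (norm_nonneg _) (ln_nonneg _)
            _ = _ := by ring
      _ ≤ _ := by
          rw [← Finset.mul_sum]
          exact mul_le_of_le_one_right (mul_nonneg (by positivity) (ln_nonneg _)) (geo _)
  have h2 := hf (iota p x)
  have h3 := f.le_opNorm (iota p x)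
  rw [nZ_eq, ← hj]
  set a := f (iota p x)
  set b := j (JJ pp (Finsupp.linearCombination ℝ z x))
  have h4 := norm_sub_norm_le a b
  have h5 := norm_sub_norm_le b a
  rw [norm_sub_rev] at h5
  change c * ln p x ≤ _ at h2
  change _ ≤ ‖f‖ * ln p x at h3
  constructor <;> linarith

end Coord

section Nec

variable {N : ℕ} {pp : Fin N → ℝ} [∀ i, Fact (1 ≤ ENNReal.ofReal (pp i))]

/-- coordinates outside `A` are less than `m` -/
def FF (A : Finset (Fin N)) (m : ℕ) (i : Fin N) : Set ℕ := if i ∈ A then Set.univ else Set.Iio m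

/-- coordinates in `A` are at least `m` -/
def upS (A : Finset (Fin N)) (m : ℕ) (i : Fin N) : Set ℕ := if i ∈ A then Set.Ici m else Set.univ

/-- coordinate `i` is less than `m` -/
def loS (i : Fin N) (m : ℕ) (j : Fin N) : Set ℕ := if j = i then Set.Iio m else Set.univ

lemma flt_congr {S S' : Fin N → Set ℕ} (z : ZZ N)
    (h : ∀ α, z α ≠ 0 → ((∀ i, α i ∈ S i) ↔ ∀ i, α i ∈ S' i)) : flt S z = flt S' z := by
  ext α
  by_cases hz : z α = 0
  · have : ∀ S : Fin N → Set ℕ, flt S z α = 0 := by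
      intro S
      by_cases h : ∀ i, α i ∈ S i
      · rw [flt_pos h, hz]
      · rw [flt_neg h]
    rw [this, this]
  · have := h α hz
    by_cases h1 : ∀ i, α i ∈ S i
    · rw [flt_pos h1, flt_pos (this.1 h1)]
    · rw [flt_neg h1, flt_neg (fun h2 => h1 (this.2 h2))]

lemma flt_id {S : Fin N → Set ℕ} (z : ZZ N) (h : ∀ α, z α ≠ 0 → ∀ i, α i ∈ S i) : flt S z = z := by
  ext α
  by_cases h1 : ∀ i, α i ∈ S i
  · rw [flt_pos h1]
  · rw [flt_neg h1]
    by_contra h2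
    exact h1 (h α (Ne.symm h2))

lemma flt_zero {S : Fin N → Set ℕ} (z : ZZ N) (h : ∀ α, (∀ i, α i ∈ S i) → z α = 0) :
    flt S z = 0 := by
  ext α
  by_cases h1 : ∀ i, α i ∈ S i
  · rw [flt_pos h1, h α h1]; rfl
  · rw [flt_neg h1]; rfl

lemma diff_le (hpp : ∀ i, 1 < pp i) (m : ℕ) (z : ZZ N) (B : Finset (Fin N)) :
    nZ pp (flt (upS B m) z - z) ≤ ∑ i ∈ B, nZ pp (flt (loS i m) z) := by
  classical
  induction B using Finset.induction_on with
  | empty =>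
    rw [flt_id, sub_self, map_zero, Finset.sum_empty]
    intro α _ i
    simp [upS]
  | insert i B hi ih =>
    rw [Finset.sum_insert hi]
    have h1 : flt (upS (insert i B) m) z = flt (upS B m) (z - flt (loS i m) z) := by
      ext α
      rw [map_sub, flt_flt, Finsupp.sub_apply]
      by_cases h1 : ∀ j, α j ∈ upS B m j
      · rw [flt_pos h1]
        by_cases h2 : α i < m
        · rw [flt_pos (S := fun j => upS B m j ∩ loS i m j), sub_self, flt_neg]
          · intro h
            have := h i
            simp only [upS, Finset.mem_insert_self, if_true, Set.mem_Ici] at this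
            omega
          · intro j
            refine ⟨h1 j, ?_⟩
            by_cases hj : j = i
            · subst hj; simpa [loS] using h2
            · simp [loS, hj]
        · rw [flt_pos, flt_neg, sub_zero]
          · intro h
            have := (h i).2
            simp only [loS, if_true, Set.mem_Iio] at this
            exact h2 this
          · intro j
            have := h1 j
            by_cases hj : j = i
            · subst hj; simpa [upS] using h2
            · simpa [upS, hj] using this
      · rw [flt_neg h1, flt_neg, flt_neg, sub_zero]
        · exact fun h => h1 fun j => (h j).1
        · refine fun h => h1 fun j => ?_
          have := h j
          by_cases hj : j ∈ B
          · simpa [upS, hj] using this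
          · simp [upS, hj]
    have h2 : flt (upS (insert i B) m) z - z =
        (flt (upS B m) z - z) + (- flt (upS B m) (flt (loS i m) z)) := by
      rw [h1, map_sub]; abel
    rw [h2, add_comm (nZ pp _)]
    refine (map_add_le_add _ _ _).trans (add_le_add ih ?_)
    rw [map_neg_eq_map]
    exact nZ_flt_le hpp _ _

/-- The seminorm associated with `A, m`. -/
def sN (pp : Fin N → ℝ) [∀ i, Fact (1 ≤ ENNReal.ofReal (pp i))] (T : C00 →ₗ[ℝ] ZZ N)
    (A : Finset (Fin N)) (m : ℕ) : Seminorm ℝ C00 := (nZ pp).comp ((flt (FF A m)).comp T)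

lemma sN_apply (T : C00 →ₗ[ℝ] ZZ N) (A : Finset (Fin N)) (m : ℕ) (x : C00) :
    sN pp T A m x = nZ pp (flt (FF A m) (T x)) := rfl

lemma smallS_empty (p : ℝ) (T : C00 →ₗ[ℝ] ZZ N) (m : ℕ) : SmallS p (sN pp T ∅ m) := by
  classical
  intro W hW ε hε
  obtain ⟨W', h1, h2, h3⟩ := hW.ker_finset
    (fun α : Fin N → ℕ => (Finsupp.lapply (R := ℝ) α : ZZ N →ₗ[ℝ] ℝ).comp T)
    (Fintype.piFinset fun _ => Finset.range m)
  refine ⟨W', h1, h2, fun x hx => ?_⟩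
  rw [sN_apply, flt_zero, map_zero]
  · exact mul_nonneg hε.le (ln_nonneg _)
  · intro α hα
    refine h3 α ?_ x hx
    rw [Fintype.mem_piFinset]
    intro i
    simpa [FF] using hα i

lemma not_small_univ (p : ℝ) (hp : 1 ≤ p) (T : C00 →ₗ[ℝ] ZZ N) (c : ℝ) (hc : 0 < c)
    (hT : ∀ x, c * ln p x ≤ nZ pp (T x)) : ¬ SmallS p (sN pp T Finset.univ 0) := by
  intro h
  have hbig : Big ⊤ := fun k => ⟨Finsupp.single k 1, trivial, by simp, fun j hj => by
    rw [Finsupp.single_eq_of_ne (by omega)]⟩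
  obtain ⟨W, -, h1, h2⟩ := h ⊤ hbig (c / 2) (by positivity)
  obtain ⟨x, hx, hx0, -⟩ := h1 0
  have h3 := h2 x hx
  rw [sN_apply, flt_id _ (fun α _ i => by simp [FF])] at h3
  have := ln_pos (p := p) (by linarith) hx0
  have := hT x
  nlinarith

lemma exists_min (p : ℝ) (hp : 1 ≤ p) (T : C00 →ₗ[ℝ] ZZ N) (c : ℝ) (hc : 0 < c)
    (hT : ∀ x, c * ln p x ≤ nZ pp (T x)) : ∃ (A : Finset (Fin N)) (m0 : ℕ), A.Nonempty ∧
      ¬ SmallS p (sN pp T A m0) ∧ ∀ i ∈ A, ∀ m, SmallS p (sN pp T (A.erase i) m) := by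
  classical
  let s : Finset (Finset (Fin N)) := Finset.univ.filter fun A => ∃ m, ¬ SmallS p (sN pp T A m)
  have hs : s.Nonempty := ⟨Finset.univ, by
    simp only [s, Finset.mem_filter, Finset.mem_univ, true_and]
    exact ⟨0, not_small_univ p hp T c hc hT⟩⟩
  obtain ⟨A, hA, hmin⟩ := s.exists_min_image Finset.card hs
  simp only [s, Finset.mem_filter, Finset.mem_univ, true_and] at hA hmin
  obtain ⟨m0, hm0⟩ := hA
  refine ⟨A, m0, ?_, hm0, ?_⟩
  · rw [Finset.nonempty_iff_ne_empty]
    rintro rfl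
    exact hm0 (smallS_empty p T m0)
  · intro i hi m
    by_contra h
    have := hmin _ ⟨m, h⟩
    have h2 := Finset.card_erase_lt_of_mem hi
    omega

lemma one_block (hpp : ∀ i, 1 < pp i) (p : ℝ) (hp : 1 ≤ p) (T : C00 →ₗ[ℝ] ZZ N)
    (A : Finset (Fin N)) (m0 : ℕ)
    (hsm : ∀ i ∈ A, ∀ m, SmallS p (sN pp T (A.erase i) m)) (W : Submodule ℝ C00) (hW : Big W)
    (k : ℕ) (δ : ℝ) (hδ : 0 < δ) :
    ∃ x ∈ W ⊓ tailS k, ln p x = 1 ∧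
      nZ pp (flt (upS A k) (flt (FF A m0) (T x)) - flt (FF A m0) (T x)) ≤ δ := by
  classical
  obtain ⟨W', h1, h2, h3⟩ := small_finset (fun i => sN pp T (A.erase i) (max k m0)) A
    (fun i hi => hsm i hi _) (hW.tail k) (ε := δ / (A.card + 1)) (by positivity)
  obtain ⟨x, hx, hx0, -⟩ := h2 0
  have hb := ln_pos (p := p) (by linarith) hx0
  set y := (ln p x)⁻¹ • x with hy
  have hyW : y ∈ W' := W'.smul_mem _ hx
  have hy1 : ln p y = 1 := by
    rw [hy, ln_smul hp, abs_of_pos (inv_pos.2 hb), inv_mul_cancel₀ hb.ne']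
  refine ⟨y, h1 hyW, hy1, ?_⟩
  refine (diff_le hpp _ _ _).trans ?_
  have : ∀ i ∈ A, nZ pp (flt (loS i k) (flt (FF A m0) (T y))) ≤ δ / (A.card + 1) := by
    intro i hi
    have h4 := h3 i hi y hyW
    rw [hy1, mul_one, sN_apply] at h4
    have h5 : flt (loS i k) (flt (FF A m0) (T y)) =
        flt (fun j => loS i k j ∩ FF A m0 j) (flt (FF (A.erase i) (max k m0)) (T y)) := by
      rw [flt_flt, flt_flt]
      refine flt_congr _ fun α _ => ?_
      constructor
      · intro h j
        refine ⟨h j, ?_⟩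
        have h6 := h j
        by_cases hj : j = i
        · subst hj
          simp only [loS, if_true, FF, Set.mem_inter_iff, Set.mem_Iio] at h6
          simp only [FF, Finset.notMem_erase, if_false, Set.mem_Iio]
          exact lt_max_of_lt_left h6.1
        · by_cases hjA : j ∈ A
          · simp [FF, hj, hjA]
          · have h7 := h6.2
            simp only [FF, hjA, if_false, Set.mem_Iio] at h7
            simp [FF, hj, hjA, h7]
      · intro h j
        exact (h j).1
    rw [h5]
    exact (nZ_flt_le hpp _ _).trans h4
  refine (Finset.sum_le_sum this).trans ?_
  rw [Finset.sum_const, nsmul_eq_mul]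
  have h6 : (0 : ℝ) < A.card + 1 := by positivity
  rw [mul_div_assoc', div_le_iff₀ h6]
  nlinarith

lemma exists_blocks (hpp : ∀ i, 1 < pp i) (p : ℝ) (hp : 1 ≤ p) (T : C00 →ₗ[ℝ] ZZ N)
    (A : Finset (Fin N)) (m0 : ℕ)
    (hsm : ∀ i ∈ A, ∀ m, SmallS p (sN pp T (A.erase i) m)) (W : Submodule ℝ C00) (hW : Big W)
    (c : ℝ) (hc : 0 < c) :
    ∃ (k : ℕ → ℕ) (x : ℕ → C00), IsBlock k x ∧ (∀ n, x n ∈ W) ∧ (∀ n, ln p (x n) = 1) ∧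
      (∀ n α i, T (x n) α ≠ 0 → α i < k (n + 1)) ∧
      ∀ n, nZ pp (flt (upS A (k n)) (flt (FF A m0) (T (x n))) - flt (FF A m0) (T (x n))) ≤
        c * (1 / 2) ^ (n + 1) := by
  choose g hgW hg1 hgd using fun k : ℕ => one_block hpp p hp T A m0 hsm W hW k
    (c * (1 / 2) ^ (k + 1)) (by positivity)
  obtain ⟨k, h1, h2, h3⟩ := extract g (fun k j hj => (hgW k).2 j hj)
    (fun x => (T x).support.sup (fun α => Finset.univ.sup α) + 1)
  refine ⟨k, fun n => g (k n), h1, fun n => (hgW _).1, fun n => hg1 _, fun n α i hα => ?_,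
    fun n => (hgd _).trans ?_⟩
  · refine lt_of_lt_of_le (Nat.lt_succ_of_le ?_) (h3 n)
    have h4 : α i ≤ Finset.univ.sup α := Finset.le_sup (f := α) (Finset.mem_univ i)
    exact h4.trans (Finset.le_sup (f := fun α : Fin N → ℕ => Finset.univ.sup α)
      (Finsupp.mem_support_iff.2 hα))
  · refine mul_le_mul_of_nonneg_left ?_ hc.le
    exact pow_le_pow_of_le_one (by norm_num) (by norm_num) (Nat.succ_le_succ (h2 n))

end Nec

section Fin

lemma pow_cmp {a b s t : ℝ} (ha : 0 < a)
    (h : ∀ M : ℕ, 1 ≤ M → a * (M : ℝ) ^ s ≤ b * (M : ℝ) ^ t) : s ≤ t := by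
  by_contra hc
  push Not at hc
  have h1 := (tendsto_rpow_atTop (sub_pos.2 hc)).comp (tendsto_natCast_atTop_atTop (R := ℝ))
  obtain ⟨M, hM, hM1⟩ :=
    ((h1.eventually_gt_atTop (b / a)).and (Filter.eventually_ge_atTop 1)).exists
  have hM0 : (0 : ℝ) < M := by exact_mod_cast hM1
  have h2 := h M hM1
  simp only [Function.comp_apply] at hM
  rw [Real.rpow_sub hM0, div_lt_div_iff₀ ha (Real.rpow_pos_of_pos hM0 _)] at hM
  linarith

variable {N : ℕ} {pp : Fin N → ℝ} [∀ i, Fact (1 ≤ ENNReal.ofReal (pp i))]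

lemma low_bound (hpp : ∀ i, 1 < pp i) (A : Finset (Fin N)) (hA : A.Nonempty)
    (k : ℕ → ℕ) (hk : StrictMono k) (y : ℕ → ZZ N)
    (hy : ∀ n α, y n α ≠ 0 → ∀ i ∈ A, k n ≤ α i ∧ α i < k (n + 1)) (c : ℝ)
    (hc : ∀ n, c ≤ nZ pp (y n)) (M : ℕ) (hM : 1 ≤ M) :
    c * (M : ℝ) ^ (theta pp A) ≤ nZ pp (∑ n ∈ Finset.range M, y n) := by
  have hdis : ∀ n m : ℕ, n ≠ m → Disjoint (Set.Ico (k n) (k (n + 1))) (Set.Ico (k m) (k (m + 1))) := by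
    intro n m hnm
    exact hk.monotone.pairwise_disjoint_on_Ico_succ hnm
  have hM0 : (0 : ℝ) < M := by exact_mod_cast hM
  have h1 := lower_est (κ := Fin M) hpp A hA (fun n => Set.Ico (k n) (k (n + 1)))
    (fun n m hnm => hdis n m (fun h => hnm (Fin.ext h))) (fun _ => Set.univ)
    (fun _ => (M : ℝ)⁻¹) (fun _ => by positivity) (by
      rw [Finset.sum_const, Finset.card_univ, Fintype.card_fin, nsmul_eq_mul,
        mul_inv_cancel₀ hM0.ne'])
    (JJ pp (∑ n ∈ Finset.range M, y n))
  rw [← nZ_eq] at h1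
  refine le_trans ?_ h1
  have h2 : ∀ n : Fin M, flt (blk A (Set.Ico (k n) (k (n + 1))) (fun _ => Set.univ))
      (∑ n ∈ Finset.range M, y n) = y n := by
    intro n
    rw [map_sum, Finset.sum_eq_single (n : ℕ)]
    · refine flt_id _ fun α hα i => ?_
      by_cases hi : i ∈ A
      · simpa [blk, hi] using hy n α hα i hi
      · simp [blk, hi]
    · intro m _ hmn
      refine flt_zero _ fun α hα => ?_
      by_contra h0
      obtain ⟨i, hi⟩ := hA
      have h3 := hα i
      simp only [blk, hi, if_true] at h3
      exact Set.disjoint_left.1 (hdis m n hmn) (hy m α h0 i hi) h3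
    · intro h
      exact absurd (Finset.mem_range.2 n.2) h
  have h3 : ∀ n : Fin M, (M : ℝ)⁻¹ ^ (1 - theta pp A) * c ≤ (M : ℝ)⁻¹ ^ (1 - theta pp A) *
      nu pp (boxP pp (blk A (Set.Ico (k n) (k (n + 1))) (fun _ => Set.univ))
        (JJ pp (∑ n ∈ Finset.range M, y n))) := by
    intro n
    rw [← JJ_flt, h2, ← nZ_eq]
    exact mul_le_mul_of_nonneg_left (hc n) (by positivity)
  refine le_trans (le_of_eq ?_) (Finset.sum_le_sum fun n _ => h3 n)
  rw [Finset.sum_const, Finset.card_univ, Fintype.card_fin, nsmul_eq_mul, Real.inv_rpow hM0.le,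
    ← Real.rpow_neg hM0.le, neg_sub, Real.rpow_sub_one hM0.ne']
  field_simp

lemma up_bound (hpp : ∀ i, 1 < pp i) (A : Finset (Fin N)) (hA : A.Nonempty)
    (k : ℕ → ℕ) (hk : StrictMono k) (m0 : ℕ) (y : ℕ → ZZ N)
    (hy : ∀ n α, y n α ≠ 0 → ∀ i ∈ A, k n ≤ α i ∧ α i < k (n + 1))
    (hy' : ∀ n α, y n α ≠ 0 → ∀ i, i ∉ A → α i < m0) (C : ℝ) (hC : 0 < C)
    (hyC : ∀ n, nZ pp (y n) < C) : ∃ K : ℝ, ∀ M : ℕ,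
      nZ pp (∑ n ∈ Finset.range M, y n) ≤ K * (M : ℝ) ^ (theta pp A) := by
  classical
  let Γ : Finset (Fin N → ℕ) := Fintype.piFinset fun i => if i ∈ A then {0} else Finset.range m0
  refine ⟨Γ.card * C, fun M => ?_⟩
  have hdis : ∀ n m : ℕ, n ≠ m → Disjoint (Set.Ico (k n) (k (n + 1))) (Set.Ico (k m) (k (m + 1))) := by
    intro n m hnm
    exact hk.monotone.pairwise_disjoint_on_Ico_succ hnm
  have hdec : ∀ n, y n = ∑ γ ∈ Γ, flt (blk A (Set.Ico (k n) (k (n + 1))) (fun i => {γ i})) (y n) := by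
    intro n
    ext α
    rw [Finsupp.finset_sum_apply]
    by_cases h0 : y n α = 0
    · rw [h0]
      refine (Finset.sum_eq_zero fun γ _ => ?_).symm
      by_cases h : ∀ i, α i ∈ blk A (Set.Ico (k n) (k (n + 1))) (fun i => {γ i}) i
      · rw [flt_pos h, h0]
      · rw [flt_neg h]
    · rw [Finset.sum_eq_single (fun i => if i ∈ A then 0 else α i)]
      · rw [flt_pos]
        intro i
        by_cases hi : i ∈ A
        · simpa [blk, hi] using hy n α h0 i hi
        · simp [blk, hi]
      · intro γ hγ hne
        refine flt_neg fun h => hne ?_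
        ext i
        have h1 := h i
        have h2 := Fintype.mem_piFinset.1 hγ i
        by_cases hi : i ∈ A
        · simpa [hi] using h2
        · simp only [blk, hi, if_false, Set.mem_singleton_iff] at h1
          simp [hi, h1]
      · intro h
        exfalso
        refine h (Fintype.mem_piFinset.2 fun i => ?_)
        by_cases hi : i ∈ A
        · simp [hi]
        · simpa [hi] using hy' n α h0 i hi
  have hsum : ∑ n ∈ Finset.range M, y n = ∑ γ ∈ Γ, ∑ n : Fin M,
      flt (blk A (Set.Ico (k n) (k (n + 1))) (fun i => {γ i})) (y n) := by
    rw [Finset.sum_comm, ← Fin.sum_univ_eq_sum_range]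
    exact Finset.sum_congr rfl fun n _ => hdec n
  rw [hsum]
  refine (Finset.le_sum_of_subadditive (nZ pp) (map_zero _).le (map_add_le_add _) _ _).trans ?_
  rw [mul_assoc, ← nsmul_eq_mul]
  refine Finset.sum_le_card_nsmul _ _ _ fun γ _ => ?_
  have := upper_est (κ := Fin M) hpp A hA (fun n => Set.Ico (k n) (k (n + 1)))
    (fun n m hnm => hdis n m (fun h => hnm (Fin.ext h))) γ (fun n => JJ pp (y n)) C hC
    (fun n => hyC n)
  rw [Fintype.card_fin] at this
  rw [nZ_eq, map_sum]
  simp_rw [JJ_flt]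
  exact this

lemma nec_core (hpp : ∀ i, 1 < pp i) (p : ℝ) (hp : 1 ≤ p) (T : C00 →ₗ[ℝ] ZZ N) (c C : ℝ)
    (hc : 0 < c) (hC : 0 < C)
    (hT : ∀ x, c * ln p x ≤ nZ pp (T x) ∧ nZ pp (T x) ≤ C * ln p x) :
    ∃ A : Finset (Fin N), A.Nonempty ∧ 1 / p = theta pp A := by
  obtain ⟨A, m0, hA, hns, hsm⟩ := exists_min p hp T c hc fun x => (hT x).1
  refine ⟨A, hA, ?_⟩
  obtain ⟨W, hW, c1, hc1, hWc⟩ := not_small hp hns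
  obtain ⟨k, x, hblk, hxW, hx1, hxT, hxd⟩ := exists_blocks hpp p hp T A m0 hsm W hW (c1 / 2)
    (by positivity)
  let y : ℕ → ZZ N := fun n => flt (upS A (k n)) (flt (FF A m0) (T (x n)))
  have hy0 : ∀ n α, y n α ≠ 0 → (∀ i, α i ∈ upS A (k n) i) ∧ (∀ i, α i ∈ FF A m0 i) ∧
      T (x n) α ≠ 0 := by
    intro n α h
    simp only [y] at h
    have h1 : ∀ i, α i ∈ upS A (k n) i := by
      by_contra h1; exact h (flt_neg h1)
    rw [flt_pos h1] at h
    have h2 : ∀ i, α i ∈ FF A m0 i := by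
      by_contra h2; exact h (flt_neg h2)
    rw [flt_pos h2] at h
    exact ⟨h1, h2, h⟩
  have hyA : ∀ n α, y n α ≠ 0 → ∀ i ∈ A, k n ≤ α i ∧ α i < k (n + 1) := by
    intro n α h i hi
    obtain ⟨h1, -, h3⟩ := hy0 n α h
    have h1 := h1 i
    simp only [upS, hi, if_true, Set.mem_Ici] at h1
    exact ⟨h1, hxT n α i h3⟩
  have hyA' : ∀ n α, y n α ≠ 0 → ∀ i, i ∉ A → α i < m0 := by
    intro n α h i hi
    obtain ⟨-, h2, -⟩ := hy0 n α h
    have h2 := h2 i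
    simpa only [FF, hi, if_false, Set.mem_Iio] using h2
  have hyC : ∀ n, nZ pp (y n) < C + 1 := by
    intro n
    have h1 := (nZ_flt_le hpp (upS A (k n)) (flt (FF A m0) (T (x n)))).trans
      (nZ_flt_le hpp (FF A m0) (T (x n)))
    have h2 := (hT (x n)).2
    rw [hx1, mul_one] at h2
    exact lt_of_le_of_lt (h1.trans h2) (by linarith)
  have htri : ∀ a b : ZZ N, nZ pp b - nZ pp (a - b) ≤ nZ pp a ∧
      nZ pp a ≤ nZ pp b + nZ pp (a - b) := by
    intro a b
    have h1 := map_add_le_add (nZ pp) b (a - b)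
    have h2 := map_sub_le_add (nZ pp) a (a - b)
    rw [add_sub_cancel] at h1
    rw [sub_sub_cancel] at h2
    exact ⟨by linarith, h1⟩
  have hylow : ∀ n, c1 / 2 ≤ nZ pp (y n) := by
    intro n
    have h1 := hWc (x n) (hxW n)
    rw [hx1, mul_one, sN_apply] at h1
    have h2 := (htri (y n) (flt (FF A m0) (T (x n)))).1
    have h3 : nZ pp (y n - flt (FF A m0) (T (x n))) ≤ c1 / 2 := by
      refine (hxd n).trans (mul_le_of_le_one_right (by positivity) ?_)
      exact pow_le_one₀ (by norm_num) (by norm_num)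
    linarith
  have hsum : ∀ M : ℕ, nZ pp (∑ n ∈ Finset.range M, y n -
      flt (FF A m0) (T (∑ n ∈ Finset.range M, x n))) ≤ c1 / 2 := by
    intro M
    rw [map_sum, map_sum, ← Finset.sum_sub_distrib]
    refine (Finset.le_sum_of_subadditive (nZ pp) (map_zero _).le (map_add_le_add _) _ _).trans ?_
    refine (Finset.sum_le_sum fun n _ => hxd n).trans ?_
    rw [← Finset.mul_sum]
    exact mul_le_of_le_one_right (by positivity) (geo _)
  have hone : ∀ M : ℕ, 1 ≤ M → (1 : ℝ) ≤ (M : ℝ) ^ (1 / p) := by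
    intro M hM
    exact Real.one_le_rpow (by exact_mod_cast hM) (by positivity)
  apply le_antisymm
  · obtain ⟨K, hK⟩ := up_bound hpp A hA k hblk.1 m0 y hyA hyA' (C + 1) (by positivity) hyC
    refine pow_cmp (a := c1 / 2) (b := K) (by positivity) fun M hM => le_trans ?_ (hK M)
    have h1 := hWc (∑ n ∈ Finset.range M, x n) (W.sum_mem fun n _ => hxW n)
    rw [hblk.sum hp hx1, sN_apply] at h1
    have h2 := (htri (∑ n ∈ Finset.range M, y n)
      (flt (FF A m0) (T (∑ n ∈ Finset.range M, x n)))).1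
    have h3 := hsum M
    have h4 := hone M hM
    nlinarith
  · refine pow_cmp (a := c1 / 2) (b := C + c1 / 2) (by positivity) fun M hM => 
      (low_bound hpp A hA k hblk.1 y hyA (c1 / 2) hylow M hM).trans ?_
    have h1 := (hT (∑ n ∈ Finset.range M, x n)).2
    rw [hblk.sum hp hx1] at h1
    have h5 := nZ_flt_le hpp (FF A m0) (T (∑ n ∈ Finset.range M, x n))
    have h2 := (htri (∑ n ∈ Finset.range M, y n)
      (flt (FF A m0) (T (∑ n ∈ Finset.range M, x n)))).2
    have h3 := hsum M
    have h4 := hone M hM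
    nlinarith

lemma nec (hpp : ∀ i, 1 < pp i) (p : ℝ) (hp : 1 ≤ p) [Fact (1 ≤ ENNReal.ofReal p)]
    (h : EmbedsIn (Lp' (ENNReal.ofReal p)) (LpT pp)) :
    ∃ A : Finset (Fin N), A.Nonempty ∧ 1 / p = theta pp A := by
  obtain ⟨T, c, C, hc, hC, hT⟩ := discretize (cN pp) (fun t => norm_cN t)
    UniformSpace.Completion.denseRange_coe p hp h
  exact nec_core hpp p hp T c C hc hC hT

end Fin

/-- For `1 < pᵢ < ∞`, `ℓ_p` embeds isomorphically into
`ℓ_{p₁} ⊗̂ ⋯ ⊗̂ ℓ_{p_N}` if and only if `p = r_A` for some nonempty `A ⊆ {1, …, N}`, where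
`1/r_A = min{1, ∑_{i ∈ A} 1/pᵢ}`. -/
theorem stmt10 {N : ℕ} (pp : Fin N → ℝ) [∀ i, Fact (1 ≤ ENNReal.ofReal (pp i))]
    (hpp : ∀ i, 1 < pp i) (p : ℝ) (hp : 1 ≤ p) [Fact (1 ≤ ENNReal.ofReal p)] :
    EmbedsIn (Lp' (ENNReal.ofReal p)) (LpT pp) ↔
      ∃ A : Finset (Fin N), A.Nonempty ∧ 1 / p = min 1 (∑ i ∈ A, 1 / pp i) := by
  constructor
  · intro h
    obtain ⟨A, hA, h2⟩ := nec hpp p hp h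
    exact ⟨A, hA, h2⟩
  · rintro ⟨A, hA, h⟩
    exact suff hpp A hA p hp h
end
end

section
/- Let 1 < p₁ ≠ p₂ < ∞. Then ℓ_{p₁} does not embed isomorphically into the 'upper triangular' subspace T = closed span{ e_i ⊗ e_j : i ≤ j } of ℓ_{p₁} ⊗̂ ℓ_{p₂}. -/
open scoped TensorProduct ENNReal
open PiTensorProduct

noncomputable section

variable (ι : Type*) [Fintype ι] (E : ι → Type*)
  [∀ i, NormedAddCommGroup (E i)] [∀ i, NormedSpace ℝ (E i)]

/-- The upper triangular subspace `[e_i ⊗ e_j : i ≤ j]` of `ℓ_{p 0} ⊗̂ ℓ_{p 1}`. -/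
def UpperTri (p : Fin 2 → ℝ) [∀ i, Fact (1 ≤ ENNReal.ofReal (p i))] : Submodule ℝ (LpT p) :=
  (Submodule.span ℝ {x : LpT p | ∃ i j : ℕ, i ≤ j ∧ x = eT p ![i, j]}).topologicalClosure

/-! ### Facts about `ℓ_p` -/

open Filter Topology

section lpfacts

set_option linter.unusedSectionVars false

variable {P : ℝ≥0∞} [Fact (1 ≤ P)]

lemma lp_summable (hP : 1 < P.toReal) (x : Lp' P) : Summable fun n => ‖x n‖ ^ P.toReal :=
  (lp.memℓp x).summable (by linarith)

/-- Additivity of the `p`-th power of the norm for disjoint vectors. -/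
lemma lp_norm_add_disj (hP : 1 < P.toReal) (x y : Lp' P) (h : ∀ n, x n = 0 ∨ y n = 0) :
    ‖x + y‖ ^ P.toReal = ‖x‖ ^ P.toReal + ‖y‖ ^ P.toReal := by
  have h0 : 0 < P.toReal := by linarith
  rw [lp.norm_rpow_eq_tsum h0, lp.norm_rpow_eq_tsum h0, lp.norm_rpow_eq_tsum h0,
    ← (lp_summable hP x).tsum_add (lp_summable hP y)]
  congr 1
  ext n
  rcases h n with h | h <;> simp [h, Real.zero_rpow h0.ne']

lemma memlp_ind (S : Set ℕ) (x : Lp' P) :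
    Memℓp (E := fun _ : ℕ => ℝ) (S.indicator (x : ℕ → ℝ)) P := by
  have hx := lp.memℓp x
  rcases P.trichotomy with h | h | h
  · have : (1 : ℝ≥0∞) ≤ P := Fact.out
    simp [h] at this
  · subst h
    rw [memℓp_infty_iff] at hx ⊢
    obtain ⟨C, hC⟩ := hx
    refine ⟨C, ?_⟩
    rintro _ ⟨n, rfl⟩
    exact (norm_indicator_le_norm_self _ _).trans (hC ⟨n, rfl⟩)
  · refine memℓp_gen ((hx.summable h).of_nonneg_of_le (fun n => by positivity) fun n => ?_)
    exact Real.rpow_le_rpow (norm_nonneg _) (norm_indicator_le_norm_self _ _) h.le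

/-- Coordinate restriction to a set `S`. -/
def indL (P : ℝ≥0∞) [Fact (1 ≤ P)] (S : Set ℕ) : Lp' P →L[ℝ] Lp' P :=
  LinearMap.mkContinuous
    { toFun := fun x => ⟨S.indicator (x : ℕ → ℝ), memlp_ind S x⟩
      map_add' := fun x y => by
        ext n
        exact congrFun (Set.indicator_add S (x : ℕ → ℝ) (y : ℕ → ℝ)) n
      map_smul' := fun c x => by
        ext n; by_cases hn : n ∈ S <;> simp [hn] }
    1 (fun x => by
      rw [one_mul]
      refine lp.norm_mono (zero_lt_one.trans_le (Fact.out : (1 : ℝ≥0∞) ≤ P)).ne' fun n => ?_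
      exact norm_indicator_le_norm_self _ _)

lemma indL_apply (S : Set ℕ) (x : Lp' P) (n : ℕ) :
    indL P S x n = S.indicator (x : ℕ → ℝ) n := rfl

lemma indL_le (S : Set ℕ) (x : Lp' P) : ‖indL P S x‖ ≤ ‖x‖ := by
  refine lp.norm_mono (zero_lt_one.trans_le (Fact.out : (1 : ℝ≥0∞) ≤ P)).ne' fun n => ?_
  exact norm_indicator_le_norm_self _ _

lemma indL_add_compl (S : Set ℕ) (x : Lp' P) : indL P S x + indL P Sᶜ x = x := by
  ext n; by_cases hn : n ∈ S <;> simp [hn, indL_apply]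

lemma indL_pow (hP : 1 < P.toReal) (S : Set ℕ) (x : Lp' P) :
    ‖indL P S x‖ ^ P.toReal + ‖indL P Sᶜ x‖ ^ P.toReal = ‖x‖ ^ P.toReal := by
  rw [← lp_norm_add_disj hP, indL_add_compl]
  intro n; by_cases hn : n ∈ S <;> simp [hn, indL_apply]

lemma indL_comp (S S' : Set ℕ) (x : Lp' P) : indL P S (indL P S' x) = indL P (S ∩ S') x := by
  ext n
  by_cases hn : n ∈ S <;> by_cases hn' : n ∈ S' <;> simp [hn, hn', indL_apply]

lemma indL_univ (x : Lp' P) : indL P Set.univ x = x := by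
  ext n; simp [indL_apply]

lemma indL_e' (S : Set ℕ) (n : ℕ) [Decidable (n ∈ S)] :
    indL P S (e' P n) = if n ∈ S then e' P n else 0 := by
  ext k
  by_cases hkn : k = n
  · subst hkn; by_cases h : k ∈ S <;> simp [h, indL_apply, e']
  · by_cases h : n ∈ S <;> by_cases hk : k ∈ S <;> simp [h, hk, hkn, indL_apply, e']

lemma norm_e' (n : ℕ) : ‖e' P n‖ = 1 := by
  rw [e', lp.norm_single (zero_lt_one.trans_le (Fact.out : (1 : ℝ≥0∞) ≤ P))]; simp

lemma indL_Iio_eq (M : ℕ) (x : Lp' P) :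
    indL P (Set.Iio M) x = ∑ i ∈ Finset.range M, x i • e' P i := by
  ext k
  simp only [indL_apply, e', lp.coeFn_sum, Finset.sum_apply, lp.coeFn_smul, Pi.smul_apply,
    lp.single_apply, Pi.single_apply, Set.indicator_apply, Set.mem_Iio]
  simp

lemma indL_tendsto (hP : 1 < P.toReal) (x : Lp' P) :
    Tendsto (fun M => indL P (Set.Iio M) x) atTop (𝓝 x) := by
  have h : P ≠ ∞ := by rintro rfl; norm_num at hP
  have := (lp.hasSum_single h x).tendsto_sum_nat
  refine this.congr fun M => ?_
  rw [indL_Iio_eq]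
  refine Finset.sum_congr rfl fun i _ => ?_
  rw [e', ← lp.single_smul]; simp

lemma indL_compl_tendsto (hP : 1 < P.toReal) (x : Lp' P) :
    Tendsto (fun M => indL P (Set.Iio M)ᶜ x) atTop (𝓝 0) := by
  have := (tendsto_const_nhds (x := x)).sub (indL_tendsto hP x)
  rw [sub_self] at this
  refine this.congr fun M => ?_
  rw [sub_eq_iff_eq_add, add_comm, indL_add_compl]

/-- Greedy lower estimate: an operator on `ℓ_p` cannot have a lower `r`-estimate on
inductively chosen blocks with `r < p`. -/
lemma greedy_lower (hP : 1 < P.toReal) {Y : Type*} [NormedAddCommGroup Y] [NormedSpace ℝ Y]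
    (f : Lp' P →L[ℝ] Y) (r δ : ℝ) (hr : 0 < r) (hrP : r < P.toReal) (hδ : 0 < δ)
    (H : ∀ z : Lp' P, ∀ N : ℕ, ∃ x : Lp' P, ∃ b : ℕ, (∀ n, x n ≠ 0 → N ≤ n ∧ n < b) ∧ ‖x‖ = 1 ∧
      ‖f z‖ ^ r + δ ≤ ‖f (z + x)‖ ^ r) : False := by
  have key : ∀ K : ℕ, ∃ z : Lp' P, ∃ b : ℕ, (∀ n, z n ≠ 0 → n < b) ∧ ‖z‖ ^ P.toReal = K ∧
      K * δ ≤ ‖f z‖ ^ r := by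
    intro K
    induction K with
    | zero => exact ⟨0, 0, by simp, by simp [Real.zero_rpow (by linarith : P.toReal ≠ 0)],
        by simp [Real.zero_rpow hr.ne']⟩
    | succ K ih =>
      obtain ⟨z, b, hz, hz1, hz2⟩ := ih
      obtain ⟨x, b', hx, hx1, hx2⟩ := H z b
      refine ⟨z + x, max b b', ?_, ?_, ?_⟩
      · intro n hn
        by_cases h : z n = 0
        · have : x n ≠ 0 := by intro h'; apply hn; simp [h, h']
          exact lt_max_of_lt_right (hx n this).2
        · exact lt_max_of_lt_left (hz n h)
      · rw [lp_norm_add_disj hP, hz1, hx1]; · simp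
        intro n
        by_contra hcon
        push Not at hcon
        have h1 := hz n hcon.1
        have h2 := hx n hcon.2
        omega
      · push_cast; linarith
  set C := ‖f‖ + 1
  have hC : 0 < C := by positivity
  have bd : ∀ K : ℕ, (K : ℝ) * δ ≤ C ^ r * (K : ℝ) ^ (r / P.toReal) := by
    intro K
    obtain ⟨z, -, -, hz1, hz2⟩ := key K
    refine hz2.trans ?_
    have h1 : ‖f z‖ ≤ C * ‖z‖ := (f.le_opNorm z).trans
      (mul_le_mul_of_nonneg_right (by simp [C]) (norm_nonneg _))
    calc ‖f z‖ ^ r ≤ (C * ‖z‖) ^ r := Real.rpow_le_rpow (norm_nonneg _) h1 hr.le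
      _ = C ^ r * ‖z‖ ^ r := Real.mul_rpow hC.le (norm_nonneg _)
      _ = C ^ r * (K : ℝ) ^ (r / P.toReal) := by
        rw [← hz1, ← Real.rpow_mul (norm_nonneg _)]
        congr 2
        field_simp
  have hs : 0 < 1 - r / P.toReal := by
    have : r / P.toReal < 1 := by rw [div_lt_one (by linarith)]; exact hrP
    linarith
  have ht := (tendsto_rpow_atTop hs).comp tendsto_natCast_atTop_atTop
  obtain ⟨K, hK, hK1⟩ := ((ht.eventually_gt_atTop (C ^ r / δ)).and (eventually_ge_atTop 1)).exists
  have hK0 : (0 : ℝ) < K := by exact_mod_cast hK1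
  have := bd K
  simp only [Function.comp] at hK
  rw [Real.rpow_sub hK0, Real.rpow_one, div_lt_div_iff₀ hδ (by positivity)] at hK
  linarith

/-- `S e_n` tends to zero weakly. -/
lemma weak_null (hP : 1 < P.toReal) (φ : Lp' P →L[ℝ] ℝ) :
    Tendsto (fun n => φ (e' P n)) atTop (𝓝 0) := by
  by_contra hcon
  rw [Metric.tendsto_atTop] at hcon
  push Not at hcon
  obtain ⟨δ, hδ, H⟩ := hcon
  refine greedy_lower hP φ 1 δ one_pos hP hδ fun z N => ?_
  obtain ⟨n, hn, hd⟩ := H N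
  rw [dist_zero_right] at hd
  have hnorm := norm_e' (P := P) n
  have hs : ∀ (c : ℝ), ∀ k, (c • e' P n) k ≠ 0 → N ≤ k ∧ k < n + 1 := by
    intro c k hk
    have : k = n := by
      by_contra h
      apply hk
      simp [e', h]
    omega
  simp only [Real.rpow_one, Real.norm_eq_abs] at *
  by_cases hsg : 0 ≤ φ z * φ (e' P n)
  · refine ⟨(1 : ℝ) • e' P n, n + 1, hs 1, by simp [hnorm], ?_⟩
    have : |φ z + φ (e' P n)| = |φ z| + |φ (e' P n)| := by
      rw [abs_add_eq_add_abs_iff]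
      rcases mul_nonneg_iff.1 hsg with h | h <;> tauto
    rw [one_smul, map_add, this]; linarith
  · refine ⟨(-1 : ℝ) • e' P n, n + 1, hs (-1), by simp [hnorm], ?_⟩
    have : |φ z + -φ (e' P n)| = |φ z| + |-φ (e' P n)| := by
      rw [abs_add_eq_add_abs_iff]
      push Not at hsg
      rcases mul_neg_iff.1 hsg with h | h
      · left; constructor <;> linarith
      · right; constructor <;> linarith
    rw [neg_one_smul, map_add, map_neg, this, abs_neg]; linarith

end lpfacts

section rows

set_option linter.unusedSectionVars false

variable {P R : ℝ≥0∞} [Fact (1 ≤ P)] [Fact (1 ≤ R)]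

/-- Gliding hump: operators on `ℓ_p` and decompositions with a lower `r`-estimate. -/
lemma block_lower (hP : 1 < P.toReal) {Y : Type*} [NormedAddCommGroup Y] [NormedSpace ℝ Y]
    (f : Lp' P →L[ℝ] Y) (r δ : ℝ) (hr : 0 < r) (hrP : r < P.toReal) (hδ : 0 < δ)
    (Q Q' : ℕ → Y →L[ℝ] Y) (hQ : ∀ M t, ‖Q M t‖ ^ r + ‖Q' M t‖ ^ r ≤ ‖t‖ ^ r)
    (hQt : ∀ t, Tendsto (fun M => Q M t) atTop (𝓝 t))
    (hQt' : ∀ t, Tendsto (fun M => Q' M t) atTop (𝓝 0))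
    (H : ∀ M N : ℕ, ∀ ε : ℝ, 0 < ε → ∃ x : Lp' P, ∃ b : ℕ, (∀ n, x n ≠ 0 → N ≤ n ∧ n < b) ∧
      ‖x‖ = 1 ∧ δ ≤ ‖f x‖ ∧ ‖Q M (f x)‖ ≤ ε ∧ ‖f x - Q' M (f x)‖ ≤ ε) : False := by
  refine greedy_lower hP f r (δ ^ r / 2) hr hrP (by positivity) fun z N => ?_
  set u := f z with hu
  obtain ⟨ε, hε, hε0⟩ : ∃ ε : ℝ, ‖u‖ ^ r + δ ^ r / 2 <
      (max (‖u‖ - 2 * ε) 0) ^ r + (max (δ - 2 * ε) 0) ^ r ∧ 0 < ε := by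
    have hc : Continuous fun ε : ℝ => (max (‖u‖ - 2 * ε) 0) ^ r + (max (δ - 2 * ε) 0) ^ r := by
      refine Continuous.add ?_ ?_
      · exact Continuous.rpow_const (by fun_prop) fun _ => Or.inr hr.le
      · exact Continuous.rpow_const (by fun_prop) fun _ => Or.inr hr.le
    have h0 := hc.tendsto 0
    simp only [mul_zero, sub_zero, max_eq_left (norm_nonneg u), max_eq_left hδ.le] at h0
    have hlt : ‖u‖ ^ r + δ ^ r / 2 < ‖u‖ ^ r + δ ^ r := by
      have : 0 < δ ^ r := by positivity
      linarith
    have := (h0.mono_left (nhdsWithin_le_nhds (s := Set.Ioi 0))).eventually (lt_mem_nhds hlt)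
    exact (this.and self_mem_nhdsWithin).exists
  have e1 : ∀ᶠ M in atTop, ‖Q M u - u‖ < ε := by
    have := (hQt u).sub_const u
    rw [sub_self] at this
    have := this.norm
    rw [norm_zero] at this
    exact this.eventually (gt_mem_nhds hε0)
  have e2 : ∀ᶠ M in atTop, ‖Q' M u‖ < ε := by
    have := (hQt' u).norm
    rw [norm_zero] at this
    exact this.eventually (gt_mem_nhds hε0)
  obtain ⟨M, hM1, hM2⟩ := (e1.and e2).exists
  obtain ⟨x, b, hx, hx1, hxδ, hx2, hx3⟩ := H M N ε hε0
  refine ⟨x, b, hx, hx1, ?_⟩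
  rw [map_add, ← hu]
  set w := f x
  refine hε.le.trans (le_trans ?_ (hQ M (u + w)))
  have k1 : ‖u‖ - 2 * ε ≤ ‖Q M (u + w)‖ := by
    have : u = Q M (u + w) - (Q M u - u) - Q M w := by rw [map_add]; abel
    have h2 : ‖u‖ ≤ ‖Q M (u + w)‖ + ‖Q M u - u‖ + ‖Q M w‖ := by
      conv_lhs => rw [this]
      exact (norm_sub_le _ _).trans (add_le_add_left (norm_sub_le _ _) _)
    linarith
  have k2 : δ - 2 * ε ≤ ‖Q' M (u + w)‖ := by
    have : w = Q' M (u + w) + (w - Q' M w) - Q' M u := by rw [map_add]; abel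
    have h2 : ‖w‖ ≤ ‖Q' M (u + w)‖ + ‖w - Q' M w‖ + ‖Q' M u‖ := by
      conv_lhs => rw [this]
      exact (norm_sub_le _ _).trans (add_le_add_left (norm_add_le _ _) _)
    linarith
  exact add_le_add
    (Real.rpow_le_rpow (le_max_right _ _) (max_le k1 (norm_nonneg _)) hr.le)
    (Real.rpow_le_rpow (le_max_right _ _) (max_le k2 (norm_nonneg _)) hr.le)

lemma e'_supp (n N : ℕ) (h : N ≤ n) : ∀ k, e' P n k ≠ 0 → N ≤ k ∧ k < n + 1 := by
  intro k hk
  have : k = n := by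
    by_contra h
    apply hk
    simp [e', h]
  omega

lemma trunc_null (hP : 1 < P.toReal) (S : Lp' P →L[ℝ] Lp' R) (M : ℕ) :
    Tendsto (fun n => indL R (Set.Iio M) (S (e' P n))) atTop (𝓝 0) := by
  simp only [indL_Iio_eq]
  have : Tendsto (fun n => ∑ i ∈ Finset.range M, (S (e' P n) i) • e' R i) atTop
      (𝓝 (∑ i ∈ Finset.range M, (0 : ℝ) • e' R i)) := by
    refine tendsto_finsetSum _ fun i _ => Tendsto.smul_const ?_ _
    exact weak_null hP ((lp.evalCLM ℝ (fun _ : ℕ => ℝ) R i).comp S)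
  simpa using this

/-- Pitt-type: operators from `ℓ_p` to `ℓ_r`, `r < p`, send the basis to a null sequence. -/
lemma pitt_null (hP : 1 < P.toReal) (hR : 1 < R.toReal) (hRP : R.toReal < P.toReal)
    (S : Lp' P →L[ℝ] Lp' R) : Tendsto (fun n => S (e' P n)) atTop (𝓝 0) := by
  by_contra hcon
  rw [Metric.tendsto_atTop] at hcon
  push Not at hcon
  obtain ⟨δ, hδ, H⟩ := hcon
  refine block_lower hP S R.toReal δ (by linarith) hRP hδ (fun M => indL R (Set.Iio M))
    (fun M => indL R (Set.Iio M)ᶜ) (fun M t => (indL_pow hR _ t).le) (indL_tendsto hR)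
    (indL_compl_tendsto hR) fun M N ε hε => ?_
  have h1 := (trunc_null hP S M).norm
  rw [norm_zero] at h1
  obtain ⟨N', hN'⟩ := eventually_atTop.1 (h1.eventually (gt_mem_nhds hε))
  obtain ⟨n, hn, hd⟩ := H (max N N')
  rw [dist_zero_right] at hd
  have h2 := hN' n ((le_max_right _ _).trans hn)
  refine ⟨e' P n, n + 1, e'_supp n N ((le_max_left _ _).trans hn), norm_e' n, hd, h2.le, ?_⟩
  refine le_trans (le_of_eq ?_) h2.le
  congr 1
  rw [sub_eq_iff_eq_add, indL_add_compl]

lemma bl_upper (hR : 1 < R.toReal) (u : Lp' R) (w : ℕ → Lp' R) (C : ℝ) (hw : ∀ n, ‖w n‖ ≤ C)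
    (hw0 : ∀ M : ℕ, Tendsto (fun n => indL R (Set.Iio M) (w n)) atTop (𝓝 0)) :
    ∀ᶠ n in atTop, ‖u + w n‖ ^ R.toReal ≤ ‖u‖ ^ R.toReal + (C ^ R.toReal + 1) := by
  have hq : 0 < R.toReal := by linarith
  set q := R.toReal with hqdef
  have hC : 0 ≤ C := (norm_nonneg _).trans (hw 0)
  set A := (‖u‖ ^ q + C ^ q) ^ (1 / q) with hA
  have hA0 : 0 ≤ A := by positivity
  have hAq : A ^ q = ‖u‖ ^ q + C ^ q := by
    rw [hA, ← Real.rpow_mul (by positivity), one_div_mul_cancel hq.ne', Real.rpow_one]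
  obtain ⟨η, hη, hη0⟩ : ∃ η : ℝ, (A + 2 * η) ^ q < A ^ q + 1 ∧ 0 < η := by
    have hc : Continuous fun η : ℝ => (A + 2 * η) ^ q :=
      Continuous.rpow_const (by fun_prop) fun _ => Or.inr hq.le
    have h0 := hc.tendsto 0
    simp only [mul_zero, add_zero] at h0
    have := (h0.mono_left (nhdsWithin_le_nhds (s := Set.Ioi 0))).eventually
      (gt_mem_nhds (lt_add_one _))
    exact (this.and self_mem_nhdsWithin).exists
  have e2 : ∀ᶠ M in atTop, ‖indL R (Set.Iio M)ᶜ u‖ < η := by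
    have := (indL_compl_tendsto hR u).norm
    rw [norm_zero] at this
    exact this.eventually (gt_mem_nhds hη0)
  obtain ⟨M, hM⟩ := e2.exists
  have h1 := (hw0 M).norm
  rw [norm_zero] at h1
  filter_upwards [h1.eventually (gt_mem_nhds hη0)] with n hn
  set S : Set ℕ := Set.Iio M
  have k1 : ‖indL R S u + indL R Sᶜ (w n)‖ ≤ A := by
    have h3 : ‖indL R S u + indL R Sᶜ (w n)‖ ^ q ≤ A ^ q := by
      rw [lp_norm_add_disj hR, hAq]
      · refine add_le_add (Real.rpow_le_rpow (norm_nonneg _) (indL_le _ _) hq.le)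
          (Real.rpow_le_rpow (norm_nonneg _) ((indL_le _ _).trans (hw n)) hq.le)
      · intro k; by_cases hk : k ∈ S <;> simp [hk, indL_apply]
    exact (Real.rpow_le_rpow_iff (norm_nonneg _) hA0 hq).1 h3
  have k2 : u + w n = (indL R S u + indL R Sᶜ (w n)) + (indL R Sᶜ u + indL R S (w n)) := by
    conv_lhs => rw [← indL_add_compl S u, ← indL_add_compl S (w n)]
    abel
  have k3 : ‖u + w n‖ ≤ A + 2 * η := by
    rw [k2]
    refine (norm_add_le _ _).trans ?_
    have := norm_add_le (indL R Sᶜ u) (indL R S (w n))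
    linarith
  calc ‖u + w n‖ ^ q ≤ (A + 2 * η) ^ q := Real.rpow_le_rpow (norm_nonneg _) k3 hq.le
    _ ≤ A ^ q + 1 := hη.le
    _ = _ := by rw [hAq]; ring

/-- Finitely many operators `ℓ_p → ℓ_r`, `p ≠ r`, are simultaneously small on a normalized
finitely supported vector far out. -/
lemma row_small (hP : 1 < P.toReal) (hR : 1 < R.toReal) (hne : P.toReal ≠ R.toReal)
    (L : ℕ) (S : ℕ → Lp' P →L[ℝ] Lp' R) (N : ℕ) (ε : ℝ) (hε : 0 < ε) :
    ∃ x : Lp' P, ∃ b : ℕ, (∀ n, x n ≠ 0 → N ≤ n ∧ n < b) ∧ ‖x‖ = 1 ∧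
      ∀ i ∈ Finset.range L, ‖S i x‖ ≤ ε := by
  rcases lt_or_gt_of_ne hne with hlt | hlt
  · set C : ℝ := ∑ i ∈ Finset.range L, ‖S i‖ with hC
    have hC0 : 0 ≤ C := Finset.sum_nonneg fun _ _ => norm_nonneg _
    set q := R.toReal with hq
    set p := P.toReal with hp
    set D := C ^ q + 1 with hD
    have hD0 : 0 < D := by positivity
    have key : ∀ m : ℕ, ∃ z : Lp' P, ∃ b : ℕ, (∀ n, z n ≠ 0 → N ≤ n ∧ n < b) ∧ ‖z‖ ^ p = m ∧
        ∀ i ∈ Finset.range L, ‖S i z‖ ^ q ≤ m * D := by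
      intro m
      induction m with
      | zero => exact ⟨0, 0, by simp, by simp [Real.zero_rpow (by linarith : p ≠ 0)],
          by simp [Real.zero_rpow (by linarith : q ≠ 0)]⟩
      | succ m ih =>
        obtain ⟨z, b, hz, hz1, hz2⟩ := ih
        have h1 : ∀ᶠ n in atTop, ∀ i ∈ Finset.range L,
            ‖S i z + S i (e' P n)‖ ^ q ≤ ‖S i z‖ ^ q + D := by
          rw [Finset.eventually_all]
          intro i hi
          refine bl_upper hR (S i z) (fun n => S i (e' P n)) C (fun n => ?_)
            (fun M => trunc_null hP (S i) M)
          have := (S i).le_opNorm (e' P n)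
          rw [norm_e', mul_one] at this
          exact this.trans (Finset.single_le_sum (f := fun i => ‖S i‖)
            (fun _ _ => norm_nonneg _) hi)
        obtain ⟨n, hn, hnb⟩ := (h1.and (eventually_ge_atTop (max b N))).exists
        have hs := e'_supp (P := P) n (max b N) hnb
        refine ⟨z + e' P n, max b (n + 1), ?_, ?_, ?_⟩
        · intro k hk
          by_cases h : z k = 0
          · have : e' P n k ≠ 0 := by intro h'; apply hk; simp [h, h']
            have := hs k this
            exact ⟨(le_max_right _ _).trans this.1, lt_max_of_lt_right this.2⟩
          · exact ⟨(hz k h).1, lt_max_of_lt_left (hz k h).2⟩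
        · rw [hp, lp_norm_add_disj hP, ← hp, hz1, norm_e']; · simp
          intro k
          by_contra hcon
          push Not at hcon
          have h1 := hz k hcon.1
          have h2 := hs k hcon.2
          have := (le_max_left _ _).trans h2.1
          omega
        · intro i hi
          rw [map_add]
          have := hn i hi
          have := hz2 i hi
          push_cast
          linarith
    have hs : 0 < 1 / p - 1 / q := by
      have : 1 / q < 1 / p := one_div_lt_one_div_of_lt (by linarith) hlt
      linarith
    have ht := (tendsto_rpow_neg_atTop hs).comp tendsto_natCast_atTop_atTop
    have ht2 := ht.mul_const (D ^ (1 / q))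
    rw [zero_mul] at ht2
    obtain ⟨m, hm, hm1⟩ := ((ht2.eventually (gt_mem_nhds hε)).and (eventually_ge_atTop 1)).exists
    simp only [Function.comp] at hm
    have hm0 : (0 : ℝ) < m := by exact_mod_cast hm1
    obtain ⟨z, b, hz, hz1, hz2⟩ := key m
    have hzn : ‖z‖ = (m : ℝ) ^ (1 / p) := by
      rw [← hz1, ← Real.rpow_mul (norm_nonneg _), mul_one_div_cancel (by linarith), Real.rpow_one]
    have hzpos : 0 < ‖z‖ := by rw [hzn]; positivity
    refine ⟨‖z‖⁻¹ • z, b, ?_, ?_, ?_⟩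
    · intro n hn
      apply hz
      intro h; apply hn; simp [h]
    · rw [norm_smul, norm_inv, norm_norm, inv_mul_cancel₀ hzpos.ne']
    · intro i hi
      rw [map_smul, norm_smul, norm_inv, norm_norm]
      have h3 : ‖S i z‖ ≤ (m * D) ^ (1 / q) := by
        rw [one_div, Real.le_rpow_inv_iff_of_pos (norm_nonneg _) (by positivity) (by linarith)]
        exact hz2 i hi
      refine le_trans (mul_le_mul_of_nonneg_left h3 (by positivity)) (le_of_eq_of_le ?_ hm.le)
      rw [hzn, Real.mul_rpow hm0.le hD0.le, neg_sub, Real.rpow_sub hm0]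
      field_simp
  · have h1 : ∀ᶠ n in atTop, ∀ i ∈ Finset.range L, ‖S i (e' P n)‖ ≤ ε := by
      rw [Finset.eventually_all]
      intro i hi
      have := (pitt_null hP hR hlt (S i)).norm
      rw [norm_zero] at this
      exact (this.eventually (gt_mem_nhds hε)).mono fun n hn => hn.le
    obtain ⟨n, hn, hnb⟩ := (h1.and (eventually_ge_atTop N)).exists
    exact ⟨e' P n, n + 1, e'_supp n N hnb, norm_e' n, hn⟩

end rows

section tensor

set_option linter.unusedSectionVars false

variable {J : Type*} [Fintype J] {F : J → Type*}
  [∀ i, NormedAddCommGroup (F i)] [∀ i, NormedSpace ℝ (F i)]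
  {G : Type*} [NormedAddCommGroup G] [NormedSpace ℝ G]

lemma lift_bound (g : MultilinearMap ℝ F G) (C : ℝ) (hC : 0 ≤ C)
    (hg : ∀ m, ‖g m‖ ≤ C * ∏ i, ‖m i‖) (t : ⨂[ℝ] i, F i) : ‖lift g t‖ ≤ C * ‖t‖ := by
  have h1 := norm_eval_le_projectiveSeminorm (g.mkContinuous C hg) t
  have h2 : ‖g.mkContinuous C hg‖ ≤ C := MultilinearMap.mkContinuous_norm_le _ hC _
  exact h1.trans (mul_le_mul_of_nonneg_right h2 (apply_nonneg projectiveSeminorm t))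

/-- The elementary tensor map as a multilinear map. -/
def tC (F : J → Type*) [∀ i, NormedAddCommGroup (F i)] [∀ i, NormedSpace ℝ (F i)] :
    MultilinearMap ℝ F (ProjTensor J F) :=
  (UniformSpace.Completion.toComplL (𝕜 := ℝ) (E := ⨂[ℝ] i, F i)).toLinearMap.compMultilinearMap
    (tprod ℝ)

lemma tC_apply (m : ∀ i, F i) : tC F m = tprodC m := rfl

lemma norm_tC_le (m : ∀ i, F i) : ‖tC F m‖ ≤ ∏ i, ‖m i‖ := by
  have h1 : ‖tC F m‖ = ‖(⨂ₜ[ℝ] i, m i : ⨂[ℝ] i, F i)‖ := UniformSpace.Completion.norm_coe _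
  rw [h1]
  exact projectiveSeminorm_tprod_le m

lemma bound_of_elem (L : ProjTensor J F →L[ℝ] G) (C : ℝ) (hC : 0 ≤ C)
    (hL : ∀ m, ‖L (tC F m)‖ ≤ C * ∏ i, ‖m i‖) (t : ProjTensor J F) : ‖L t‖ ≤ C * ‖t‖ := by
  induction t using UniformSpace.Completion.induction_on with
  | hp => exact isClosed_le (by fun_prop) (by fun_prop)
  | ih a =>
    have h1 := lift_bound (L.toLinearMap.compMultilinearMap (tC F)) C hC hL a
    have h2 : lift (L.toLinearMap.compMultilinearMap (tC F)) =
        (L.comp (UniformSpace.Completion.toComplL (𝕜 := ℝ) (E := ⨂[ℝ] i, F i))).toLinearMap := by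
      ext m
      simp [tC]
    rw [h2] at h1
    refine h1.trans_eq ?_
    congr 1
    exact (UniformSpace.Completion.norm_coe a).symm

lemma ext_of_elem (L L' : ProjTensor J F →L[ℝ] G) (h : ∀ m, L (tC F m) = L' (tC F m))
    (t : ProjTensor J F) : L t = L' t := by
  have := bound_of_elem (L - L') 0 le_rfl (fun m => by simp [h m]) t
  rw [zero_mul, norm_le_zero_iff, sub_apply, sub_eq_zero] at this
  exact this

lemma exists_liftC [CompleteSpace G] (g : MultilinearMap ℝ F G) (C : ℝ) (hC : 0 ≤ C)
    (hg : ∀ m, ‖g m‖ ≤ C * ∏ i, ‖m i‖) :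
    ∃ L : ProjTensor J F →L[ℝ] G, ∀ m, L (tC F m) = g m := by
  let l : (⨂[ℝ] i, F i) →L[ℝ] G := (lift g).mkContinuous C (lift_bound g C hC hg)
  refine ⟨l.extend (UniformSpace.Completion.toComplL (𝕜 := ℝ) (E := ⨂[ℝ] i, F i)), fun m => ?_⟩
  have h1 := l.extend_eq (e := UniformSpace.Completion.toComplL (𝕜 := ℝ) (E := ⨂[ℝ] i, F i))
    UniformSpace.Completion.denseRange_coe
    (UniformSpace.Completion.isUniformInducing_coe _) (tprod ℝ m)
  refine h1.trans ?_
  exact lift.tprod m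

/-- The lift of a bounded multilinear map. -/
def liftC [CompleteSpace G] (g : MultilinearMap ℝ F G) (C : ℝ) (hC : 0 ≤ C)
    (hg : ∀ m, ‖g m‖ ≤ C * ∏ i, ‖m i‖) : ProjTensor J F →L[ℝ] G :=
  (exists_liftC g C hC hg).choose

lemma liftC_tC [CompleteSpace G] (g : MultilinearMap ℝ F G) (C : ℝ) (hC : 0 ≤ C)
    (hg : ∀ m, ‖g m‖ ≤ C * ∏ i, ‖m i‖) (m : ∀ i, F i) : liftC g C hC hg (tC F m) = g m :=
  (exists_liftC g C hC hg).choose_spec m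

lemma tend_of_elem (D : ℕ → ProjTensor J F →L[ℝ] G) (C : ℝ) (hC : 0 ≤ C)
    (hD : ∀ M t, ‖D M t‖ ≤ C * ‖t‖)
    (h : ∀ m, Tendsto (fun M => D M (tC F m)) atTop (𝓝 0)) (t : ProjTensor J F) :
    Tendsto (fun M => D M t) atTop (𝓝 0) := by
  have halg : ∀ a : ⨂[ℝ] i, F i,
      Tendsto (fun M => D M (a : ProjTensor J F)) atTop (𝓝 0) := by
    intro a
    induction a using PiTensorProduct.induction_on with
    | smul_tprod r m =>
      have := (h m).const_smul r
      rw [smul_zero] at this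
      refine this.congr fun M => ?_
      rw [← map_smul]
      congr 1
      exact (UniformSpace.Completion.coe_smul r _).symm
    | add x y hx hy =>
      have := hx.add hy
      rw [add_zero] at this
      refine this.congr fun M => ?_
      rw [← map_add, UniformSpace.Completion.coe_add]
  rw [Metric.tendsto_atTop]
  intro ε hε
  obtain ⟨a, ha⟩ : ∃ a : ⨂[ℝ] i, F i, ‖t - (a : ProjTensor J F)‖ < ε / 2 / (C + 1) := by
    obtain ⟨a, ha⟩ := UniformSpace.Completion.denseRange_coe.exists_dist_lt t
      (show 0 < ε / 2 / (C + 1) by positivity)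
    rw [dist_eq_norm] at ha
    exact ⟨a, ha⟩
  obtain ⟨N, hN⟩ := Metric.tendsto_atTop.1 (halg a) (ε / 2) (by positivity)
  refine ⟨N, fun M hM => ?_⟩
  have h1 := hN M hM
  rw [dist_zero_right] at h1 ⊢
  have h2 := hD M (t - a)
  have h3 : C * ‖t - a‖ ≤ ε / 2 := by
    have : (C + 1) * ‖t - a‖ < ε / 2 := by
      rw [lt_div_iff₀ (by positivity)] at ha
      linarith
    nlinarith [norm_nonneg (t - (a : ProjTensor J F))]
  have h4 : D M t = D M (t - a) + D M a := by rw [← map_add, sub_add_cancel]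
  rw [h4]
  have := norm_add_le (D M (t - a)) (D M a)
  linarith

end tensor

lemma young_pair (p q r s t s1 s2 t1 t2 : ℝ) (hp : 1 < p) (hq : 1 < q)
    (hr0 : 0 < r) (hr : p * q / (p + q) ≤ r)
    (hs : 0 ≤ s) (ht : 0 ≤ t) (hs1 : 0 ≤ s1) (hs2 : 0 ≤ s2) (ht1 : 0 ≤ t1) (ht2 : 0 ≤ t2)
    (h1 : s1 ^ p + s2 ^ p = s ^ p) (h2 : t1 ^ q + t2 ^ q = t ^ q) :
    (s1 * t1) ^ r + (s2 * t2) ^ r ≤ (s * t) ^ r := by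
  have le_of : ∀ {a b c e : ℝ}, 0 < e → 0 ≤ a → 0 ≤ b → 0 ≤ c → a ^ e + b ^ e = c ^ e → a ≤ c := by
    intro a b c e he ha hb hc h
    refine (Real.rpow_le_rpow_iff ha hc he).1 ?_
    have : 0 ≤ b ^ e := by positivity
    linarith
  have hp0 : 0 < p := by linarith
  have hq0 : 0 < q := by linarith
  have a1 : s1 ≤ s := le_of hp0 hs1 hs2 hs h1
  have a2 : s2 ≤ s := le_of hp0 hs2 hs1 hs (by linarith)
  have b1 : t1 ≤ t := le_of hq0 ht1 ht2 ht h2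
  have b2 : t2 ≤ t := le_of hq0 ht2 ht1 ht (by linarith)
  rcases hs.eq_or_lt with h | hs'
  · subst h
    have : s1 = 0 := le_antisymm a1 hs1
    have : s2 = 0 := le_antisymm a2 hs2
    simp [*, Real.zero_rpow hr0.ne']
  rcases ht.eq_or_lt with h | ht'
  · subst h
    have : t1 = 0 := le_antisymm b1 ht1
    have : t2 = 0 := le_antisymm b2 ht2
    simp [*, Real.zero_rpow hr0.ne']
  have single : ∀ a b : ℝ, 0 ≤ a → a ≤ s → 0 ≤ b → b ≤ t →
      (a * b) ^ r ≤ (s * t) ^ r * (q / (p + q) * (a ^ p / s ^ p) + p / (p + q) * (b ^ q / t ^ q)) := by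
    intro a b ha has hb hbt
    have e1 : (a * b) ^ r = (s * t) ^ r * ((a / s) * (b / t)) ^ r := by
      rw [← Real.mul_rpow (by positivity) (by positivity)]
      congr 1
      field_simp
    rw [e1]
    refine mul_le_mul_of_nonneg_left ?_ (by positivity)
    have x0 : 0 ≤ a / s := by positivity
    have x1 : a / s ≤ 1 := (div_le_one hs').2 has
    have y0 : 0 ≤ b / t := by positivity
    have y1 : b / t ≤ 1 := (div_le_one ht').2 hbt
    have hpq : 0 < p * q / (p + q) := by positivity
    calc ((a / s) * (b / t)) ^ r ≤ ((a / s) * (b / t)) ^ (p * q / (p + q)) :=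
          Real.rpow_le_rpow_of_exponent_ge' (by positivity) (by nlinarith) hpq.le hr
      _ = ((a / s) ^ p) ^ (q / (p + q)) * ((b / t) ^ q) ^ (p / (p + q)) := by
          rw [Real.mul_rpow x0 y0, ← Real.rpow_mul x0, ← Real.rpow_mul y0]
          congr 2 <;> ring
      _ ≤ q / (p + q) * (a / s) ^ p + p / (p + q) * (b / t) ^ q :=
          Real.geom_mean_le_arith_mean2_weighted (by positivity) (by positivity) (by positivity)
            (by positivity) (by field_simp; ring)
      _ = _ := by rw [Real.div_rpow ha hs, Real.div_rpow hb ht]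
  have c1 := single s1 t1 hs1 a1 ht1 b1
  have c2 := single s2 t2 hs2 a2 ht2 b2
  have hsp : 0 < s ^ p := by positivity
  have htq : 0 < t ^ q := by positivity
  have tot : (q / (p + q) * (s1 ^ p / s ^ p) + p / (p + q) * (t1 ^ q / t ^ q)) +
      (q / (p + q) * (s2 ^ p / s ^ p) + p / (p + q) * (t2 ^ q / t ^ q)) = 1 := by
    have : (q / (p + q) * (s1 ^ p / s ^ p) + p / (p + q) * (t1 ^ q / t ^ q)) +
      (q / (p + q) * (s2 ^ p / s ^ p) + p / (p + q) * (t2 ^ q / t ^ q)) =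
        q / (p + q) * ((s1 ^ p + s2 ^ p) / s ^ p) + p / (p + q) * ((t1 ^ q + t2 ^ q) / t ^ q) := by
      ring
    rw [this, h1, h2, div_self hsp.ne', div_self htq.ne']
    field_simp; ring
  have := congrArg (fun y => (s * t) ^ r * y) tot
  simp only [mul_add, mul_one] at this c1 c2
  linarith

section restriction

set_option linter.unusedSectionVars false

variable (p : Fin 2 → ℝ) [∀ i, Fact (1 ≤ ENNReal.ofReal (p i))]

/-- The factors of the tensor product. -/
abbrev Fc (p : Fin 2 → ℝ) : Fin 2 → Type := fun i => Lp' (ENNReal.ofReal (p i))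

/-- Restriction of a tensor to a product of coordinate sets. -/
def restr (I : Fin 2 → Set ℕ) : LpT p →L[ℝ] LpT p :=
  liftC (F := Fc p) ((tC (Fc p)).compLinearMap fun i => (indL (ENNReal.ofReal (p i)) (I i)).toLinearMap)
    1 zero_le_one (fun m => by
      rw [one_mul]
      refine (norm_tC_le _).trans ?_
      exact Finset.prod_le_prod (fun _ _ => norm_nonneg _) fun i _ => indL_le _ _)

lemma restr_tC (I : Fin 2 → Set ℕ) (m : ∀ i, Fc p i) :
    restr p I (tC (Fc p) m) = tC (Fc p) fun i => indL (ENNReal.ofReal (p i)) (I i) (m i) :=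
  liftC_tC (F := Fc p) _ _ _ _ _

lemma restr_le (I : Fin 2 → Set ℕ) (t : LpT p) : ‖restr p I t‖ ≤ ‖t‖ := by
  have := bound_of_elem (F := Fc p) (restr p I) 1 zero_le_one (fun m => by
      rw [one_mul, restr_tC]
      refine (norm_tC_le _).trans ?_
      exact Finset.prod_le_prod (fun _ _ => norm_nonneg _) fun i _ => indL_le _ _) t
  rwa [one_mul] at this

lemma restr_comp (I I' : Fin 2 → Set ℕ) (t : LpT p) :
    restr p I (restr p I' t) = restr p (fun i => I i ∩ I' i) t := by
  refine ext_of_elem (F := Fc p) ((restr p I).comp (restr p I')) _ (fun m => ?_) t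
  simp only [ContinuousLinearMap.comp_apply, restr_tC, indL_comp]

lemma restr_univ (t : LpT p) : restr p (fun _ => Set.univ) t = t := by
  refine ext_of_elem (F := Fc p) (restr p (fun _ => Set.univ)) (ContinuousLinearMap.id ℝ _)
    (fun m => ?_) t
  simp only [restr_tC, indL_univ, ContinuousLinearMap.id_apply]

lemma ind_update (I : Fin 2 → Set ℕ) (k : Fin 2) (S : Set ℕ) (m : ∀ i, Fc p i) :
    (fun i => indL (ENNReal.ofReal (p i)) (Function.update I k S i) (m i)) =
      Function.update (fun i => indL (ENNReal.ofReal (p i)) (I i) (m i)) k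
        (indL (ENNReal.ofReal (p k)) S (m k)) := by
  funext i
  by_cases h : i = k
  · subst h; simp
  · simp [h]

lemma restr_split (I : Fin 2 → Set ℕ) (k : Fin 2) (S : Set ℕ) (t : LpT p) :
    restr p (Function.update I k S) t + restr p (Function.update I k Sᶜ) t =
      restr p (Function.update I k Set.univ) t := by
  refine ext_of_elem (F := Fc p) (restr p (Function.update I k S) +
    restr p (Function.update I k Sᶜ)) _ (fun m => ?_) t
  simp only [add_apply, restr_tC, ind_update]
  rw [← MultilinearMap.map_update_add, indL_add_compl, indL_univ]

lemma tri_zero (M : ℕ) (t : LpT p) (ht : t ∈ UpperTri p) :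
    restr p ![(Set.Iio M)ᶜ, Set.Iio M] t = 0 := by
  have hle : UpperTri p ≤ LinearMap.ker (restr p ![(Set.Iio M)ᶜ, Set.Iio M]).toLinearMap := by
    refine Submodule.topologicalClosure_minimal _ ?_ ?_
    · rw [Submodule.span_le]
      rintro x ⟨i, j, hij, rfl⟩
      simp only [SetLike.mem_coe, LinearMap.mem_ker]
      change restr p _ (tC (Fc p) _) = 0
      rw [restr_tC]
      by_cases hj : j < M
      · refine (tC (Fc p)).map_coord_zero 0 ?_
        change indL _ (Set.Iio M)ᶜ (e' _ i) = 0
        classical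
        rw [indL_e', if_neg]
        simp; omega
      · refine (tC (Fc p)).map_coord_zero 1 ?_
        change indL _ (Set.Iio M) (e' _ j) = 0
        classical
        rw [indL_e', if_neg]
        simpa using hj
    · exact (restr p ![(Set.Iio M)ᶜ, Set.Iio M]).isClosed_ker
  exact hle ht

lemma tri_sub (M : ℕ) (t : LpT p) (ht : t ∈ UpperTri p) :
    t - restr p (fun _ => (Set.Iio M)ᶜ) t = restr p ![Set.Iio M, Set.univ] t := by
  have h0 := tri_zero p M t ht
  have h1 := restr_split p (fun _ => (Set.Iio M)ᶜ) 1 (Set.Iio M) t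
  have h2 := restr_split p (fun _ => Set.univ) 0 (Set.Iio M) t
  have e1 : Function.update (fun _ : Fin 2 => (Set.Iio M)ᶜ) 1 (Set.Iio M) =
      ![(Set.Iio M)ᶜ, Set.Iio M] := by
    funext i; fin_cases i <;> simp
  have e2 : Function.update (fun _ : Fin 2 => (Set.Iio M)ᶜ) 1 (Set.Iio M)ᶜ =
      fun _ => (Set.Iio M)ᶜ := by simp
  have e3 : Function.update (fun _ : Fin 2 => (Set.Iio M)ᶜ) 1 Set.univ =
      ![(Set.Iio M)ᶜ, Set.univ] := by
    funext i; fin_cases i <;> simp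
  have e4 : Function.update (fun _ : Fin 2 => (Set.univ : Set ℕ)) 0 (Set.Iio M) =
      ![Set.Iio M, Set.univ] := by
    funext i; fin_cases i <;> simp
  have e5 : Function.update (fun _ : Fin 2 => (Set.univ : Set ℕ)) 0 (Set.Iio M)ᶜ =
      ![(Set.Iio M)ᶜ, Set.univ] := by
    funext i; fin_cases i <;> simp
  have e6 : Function.update (fun _ : Fin 2 => (Set.univ : Set ℕ)) 0 Set.univ =
      fun _ => Set.univ := by simp
  rw [e1, e2, e3, h0, zero_add] at h1
  rw [e4, e5, e6, restr_univ] at h2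
  rw [h1, sub_eq_iff_eq_add]
  exact h2.symm

lemma restr_diag_le (M : ℕ) (t : LpT p) :
    ‖restr p (fun _ => Set.Iio M) t‖ ≤ ‖restr p ![Set.Iio M, Set.univ] t‖ := by
  have h : restr p (fun _ => Set.Iio M) t =
      restr p (fun _ => Set.Iio M) (restr p ![Set.Iio M, Set.univ] t) := by
    rw [restr_comp]
    congr 1
    congr 1
    funext i; fin_cases i <;> simp
  rw [h]
  exact restr_le p _ _

/-- The `i`-th row. -/
def rowM (i : ℕ) : MultilinearMap ℝ (Fc p) (Lp' (ENNReal.ofReal (p 1))) where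
  toFun m := (m 0 i) • m 1
  map_update_add' := by
    intro inst m k x y
    obtain rfl : inst = instDecidableEqFin 2 := Subsingleton.elim _ _
    fin_cases k
    · simp [add_smul]
    · simp
  map_update_smul' := by
    intro inst m k c x
    obtain rfl : inst = instDecidableEqFin 2 := Subsingleton.elim _ _
    fin_cases k
    · simp [mul_smul]
    · simpa using smul_comm (m 0 i) c _

lemma rowM_apply (i : ℕ) (m : ∀ k, Fc p k) : rowM p i m = (m 0 i) • m 1 := rfl

lemma rowM_le (i : ℕ) (m : ∀ k, Fc p k) : ‖rowM p i m‖ ≤ 1 * ∏ k, ‖m k‖ := by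
  rw [rowM_apply, norm_smul, one_mul, Fin.prod_univ_two]
  refine mul_le_mul_of_nonneg_right ?_ (norm_nonneg _)
  exact lp.norm_apply_le_norm
    (zero_lt_one.trans_le (Fact.out : (1 : ℝ≥0∞) ≤ ENNReal.ofReal (p 0))).ne' (m 0) i

/-- The `i`-th row as an operator on the tensor product. -/
def row (i : ℕ) : LpT p →L[ℝ] Lp' (ENNReal.ofReal (p 1)) :=
  liftC (F := Fc p) (rowM p i) 1 zero_le_one (rowM_le p i)

/-- Embedding `v ↦ e_i ⊗ v`. -/
def colJ (i : ℕ) : Lp' (ENNReal.ofReal (p 1)) →L[ℝ] LpT p :=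
  LinearMap.mkContinuous
    ((tC (Fc p)).toLinearMap (fun k => e' (ENNReal.ofReal (p k)) i) 1) 1 (fun v => by
      refine (norm_tC_le (F := Fc p) _).trans ?_
      rw [Fin.prod_univ_two]
      simp [norm_e'])

lemma colJ_apply (i : ℕ) (v : Lp' (ENNReal.ofReal (p 1))) :
    colJ p i v = tC (Fc p) (Function.update (fun k => e' (ENNReal.ofReal (p k)) i) 1 v) := rfl

lemma colJ_le (i : ℕ) (v : Lp' (ENNReal.ofReal (p 1))) : ‖colJ p i v‖ ≤ ‖v‖ := by
  rw [colJ_apply]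
  refine (norm_tC_le (F := Fc p) _).trans ?_
  rw [Fin.prod_univ_two]
  simp [norm_e']

lemma restr_rows (M : ℕ) (t : LpT p) :
    restr p ![Set.Iio M, Set.univ] t = ∑ i ∈ Finset.range M, colJ p i (row p i t) := by
  have h := ext_of_elem (F := Fc p) (restr p ![Set.Iio M, Set.univ])
    (∑ i ∈ Finset.range M, (colJ p i).comp (row p i)) (fun m => ?_) t
  · rw [h]; simp
  · rw [restr_tC]
    have e1 : (fun i => indL (ENNReal.ofReal (p i))
        ((![Set.Iio M, Set.univ] : Fin 2 → Set ℕ) i) (m i)) =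
        Function.update m 0 (∑ i ∈ Finset.range M, m 0 i • e' (ENNReal.ofReal (p 0)) i) := by
      rw [← indL_Iio_eq]
      funext k; fin_cases k
      · simp
      · simp [indL_univ]
    rw [e1, MultilinearMap.map_update_sum]
    rw [sum_apply]
    refine Finset.sum_congr rfl fun i _ => ?_
    rw [ContinuousLinearMap.comp_apply, row, liftC_tC, rowM_apply, map_smul, colJ_apply,
      MultilinearMap.map_update_smul]
    congr 2
    funext k; fin_cases k
    · simp
    · simp

lemma restr_rows_le (M : ℕ) (t : LpT p) :
    ‖restr p ![Set.Iio M, Set.univ] t‖ ≤ ∑ i ∈ Finset.range M, ‖row p i t‖ := by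
  rw [restr_rows]
  exact (norm_sum_le _ _).trans (Finset.sum_le_sum fun i _ => colJ_le p i _)

lemma tensor_pow (hp : ∀ i, 1 < p i) (r : ℝ) (hr1 : 1 ≤ r) (hr : p 0 * p 1 / (p 0 + p 1) ≤ r)
    (S : Set ℕ) (t : LpT p) :
    ‖restr p (fun _ => S) t‖ ^ r + ‖restr p (fun _ => Sᶜ) t‖ ^ r ≤ ‖t‖ ^ r := by
  have hr0 : 0 < r := by linarith
  have : Fact (1 ≤ ENNReal.ofReal r) := ⟨by simpa using hr1⟩
  have htr : (ENNReal.ofReal r).toReal = r := ENNReal.toReal_ofReal hr0.le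
  let L : LpT p →L[ℝ] WithLp (ENNReal.ofReal r) (LpT p × LpT p) :=
    ((WithLp.prodContinuousLinearEquiv (ENNReal.ofReal r) ℝ (LpT p) (LpT p)).symm :
      (LpT p × LpT p) →L[ℝ] _).comp ((restr p (fun _ => S)).prod (restr p (fun _ => Sᶜ)))
  have hL : ∀ t, ‖L t‖ = (‖restr p (fun _ => S) t‖ ^ r + ‖restr p (fun _ => Sᶜ) t‖ ^ r) ^ (1 / r) := by
    intro t
    rw [WithLp.prod_norm_eq_add (by rw [htr]; exact hr0), htr]
    rfl
  have hb := bound_of_elem (F := Fc p) L 1 zero_le_one (fun m => by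
    refine (le_of_eq (hL _)).trans ?_
    rw [one_mul, one_div, Real.rpow_inv_le_iff_of_pos (by positivity) (by positivity) hr0,
      restr_tC, restr_tC]
    have n1 := norm_tC_le (F := Fc p) (fun i => indL (ENNReal.ofReal (p i)) S (m i))
    have n2 := norm_tC_le (F := Fc p) (fun i => indL (ENNReal.ofReal (p i)) Sᶜ (m i))
    rw [Fin.prod_univ_two] at n1 n2 ⊢
    have tp : ∀ i, (ENNReal.ofReal (p i)).toReal = p i := fun i =>
      ENNReal.toReal_ofReal (by linarith [hp i])
    have q0 := indL_pow (P := ENNReal.ofReal (p 0)) (by rw [tp]; exact hp 0) S (m 0)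
    have q1 := indL_pow (P := ENNReal.ofReal (p 1)) (by rw [tp]; exact hp 1) S (m 1)
    rw [tp] at q0 q1
    refine le_trans (add_le_add (Real.rpow_le_rpow (norm_nonneg _) n1 hr0.le)
      (Real.rpow_le_rpow (norm_nonneg _) n2 hr0.le)) ?_
    exact young_pair (p 0) (p 1) r _ _ _ _ _ _ (hp 0) (hp 1) hr0 hr (norm_nonneg _) (norm_nonneg _)
      (norm_nonneg _) (norm_nonneg _) (norm_nonneg _) (norm_nonneg _) q0 q1) t
  have hb' := (hL t).symm.le.trans hb
  rwa [one_mul, one_div, Real.rpow_inv_le_iff_of_pos (by positivity) (by positivity) hr0] at hb'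

lemma restr_compl_tendsto (hp : ∀ i, 1 < p i) (t : LpT p) :
    Tendsto (fun M : ℕ => restr p (fun _ => (Set.Iio M)ᶜ) t) atTop (𝓝 0) := by
  refine tend_of_elem (F := Fc p) (fun M : ℕ => restr p (fun _ => (Set.Iio M)ᶜ)) 1 zero_le_one
    (fun M t => by rw [one_mul]; exact restr_le p _ t) (fun m => ?_) t
  have tp : ∀ i, (ENNReal.ofReal (p i)).toReal = p i := fun i =>
      ENNReal.toReal_ofReal (by linarith [hp i])
  have h0 := (indL_compl_tendsto (P := ENNReal.ofReal (p 0)) (by rw [tp]; exact hp 0) (m 0)).norm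
  have h1 := (indL_compl_tendsto (P := ENNReal.ofReal (p 1)) (by rw [tp]; exact hp 1) (m 1)).norm
  have h2 := h0.mul h1
  rw [norm_zero, zero_mul] at h2
  refine squeeze_zero_norm (fun M => ?_) h2
  rw [restr_tC]
  refine (norm_tC_le (F := Fc p) _).trans ?_
  rw [Fin.prod_univ_two]

lemma restr_rowset_tendsto (hp : ∀ i, 1 < p i) (k : Fin 2) (t : LpT p) :
    Tendsto (fun M : ℕ => restr p (Function.update (fun _ => Set.univ) k (Set.Iio M)ᶜ) t)
      atTop (𝓝 0) := by
  refine tend_of_elem (F := Fc p)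
    (fun M : ℕ => restr p (Function.update (fun _ => Set.univ) k (Set.Iio M)ᶜ)) 1 zero_le_one
    (fun M t => by rw [one_mul]; exact restr_le p _ t) (fun m => ?_) t
  have tp : ∀ i, (ENNReal.ofReal (p i)).toReal = p i := fun i =>
      ENNReal.toReal_ofReal (by linarith [hp i])
  have h0 := (indL_compl_tendsto (P := ENNReal.ofReal (p k)) (by rw [tp]; exact hp k) (m k)).norm
  have h2 := h0.mul_const (∏ i ∈ Finset.univ.erase k, ‖m i‖)
  rw [norm_zero, zero_mul] at h2
  refine squeeze_zero_norm (fun M => ?_) h2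
  rw [restr_tC]
  refine (norm_tC_le (F := Fc p) _).trans ?_
  rw [← Finset.mul_prod_erase _ _ (Finset.mem_univ k), Function.update_self]
  refine mul_le_mul_of_nonneg_left ?_ (norm_nonneg _)
  exact Finset.prod_le_prod (fun _ _ => norm_nonneg _) fun i _ => indL_le _ _

lemma restr_tendsto (hp : ∀ i, 1 < p i) (t : LpT p) :
    Tendsto (fun M : ℕ => restr p (fun _ => Set.Iio M) t) atTop (𝓝 t) := by
  have key : ∀ M : ℕ, ‖t - restr p (fun _ => Set.Iio M) t‖ ≤
      ‖restr p (Function.update (fun _ => Set.univ) 0 (Set.Iio M)ᶜ) t‖ +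
      ‖restr p (Function.update (fun _ => Set.univ) 1 (Set.Iio M)ᶜ) t‖ := by
    intro M
    have h1 := restr_split p (fun _ => Set.univ) 0 (Set.Iio M) t
    have h2 := restr_split p (Function.update (fun _ => Set.univ) 0 (Set.Iio M)) 1 (Set.Iio M) t
    have e1 : Function.update (fun _ : Fin 2 => (Set.univ : Set ℕ)) 0 Set.univ =
      fun _ => Set.univ := by simp
    have e2 : Function.update (Function.update (fun _ : Fin 2 => (Set.univ : Set ℕ)) 0 (Set.Iio M))
        1 (Set.Iio M) = fun _ => Set.Iio M := by
      funext i; fin_cases i <;> simp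
    have e3 : Function.update (Function.update (fun _ : Fin 2 => (Set.univ : Set ℕ)) 0 (Set.Iio M))
        1 Set.univ = Function.update (fun _ => Set.univ) 0 (Set.Iio M) := by
      funext i; fin_cases i <;> simp
    have h3 : restr p (Function.update (Function.update (fun _ => Set.univ) 0 (Set.Iio M))
        1 (Set.Iio M)ᶜ) t = restr p (Function.update (fun _ => Set.univ) 0 (Set.Iio M))
          (restr p (Function.update (fun _ => Set.univ) 1 (Set.Iio M)ᶜ) t) := by
      rw [restr_comp]
      congr 1
      congr 1
      funext i; fin_cases i <;> simp
    have h4 := restr_le p (Function.update (fun _ => Set.univ) 0 (Set.Iio M))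
          (restr p (Function.update (fun _ => Set.univ) 1 (Set.Iio M)ᶜ) t)
    rw [← h3] at h4
    rw [e1, restr_univ] at h1
    rw [e2, e3] at h2
    have h5 : t - restr p (fun _ => Set.Iio M) t =
        restr p (Function.update (fun _ => Set.univ) 0 (Set.Iio M)ᶜ) t +
        restr p (Function.update (Function.update (fun _ => Set.univ) 0 (Set.Iio M))
          1 (Set.Iio M)ᶜ) t := by
      rw [sub_eq_iff_eq_add]
      calc t = _ := h1.symm
        _ = _ := by rw [← h2]; abel
    rw [h5]
    exact (norm_add_le _ _).trans (add_le_add le_rfl h4)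
  have h0 := (restr_rowset_tendsto p hp 0 t).norm.add (restr_rowset_tendsto p hp 1 t).norm
  rw [norm_zero, add_zero] at h0
  have h1 := squeeze_zero_norm key h0
  have h2 := (tendsto_const_nhds (x := t)).sub h1
  rw [sub_zero] at h2
  refine h2.congr fun M => ?_
  abel

end restriction

/-- If `1 < p₁ ≠ p₂ < ∞`, then `ℓ_{p₁}` does not embed isomorphically into
the upper triangular subspace of `ℓ_{p₁} ⊗̂ ℓ_{p₂}`. -/
theorem stmt12 (p : Fin 2 → ℝ) [∀ i, Fact (1 ≤ ENNReal.ofReal (p i))]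
    (hp : ∀ i, 1 < p i) (hne : p 0 ≠ p 1) :
    ¬ EmbedsIn (Lp' (ENNReal.ofReal (p 0))) (↥(UpperTri p)) := by
  rintro ⟨f, c, hc, hf⟩
  have tp : ∀ i, (ENNReal.ofReal (p i)).toReal = p i := fun i =>
    ENNReal.toReal_ofReal (by linarith [hp i])
  have h0 := hp 0
  have h1 := hp 1
  set r : ℝ := max 1 (p 0 * p 1 / (p 0 + p 1)) with hr
  have hrp : r < p 0 := by
    refine max_lt h0 ?_
    rw [div_lt_iff₀ (by linarith)]
    nlinarith
  have hr1 : 1 ≤ r := le_max_left _ _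
  let g : Lp' (ENNReal.ofReal (p 0)) →L[ℝ] LpT p := (UpperTri p).subtypeL.comp f
  have hg : ∀ x, g x ∈ UpperTri p := fun x => (f x).2
  have hgc : ∀ x, c * ‖x‖ ≤ ‖g x‖ := fun x => hf x
  refine block_lower (by rw [tp]; exact h0) g r c (by linarith) (by rw [tp]; exact hrp) hc
    (fun M => restr p (fun _ => Set.Iio M)) (fun M => restr p (fun _ => (Set.Iio M)ᶜ))
    (fun M t => tensor_pow p hp r hr1 (le_max_right _ _) _ t)
    (restr_tendsto p hp) (restr_compl_tendsto p hp) fun M N ε hε => ?_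
  obtain ⟨x, b, hx, hx1, hx2⟩ := row_small (P := ENNReal.ofReal (p 0)) (R := ENNReal.ofReal (p 1))
    (by rw [tp]; exact h0) (by rw [tp]; exact h1) (by rw [tp, tp]; exact hne) M
    (fun i => (row p i).comp g) N (ε / (M + 1)) (by positivity)
  have hsm : ‖restr p ![Set.Iio M, Set.univ] (g x)‖ ≤ ε := by
    refine (restr_rows_le p M (g x)).trans ((Finset.sum_le_sum hx2).trans ?_)
    rw [Finset.sum_const, Finset.card_range, nsmul_eq_mul, mul_div_assoc', div_le_iff₀ (by positivity)]
    nlinarith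
  refine ⟨x, b, hx, hx1, ?_, (restr_diag_le p M (g x)).trans hsm, ?_⟩
  · have := hgc x
    rwa [hx1, mul_one] at this
  · rw [tri_sub p M _ (hg x)]
    exact hsm
end
end

section
/- Let X = ℓ_{p₁} ⊗̂ ⋯ ⊗̂ ℓ_{p_N} with 1 < pᵢ < ∞ and 1/r = min{1, Σᵢ 1/pᵢ}. Then X is isomorphic to the ℓ_r-sum (Σ ⊕ X)_r of countably many copies of itself. -/
open scoped TensorProduct ENNReal
open PiTensorProduct

noncomputable section

variable (ι : Type*) [Fintype ι] (E : ι → Type*)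
  [∀ i, NormedAddCommGroup (E i)] [∀ i, NormedSpace ℝ (E i)]

section Interface

variable {N : ℕ} {V : Fin N → Type} [∀ i, NormedAddCommGroup (V i)] [∀ i, NormedSpace ℝ (V i)]

/-- The elementary tensor map as a multilinear map into the completion. -/
def tprodM (V : Fin N → Type) [∀ i, NormedAddCommGroup (V i)] [∀ i, NormedSpace ℝ (V i)] :
    MultilinearMap ℝ V (ProjTensor (Fin N) V) :=
  (UniformSpace.Completion.toComplL (𝕜 := ℝ) (E := ⨂[ℝ] i, V i)).toLinearMap.compMultilinearMap
    (PiTensorProduct.tprod ℝ)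

lemma norm_tprodM_le (m : ∀ i, V i) : ‖tprodM V m‖ ≤ ∏ i, ‖m i‖ := by
  have h : tprodM V m = ((⨂ₜ[ℝ] i, m i : ⨂[ℝ] i, V i) : UniformSpace.Completion _) := rfl
  rw [h]
  exact (UniformSpace.Completion.norm_coe _).le.trans
    (PiTensorProduct.projectiveSeminorm_tprod_le (𝕜 := ℝ) m)

lemma norm_lift_le {G : Type*} [SeminormedAddCommGroup G] [NormedSpace ℝ G]
    (f : MultilinearMap ℝ V G) {C : ℝ} (hC : 0 ≤ C) (h : ∀ m, ‖f m‖ ≤ C * ∏ i, ‖m i‖)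
    (x : ⨂[ℝ] i, V i) : ‖PiTensorProduct.lift f x‖ ≤ C * ‖x‖ := by
  have h1 := PiTensorProduct.norm_eval_le_projectiveSeminorm (𝕜 := ℝ) (f.mkContinuous C h) x
  have h2 := f.mkContinuous_norm_le hC h
  refine h1.trans ?_
  exact mul_le_mul_of_nonneg_right h2 (norm_nonneg (x : ⨂[ℝ] i, V i))

lemma norm_clm_le {G : Type*} [SeminormedAddCommGroup G] [NormedSpace ℝ G]
    (T : ProjTensor (Fin N) V →L[ℝ] G) {C : ℝ} (hC : 0 ≤ C)
    (h : ∀ m, ‖T (tprodM V m)‖ ≤ C * ∏ i, ‖m i‖) (x : ProjTensor (Fin N) V) :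
    ‖T x‖ ≤ C * ‖x‖ := by
  refine UniformSpace.Completion.induction_on x ?_ ?_
  · exact isClosed_le (by fun_prop) (by fun_prop)
  · intro a
    have h1 := norm_lift_le (T.toLinearMap.compMultilinearMap (tprodM V)) hC h a
    have h3 : ‖(a : UniformSpace.Completion (⨂[ℝ] i, V i))‖ = ‖a‖ :=
      UniformSpace.Completion.norm_coe a
    have h2 : PiTensorProduct.lift (T.toLinearMap.compMultilinearMap (tprodM V)) =
        T.toLinearMap ∘ₗ (UniformSpace.Completion.toComplL (𝕜 := ℝ)
          (E := ⨂[ℝ] i, V i)).toLinearMap := by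
      ext m
      simp [tprodM]
    rw [h2] at h1
    exact h1.trans (mul_le_mul_of_nonneg_left h3.ge hC)

/-- it suffices to test on elementary tensors of norm-one-bounded vectors -/
lemma norm_clm_le' {G : Type*} [SeminormedAddCommGroup G] [NormedSpace ℝ G]
    (T : ProjTensor (Fin N) V →L[ℝ] G) {C : ℝ} (hC : 0 ≤ C)
    (h : ∀ m : ∀ i, V i, (∀ i, ‖m i‖ ≤ 1) → ‖T (tprodM V m)‖ ≤ C) (x : ProjTensor (Fin N) V) :
    ‖T x‖ ≤ C * ‖x‖ := by
  refine norm_clm_le T hC (fun m => ?_) x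
  have hm : m = fun i => ‖m i‖ • (‖m i‖⁻¹ • m i) := by
    funext i
    by_cases h0 : m i = 0
    · simp [h0]
    · rw [smul_smul, mul_inv_cancel₀ (norm_ne_zero_iff.mpr h0), one_smul]
  have h1 := h (fun i => ‖m i‖⁻¹ • m i) (fun i => by
    rw [norm_smul, norm_inv, norm_norm]
    exact inv_mul_le_one)
  have h2 : tprodM V m = (∏ i, ‖m i‖) • tprodM V (fun i => ‖m i‖⁻¹ • m i) := by
    conv_lhs => rw [hm]
    rw [MultilinearMap.map_smul_univ]
  rw [h2, map_smul, norm_smul, Real.norm_of_nonneg (by positivity), mul_comm]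
  gcongr

lemma clm_ext {G : Type*} [NormedAddCommGroup G] [NormedSpace ℝ G]
    (T T' : ProjTensor (Fin N) V →L[ℝ] G) (h : ∀ m, T (tprodM V m) = T' (tprodM V m)) :
    T = T' := by
  ext x
  have := norm_clm_le (T - T') le_rfl (fun m => by simp [h]) x
  rw [zero_mul] at this
  have := norm_le_zero_iff.mp this
  simpa [sub_eq_zero] using this

lemma exists_lift {G : Type*} [NormedAddCommGroup G] [NormedSpace ℝ G] [CompleteSpace G]
    (f : MultilinearMap ℝ V G) {C : ℝ} (hC : 0 ≤ C) (h : ∀ m, ‖f m‖ ≤ C * ∏ i, ‖m i‖) :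
    ∃ T : ProjTensor (Fin N) V →L[ℝ] G, ∀ m, T (tprodM V m) = f m := by
  let g : (⨂[ℝ] i, V i) →L[ℝ] G :=
    LinearMap.mkContinuous (PiTensorProduct.lift f) C (norm_lift_le f hC h)
  refine ⟨g.extend (UniformSpace.Completion.toComplL (𝕜 := ℝ) (E := ⨂[ℝ] i, V i)), fun m => ?_⟩
  have h1 := ContinuousLinearMap.extend_eq g
    (e := UniformSpace.Completion.toComplL (𝕜 := ℝ) (E := ⨂[ℝ] i, V i))
    UniformSpace.Completion.denseRange_coe
    (UniformSpace.Completion.isUniformInducing_coe _) (⨂ₜ[ℝ] i, m i)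
  refine h1.trans ?_
  exact PiTensorProduct.lift.tprod m

/-- functoriality -/
lemma exists_map (S : ∀ i, V i →L[ℝ] V i) (hS : ∀ i x, ‖S i x‖ ≤ ‖x‖) :
    ∃ T : ProjTensor (Fin N) V →L[ℝ] ProjTensor (Fin N) V,
      (∀ m, T (tprodM V m) = tprodM V (fun i => S i (m i))) ∧ ∀ x, ‖T x‖ ≤ ‖x‖ := by
  have hb : ∀ m : ∀ i, V i, ‖tprodM V (fun i => S i (m i))‖ ≤ 1 * ∏ i, ‖m i‖ := fun m => by
    rw [one_mul]
    refine (norm_tprodM_le _).trans ?_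
    exact Finset.prod_le_prod (fun _ _ => norm_nonneg _) (fun i _ => hS i _)
  obtain ⟨T, hT⟩ := exists_lift
    ((tprodM V).compLinearMap (fun i => (S i).toLinearMap)) zero_le_one hb
  refine ⟨T, hT, fun x => ?_⟩
  have := norm_clm_le T zero_le_one (fun m => by rw [hT]; exact hb m) x
  rwa [one_mul] at this

end Interface

section Reindex

variable {G : Type*} [NormedAddCommGroup G] [NormedSpace ℝ G] {q : ℝ≥0∞} [Fact (1 ≤ q)]

lemma summable_ext {G : Type*} [NormedAddCommGroup G] {f : ℕ → ℕ} (hf : Function.Injective f) (w : ℕ → G) {s : ℝ} (hs : 0 < s)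
    {a : ℝ} (hw : HasSum (fun n => ‖w n‖ ^ s) a) :
    HasSum (fun j => ‖Function.extend f w 0 j‖ ^ s) a := by
  rw [← Function.Injective.hasSum_iff hf]
  · have : ((fun j => ‖Function.extend f w 0 j‖ ^ s) ∘ f) = fun n => ‖w n‖ ^ s := by
      funext n
      simp [hf.extend_apply]
    rwa [this]
  · intro x hx
    rw [Function.extend_apply' _ _ _ (by simpa using hx)]
    simp [Real.zero_rpow hs.ne']

/-- Restriction of a sequence along an injective reindexing. -/
def lpRes (G : Type*) [NormedAddCommGroup G] [NormedSpace ℝ G] {q : ℝ≥0∞} [Fact (1 ≤ q)]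
    (hq : 0 < q.toReal) {f : ℕ → ℕ} (hf : Function.Injective f) :
    lp (fun _ : ℕ => G) q →L[ℝ] lp (fun _ : ℕ => G) q :=
  LinearMap.mkContinuous
    { toFun := fun u => ⟨fun n => u (f n),
        memℓp_gen (((lp.memℓp u).summable hq).comp_injective hf)⟩
      map_add' := fun _ _ => rfl
      map_smul' := fun _ _ => rfl } 1 (fun u => by
    rw [one_mul]
    refine lp.norm_le_of_tsum_le hq (norm_nonneg _) ?_
    rw [lp.norm_rpow_eq_tsum hq u]
    exact tsum_comp_le_tsum_of_inj ((lp.memℓp u).summable hq) (fun _ => by positivity) hf)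

lemma lpRes_apply (hq : 0 < q.toReal) {f : ℕ → ℕ} (hf : Function.Injective f)
    (u : lp (fun _ : ℕ => G) q) (n : ℕ) : lpRes G hq hf u n = u (f n) := rfl

/-- Extension by zero of a sequence along an injective reindexing. -/
def lpExt (G : Type*) [NormedAddCommGroup G] [NormedSpace ℝ G] {q : ℝ≥0∞} [Fact (1 ≤ q)]
    (hq : 0 < q.toReal) {f : ℕ → ℕ} (hf : Function.Injective f) :
    lp (fun _ : ℕ => G) q →L[ℝ] lp (fun _ : ℕ => G) q :=
  LinearMap.mkContinuous
    { toFun := fun w => ⟨Function.extend f w 0,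
        memℓp_gen (summable_ext hf w hq (lp.hasSum_norm hq w)).summable⟩
      map_add' := fun v w => by
        apply lp.ext
        funext j
        change Function.extend f (fun n => v n + w n) 0 j =
          Function.extend f v 0 j + Function.extend f w 0 j
        by_cases h : ∃ n, f n = j
        · obtain ⟨n, rfl⟩ := h
          rw [hf.extend_apply, hf.extend_apply, hf.extend_apply]
        · simp only [Function.extend_apply' _ _ _ h, Pi.zero_apply, add_zero]
      map_smul' := fun c w => by
        apply lp.ext
        funext j
        by_cases h : ∃ n, f n = j
        · obtain ⟨n, rfl⟩ := h
          simp [hf.extend_apply]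
        · simp [Function.extend_apply' _ _ _ h] } 1 (fun w => by
    rw [one_mul]
    refine lp.norm_le_of_tsum_le hq (norm_nonneg _) ?_
    exact (summable_ext hf w hq (lp.hasSum_norm hq w)).tsum_eq.le)

lemma lpExt_apply (hq : 0 < q.toReal) {f : ℕ → ℕ} (hf : Function.Injective f)
    (w : lp (fun _ : ℕ => G) q) (n : ℕ) : lpExt G hq hf w (f n) = w n :=
  hf.extend_apply _ _ _

lemma lpExt_apply' (hq : 0 < q.toReal) {f : ℕ → ℕ} (hf : Function.Injective f)
    (w : lp (fun _ : ℕ => G) q) (j : ℕ) (h : ∀ n, f n ≠ j) : lpExt G hq hf w j = 0 :=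
  Function.extend_apply' _ _ _ (by simpa using h)

lemma norm_lpRes_le (hq : 0 < q.toReal) {f : ℕ → ℕ} (hf : Function.Injective f)
    (u : lp (fun _ : ℕ => G) q) : ‖lpRes G hq hf u‖ ≤ ‖u‖ :=
  ((lpRes G hq hf).le_of_opNorm_le (LinearMap.mkContinuous_norm_le _ zero_le_one _) u).trans
    (one_mul _).le

lemma norm_lpExt_le (hq : 0 < q.toReal) {f : ℕ → ℕ} (hf : Function.Injective f)
    (u : lp (fun _ : ℕ => G) q) : ‖lpExt G hq hf u‖ ≤ ‖u‖ :=
  ((lpExt G hq hf).le_of_opNorm_le (LinearMap.mkContinuous_norm_le _ zero_le_one _) u).trans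
    (one_mul _).le

/-- `Z ⊕ Z ≅ Z`. -/
lemma lp_double (hq : 0 < q.toReal) :
    Nonempty ((lp (fun _ : ℕ => G) q × lp (fun _ : ℕ => G) q) ≃L[ℝ] lp (fun _ : ℕ => G) q) := by
  have he : Function.Injective (fun n : ℕ => 2 * n) := fun a b h => by
    simp only at h; omega
  have ho : Function.Injective (fun n : ℕ => 2 * n + 1) := fun a b h => by
    simp only at h; omega
  refine ⟨ContinuousLinearEquiv.equivOfInverse
    ((lpExt G hq he).coprod (lpExt G hq ho)) ((lpRes G hq he).prod (lpRes G hq ho)) ?_ ?_⟩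
  · rintro ⟨a, b⟩
    ext n
    · have h1 := lpExt_apply hq he a n
      have h2 := lpExt_apply' hq ho b (2 * n) (fun m => by omega)
      simp only [ContinuousLinearMap.coprod_apply, ContinuousLinearMap.prod_apply, lpRes_apply,
        lp.coeFn_add, Pi.add_apply]
      rw [h1, h2, add_zero]
    · have h1 := lpExt_apply hq ho b n
      have h2 := lpExt_apply' hq he a (2 * n + 1) (fun m => by omega)
      simp only [ContinuousLinearMap.coprod_apply, ContinuousLinearMap.prod_apply, lpRes_apply,
        lp.coeFn_add, Pi.add_apply]
      rw [h1, h2, zero_add]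
  · intro u
    ext j
    simp only [ContinuousLinearMap.coprod_apply, ContinuousLinearMap.prod_apply,
        lp.coeFn_add, Pi.add_apply]
    rcases Nat.even_or_odd' j with ⟨n, rfl | rfl⟩
    · have h1 := lpExt_apply hq he (lpRes G hq he u) n
      have h2 := lpExt_apply' hq ho (lpRes G hq ho u) (2 * n) (fun m => by omega)
      rw [h1, h2, add_zero, lpRes_apply]
    · have h1 := lpExt_apply hq ho (lpRes G hq ho u) n
      have h2 := lpExt_apply' hq he (lpRes G hq he u) (2 * n + 1) (fun m => by omega)
      rw [h1, h2, zero_add, lpRes_apply]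

/-- `X ⊕ Z ≅ Z`. -/
lemma lp_cons (hq : 0 < q.toReal) :
    Nonempty ((G × lp (fun _ : ℕ => G) q) ≃L[ℝ] lp (fun _ : ℕ => G) q) := by
  have hs : Function.Injective (fun n : ℕ => n + 1) := fun a b h => by
    simp only at h; omega
  refine ⟨ContinuousLinearEquiv.equivOfInverse
    ((lp.singleContinuousLinearMap ℝ (fun _ : ℕ => G) q 0).coprod (lpExt G hq hs))
    ((lp.evalCLM ℝ (fun _ : ℕ => G) q 0).prod (lpRes G hq hs)) ?_ ?_⟩
  · rintro ⟨a, b⟩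
    have h0 := lpExt_apply' hq hs b 0 (fun m => by omega)
    refine Prod.ext ?_ (lp.ext (funext fun n => ?_))
    · change (lp.single q 0 a + lpExt G hq hs b : lp (fun _ : ℕ => G) q) 0 = a
      rw [lp.coeFn_add, Pi.add_apply, h0, lp.single_apply_self, add_zero]
    · change (lp.single q 0 a + lpExt G hq hs b : lp (fun _ : ℕ => G) q) (n + 1) = b n
      rw [lp.coeFn_add, Pi.add_apply, lp.single_apply_ne _ _ _ (by omega), zero_add]
      exact lpExt_apply hq hs b n
  · intro u
    refine lp.ext (funext fun j => ?_)
    change (lp.single q 0 (u 0) + lpExt G hq hs (lpRes G hq hs u) : lp (fun _ : ℕ => G) q) j = u j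
    rw [lp.coeFn_add, Pi.add_apply]
    rcases j with _ | n
    · rw [lp.single_apply_self, lpExt_apply' hq hs _ 0 (fun m => by omega), add_zero]
    · rw [lp.single_apply_ne _ _ _ (by omega), zero_add]
      exact lpExt_apply hq hs _ n

/-- The decomposition argument. -/
lemma decomposition (hq : 0 < q.toReal) (Q : G →L[ℝ] lp (fun _ : ℕ => G) q)
    (J : lp (fun _ : ℕ => G) q →L[ℝ] G) (h : ∀ z, Q (J z) = z) :
    Nonempty (G ≃L[ℝ] lp (fun _ : ℕ => G) q) := by
  obtain ⟨d⟩ := lp_double (G := G) hq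
  obtain ⟨c⟩ := lp_cons (G := G) hq
  let e := ContinuousLinearEquiv.equivOfRightInverse Q J h
  let k := Q.ker
  let e1 : G ≃L[ℝ] k × lp (fun _ : ℕ => G) q := e.trans (ContinuousLinearEquiv.prodComm ℝ _ _)
  let refl' := ContinuousLinearEquiv.refl ℝ (lp (fun _ : ℕ => G) q)
  let reflk := ContinuousLinearEquiv.refl ℝ k
  exact ⟨(c.symm.trans ((e1.prodCongr refl').trans
    ((ContinuousLinearEquiv.prodAssoc ℝ _ _ _).trans
      ((reflk.prodCongr d).trans e1.symm)))).symm⟩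

end Reindex

section Rows

variable {q : ℝ≥0∞} [Fact (1 ≤ q)]

lemma pair_inj (k : ℕ) : Function.Injective (fun n => Nat.pair k n) := fun a b h => by
  have := Nat.pair_eq_pair.mp h
  exact this.2

lemma hasSum_rows (hq : 0 < q.toReal) (u : Lp' q) :
    HasSum (fun k => ‖lpRes ℝ hq (pair_inj k) u‖ ^ q.toReal) (‖u‖ ^ q.toReal) := by
  have h1 := lp.hasSum_norm hq u
  have h2 : HasSum (fun x : ℕ × ℕ => ‖u (Nat.pair x.1 x.2)‖ ^ q.toReal) (‖u‖ ^ q.toReal) :=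
    (Nat.pairEquiv.hasSum_iff (f := fun i => ‖u i‖ ^ q.toReal)).mpr h1
  exact h2.prod_fiberwise (fun k => lp.hasSum_norm hq (lpRes ℝ hq (pair_inj k) u))

lemma res_ext (hq : 0 < q.toReal) (k l : ℕ) (w : Lp' q) :
    lpRes ℝ hq (pair_inj k) (lpExt ℝ hq (pair_inj l) w) = if k = l then w else 0 := by
  refine lp.ext (funext fun n => ?_)
  rw [lpRes_apply]
  split_ifs with h
  · subst h
    exact lpExt_apply hq (pair_inj k) w n
  · rw [lpExt_apply']
    · rfl
    · intro m hm
      exact h (Nat.pair_eq_pair.mp hm).1.symm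

lemma norm_sum_ext (hq : 0 < q.toReal) (F : Finset ℕ) (w : ℕ → Lp' q) :
    ‖∑ k ∈ F, lpExt ℝ hq (pair_inj k) (w k)‖ ^ q.toReal = ∑ k ∈ F, ‖w k‖ ^ q.toReal := by
  have h1 := hasSum_rows hq (∑ k ∈ F, lpExt ℝ hq (pair_inj k) (w k))
  have h2 : ∀ k, lpRes ℝ hq (pair_inj k) (∑ k ∈ F, lpExt ℝ hq (pair_inj k) (w k)) =
      if k ∈ F then w k else 0 := fun k => by
    rw [map_sum]
    simp only [res_ext]
    exact Finset.sum_ite_eq F k w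
  simp only [h2] at h1
  refine h1.unique ?_
  have h3 := hasSum_sum_of_ne_finset_zero (s := F) (L := .unconditional ℕ)
    (f := fun k => ‖if k ∈ F then w k else 0‖ ^ q.toReal) (fun k hk => by
      simp [hk, Real.zero_rpow hq.ne'])
  convert h3 using 1
  exact Finset.sum_congr rfl (fun k hk => by simp [hk])

end Rows

section Signs

variable {N : ℕ} {V : Fin N → Type} [∀ i, NormedAddCommGroup (V i)] [∀ i, NormedSpace ℝ (V i)]

lemma units_sgn_sum {A : Type*} [Fintype A] [DecidableEq A] (a b : A) :
    ∑ d : A → ℤˣ, (((d a : ℤ) : ℝ) * ((d b : ℤ) : ℝ)) =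
      if a = b then (Fintype.card (A → ℤˣ) : ℝ) else 0 := by
  split_ifs with h
  · subst h
    have : ∀ d : A → ℤˣ, (((d a : ℤ) : ℝ) * ((d a : ℤ) : ℝ)) = 1 := fun d => by
      rcases Int.units_eq_one_or (d a) with h | h <;> simp [h]
    simp [this]
  · have h1 := Equiv.sum_comp (Equiv.mulRight (Pi.mulSingle a (-1 : ℤˣ) : A → ℤˣ))
      (fun d : A → ℤˣ => (((d a : ℤ) : ℝ) * ((d b : ℤ) : ℝ)))
    have h2 : ∀ d : A → ℤˣ,
        ((((Equiv.mulRight (Pi.mulSingle a (-1 : ℤˣ) : A → ℤˣ)) d a : ℤ) : ℝ) *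
          (((Equiv.mulRight (Pi.mulSingle a (-1 : ℤˣ) : A → ℤˣ)) d b : ℤ) : ℝ)) =
          -(((d a : ℤ) : ℝ) * ((d b : ℤ) : ℝ)) := fun d => by
      have hb : b ≠ a := fun h' => h h'.symm
      simp [Pi.mulSingle_eq_of_ne hb]
    rw [Finset.sum_congr rfl (fun d _ => h2 d), Finset.sum_neg_distrib] at h1
    linarith

lemma const_of_rot {n : ℕ} {A : Type*} (κ : Fin (n + 1) → A) (h : ∀ i, κ (i + 1) = κ i) (i) :
    κ i = κ 0 := by
  induction i using Fin.induction with
  | zero => rfl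
  | succ i ih =>
    rw [← ih, ← h i.castSucc, Fin.coeSucc_eq_succ]

lemma sign_average {n : ℕ} {A : Type*} [Fintype A] [DecidableEq A] {W : Fin (n + 1) → Type*}
    {G : Type*} [∀ i, AddCommGroup (W i)] [∀ i, Module ℝ (W i)] [AddCommGroup G] [Module ℝ G]
    (f : MultilinearMap ℝ W G) (u : ∀ i, A → W i) :
    ∑ ε : Fin (n + 1) → A → ℤˣ,
        f (fun i => ∑ k, (((ε i k : ℤ) : ℝ) * ((ε (i + 1) k : ℤ) : ℝ)) • u i k) =
      ((Fintype.card (A → ℤˣ) : ℝ) ^ (n + 1)) • ∑ k, f (fun i => u i k) := by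
  simp only [MultilinearMap.map_sum, MultilinearMap.map_smul_univ]
  rw [Finset.sum_comm]
  simp only [← Finset.sum_smul]
  have h1 : ∀ κ : Fin (n + 1) → A,
      ∑ ε : Fin (n + 1) → A → ℤˣ,
        ∏ i, (((ε i (κ i) : ℤ) : ℝ) * ((ε (i + 1) (κ i) : ℤ) : ℝ)) =
      ∏ i, if κ (i + 1) = κ i then (Fintype.card (A → ℤˣ) : ℝ) else 0 := by
    intro κ
    have h2 : ∀ ε : Fin (n + 1) → A → ℤˣ,
        ∏ i, (((ε i (κ i) : ℤ) : ℝ) * ((ε (i + 1) (κ i) : ℤ) : ℝ)) =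
        ∏ i, (((ε (i + 1) (κ (i + 1)) : ℤ) : ℝ) * ((ε (i + 1) (κ i) : ℤ) : ℝ)) := by
      intro ε
      rw [Finset.prod_mul_distrib, Finset.prod_mul_distrib]
      congr 1
      exact (Equiv.prod_comp (Equiv.addRight (1 : Fin (n + 1)))
        (fun i => ((ε i (κ i) : ℤ) : ℝ))).symm
    simp only [h2]
    have h3 : ∀ ε : Fin (n + 1) → A → ℤˣ,
        ∏ i, (((ε (i + 1) (κ (i + 1)) : ℤ) : ℝ) * ((ε (i + 1) (κ i) : ℤ) : ℝ)) =
        ∏ i, (((ε i (κ i) : ℤ) : ℝ) * ((ε i (κ (i - 1)) : ℤ) : ℝ)) := by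
      intro ε
      rw [← Equiv.prod_comp (Equiv.addRight (1 : Fin (n + 1)))
        (fun i => (((ε i (κ i) : ℤ) : ℝ) * ((ε i (κ (i - 1)) : ℤ) : ℝ)))]
      simp
    simp only [h3]
    have h4 := Finset.prod_univ_sum (fun _ : Fin (n + 1) => (Finset.univ : Finset (A → ℤˣ)))
      (fun i d => (((d (κ i) : ℤ) : ℝ) * ((d (κ (i - 1)) : ℤ) : ℝ)))
    rw [Fintype.piFinset_univ] at h4
    rw [← h4]
    simp only [units_sgn_sum]
    rw [← Equiv.prod_comp (Equiv.addRight (1 : Fin (n + 1)))]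
    simp
  simp only [h1]
  rw [Finset.smul_sum]
  symm
  refine Finset.sum_of_injOn (fun k => fun _ : Fin (n + 1) => k) ?_ (by simp) ?_ ?_
  · intro a _ b _ hab
    exact congrFun hab 0
  · intro κ _ hκ
    have : ∃ i, κ (i + 1) ≠ κ i := by
      by_contra hcon
      push Not at hcon
      exact hκ ⟨κ 0, by simp, funext fun i => (const_of_rot κ hcon i).symm⟩
    obtain ⟨i, hi⟩ := this
    rw [Finset.prod_eq_zero (Finset.mem_univ i) (by simp [hi]), zero_smul]
  · intro k _
    simp

lemma norm_diag_le (hN : N ≠ 0) (F : Finset ℕ) (u : ∀ i, ℕ → V i) (B : Fin N → ℝ)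
    (hB : ∀ i, ∀ η : ℕ → ℝ, (∀ k, |η k| = 1) → ‖∑ k ∈ F, η k • u i k‖ ≤ B i) :
    ‖∑ k ∈ F, tprodM V (fun i => u i k)‖ ≤ ∏ i, B i := by
  classical
  obtain ⟨n, rfl⟩ := Nat.exists_eq_succ_of_ne_zero hN
  have h := sign_average (A := F) (tprodM V) (fun i k => u i k)
  set c : ℝ := (Fintype.card (F → ℤˣ) : ℝ) with hc
  have hc0 : 0 < c := by
    rw [hc]
    exact_mod_cast Fintype.card_pos
  have hsum : ∑ k : F, tprodM V (fun i => u i k) = ∑ k ∈ F, tprodM V (fun i => u i k) :=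
    Finset.sum_coe_sort F (fun k => tprodM V (fun i => u i k))
  rw [hsum] at h
  have h5 : ∀ z : ℤˣ, |((z : ℤ) : ℝ)| = 1 := fun z => by
    rcases Int.units_eq_one_or z with h | h <;> simp [h]
  have hb : ∀ ε : Fin (n + 1) → F → ℤˣ,
      ‖tprodM V (fun i => ∑ k : F, (((ε i k : ℤ) : ℝ) * ((ε (i + 1) k : ℤ) : ℝ)) • u i k)‖
        ≤ ∏ i, B i := by
    intro ε
    refine (norm_tprodM_le _).trans (Finset.prod_le_prod (fun _ _ => norm_nonneg _) ?_)
    intro i _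
    have := hB i (fun k => if hk : k ∈ F then
      (((ε i ⟨k, hk⟩ : ℤ) : ℝ) * ((ε (i + 1) ⟨k, hk⟩ : ℤ) : ℝ)) else 1) (fun k => by
        split_ifs with hk
        · rw [abs_mul, h5, h5, one_mul]
        · simp)
    rw [← Finset.sum_coe_sort] at this
    simpa using this
  have h6 := norm_sum_le_of_le (Finset.univ) (fun ε _ => hb ε)
  rw [h, norm_smul, Real.norm_of_nonneg (by positivity)] at h6
  have h7 : ((Finset.univ : Finset (Fin (n + 1) → F → ℤˣ)).card : ℝ) = c ^ (n + 1) := by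
    rw [Finset.card_univ, Fintype.card_fun, Fintype.card_fin, hc]
    push_cast
    rfl
  rw [Finset.sum_const, nsmul_eq_mul, h7] at h6
  exact le_of_mul_le_mul_left h6 (by positivity)

end Signs

section Main

lemma holder_aux {N : ℕ} (p : Fin N → ℝ) (hp : ∀ i, 1 < p i) (r : ℝ) (hr0 : 0 < r)
    (hr : 1 ≤ ∑ i, r / p i) (F : Finset ℕ) (a : ℕ → Fin N → ℝ) (ha : ∀ k i, 0 ≤ a k i)
    (hs : ∀ i, ∑ k ∈ F, a k i ^ p i ≤ 1) : ∑ k ∈ F, (∏ i, a k i) ^ r ≤ 1 := by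
  set σ := ∑ i, r / p i with hσ
  have hp0 : ∀ i, 0 < p i := fun i => zero_lt_one.trans (hp i)
  have hσ0 : 0 < σ := by linarith
  have hw : ∑ i, r / p i / σ = 1 := by
    rw [← Finset.sum_div, ← hσ, div_self hσ0.ne']
  have key : ∀ k ∈ F, (∏ i, a k i) ^ r ≤ ∑ i, r / p i / σ * a k i ^ p i := by
    intro k hk
    have h1 : ∀ i, a k i ^ p i ≤ 1 := fun i =>
      (Finset.single_le_sum (f := fun k => a k i ^ p i)
        (fun j _ => Real.rpow_nonneg (ha j i) _) hk).trans (hs i)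
    refine le_trans ?_ (Real.geom_mean_le_arith_mean_weighted Finset.univ
      (fun i => r / p i / σ) (fun i => a k i ^ p i)
      (fun i _ => by have := hp0 i; positivity) hw (fun i _ => Real.rpow_nonneg (ha k i) _))
    rw [← Real.finsetProd_rpow _ _ (fun i _ => ha k i)]
    refine Finset.prod_le_prod (fun i _ => Real.rpow_nonneg (ha k i) _) (fun i _ => ?_)
    have hi := hp0 i
    have h2 : a k i ^ r = (a k i ^ p i) ^ (r / p i) := by
      rw [← Real.rpow_mul (ha k i), mul_div_cancel₀ _ hi.ne']
    rw [h2]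
    refine Real.rpow_le_rpow_of_exponent_ge_of_imp (Real.rpow_nonneg (ha k i) _) (h1 i) ?_ ?_
    · exact div_le_self (by positivity) hr
    · intro _ h
      have : 0 < r / p i := by positivity
      have : 0 < r / p i / σ := by positivity
      linarith
  calc ∑ k ∈ F, (∏ i, a k i) ^ r ≤ ∑ k ∈ F, ∑ i, r / p i / σ * a k i ^ p i :=
        Finset.sum_le_sum key
    _ = ∑ i, r / p i / σ * ∑ k ∈ F, a k i ^ p i := by
        rw [Finset.sum_comm]
        simp only [Finset.mul_sum]
    _ ≤ ∑ i, r / p i / σ * 1 := by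
        refine Finset.sum_le_sum (fun i _ => mul_le_mul_of_nonneg_left (hs i) ?_)
        have := hp0 i
        positivity
    _ = 1 := by simp only [mul_one, hw]

lemma approx {N : ℕ} {V : Fin N → Type} [∀ i, NormedAddCommGroup (V i)]
    [∀ i, NormedSpace ℝ (V i)] (hN : N ≠ 0) (ψ : ProjTensor (Fin N) V →L[ℝ] ℝ)
    (x : ProjTensor (Fin N) V) {δ : ℝ} (hδ : 0 < δ) :
    ∃ m : ∀ i, V i, (∀ i, ‖m i‖ ≤ 1) ∧ ψ x ≤ ‖x‖ * ψ (tprodM V m) + δ := by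
  by_contra hcon
  push Not at hcon
  have h0 := hcon 0 (by simp)
  have i0 : Fin N := ⟨0, Nat.pos_of_ne_zero hN⟩
  have hz : tprodM V 0 = 0 := (tprodM V).map_coord_zero i0 rfl
  rw [hz, map_zero, mul_zero, zero_add] at h0
  have hx : 0 < ‖x‖ := by
    refine norm_pos_iff.mpr ?_
    rintro rfl
    rw [map_zero] at h0
    linarith
  have habs : ∀ m : ∀ i, V i, (∀ i, ‖m i‖ ≤ 1) → ‖x‖ * |ψ (tprodM V m)| + δ < ψ x := by
    intro m hm
    rcases abs_choice (ψ (tprodM V m)) with h | h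
    · rw [h]
      exact hcon m hm
    · rw [h]
      have := hcon (Function.update m i0 (-m i0)) (fun i => by
        by_cases hi : i = i0
        · subst hi
          simpa using hm i
        · simpa [hi] using hm i)
      rwa [MultilinearMap.map_update_neg, Function.update_eq_self, map_neg] at this
  have hb := norm_clm_le' ψ (C := (ψ x - δ) / ‖x‖) (by
      apply div_nonneg _ hx.le
      linarith) (fun m hm => by
      rw [Real.norm_eq_abs, le_div_iff₀ hx, mul_comm]
      linarith [habs m hm]) x
  rw [div_mul_cancel₀ _ hx.ne', Real.norm_eq_abs] at hb
  linarith [le_abs_self (ψ x)]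

variable {N : ℕ} (p : Fin N → ℝ) [∀ i, Fact (1 ≤ ENNReal.ofReal (p i))]

/-- The family of `ℓ_p` spaces. -/
abbrev LV : Fin N → Type := fun i => Lp' (ENNReal.ofReal (p i))

lemma toReal_ofReal'_s16 (hp : ∀ i, 1 < p i) (i) : (ENNReal.ofReal (p i)).toReal = p i :=
  ENNReal.toReal_ofReal (zero_lt_one.trans (hp i)).le

lemma toReal_pos' (hp : ∀ i, 1 < p i) (i) : 0 < (ENNReal.ofReal (p i)).toReal := by
  rw [toReal_ofReal'_s16 p hp]
  exact zero_lt_one.trans (hp i)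

lemma elem_bound (hN : N ≠ 0) (hp : ∀ i, 1 < p i) (r : ℝ) (hr0 : 0 < r)
    (hr : 1 / r = min 1 (∑ i, 1 / p i)) (F : Finset ℕ) (c : ℕ → ℝ) (hc : ∀ k, 0 ≤ c k)
    (m : ℕ → ∀ i, LV p i) (hm : ∀ k i, ‖m k i‖ ≤ 1) :
    ‖∑ k ∈ F, c k • tprodM (LV p)
        (fun i => lpExt ℝ (toReal_pos' p hp i) (pair_inj k) (m k i))‖ ≤
      (∑ k ∈ F, c k ^ r) ^ (1 / r) := by
  have hp0 : ∀ i, 0 < p i := fun i => zero_lt_one.trans (hp i)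
  have hA0 : 0 ≤ ∑ k ∈ F, c k ^ r := Finset.sum_nonneg (fun k _ => Real.rpow_nonneg (hc k) _)
  rcases le_total 1 (∑ i, 1 / p i) with h | h
  · rw [min_eq_left h, div_eq_iff hr0.ne', one_mul] at hr
    subst hr
    simp only [Real.rpow_one, div_one]
    refine norm_sum_le_of_le F (fun k _ => ?_)
    rw [norm_smul, Real.norm_of_nonneg (hc k)]
    refine mul_le_of_le_one_right (hc k) ((norm_tprodM_le _).trans ?_)
    exact Finset.prod_le_one (fun _ _ => norm_nonneg _)
      (fun i _ => (norm_lpExt_le _ _ _).trans (hm k i))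
  · rw [min_eq_right h] at hr
    have hsum : ∑ i, r / p i = 1 := by
      have : ∑ i, r / p i = r * ∑ i, 1 / p i := by
        rw [Finset.mul_sum]
        exact Finset.sum_congr rfl (fun i _ => by ring)
      rw [this, ← hr, mul_one_div_cancel hr0.ne']
    have h1 := norm_diag_le (V := LV p) hN F
      (fun i k => (c k ^ (r / p i)) • lpExt ℝ (toReal_pos' p hp i) (pair_inj k) (m k i))
      (fun i => (∑ k ∈ F, c k ^ r) ^ (1 / p i)) (by
        intro i η hη
        have h2 := norm_sum_ext (toReal_pos' p hp i) F
          (fun k => η k • (c k ^ (r / p i)) • m k i)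
        simp only [map_smul] at h2
        rw [toReal_ofReal'_s16 p hp i] at h2
        rw [one_div, Real.le_rpow_inv_iff_of_pos (norm_nonneg _) hA0 (hp0 i)]
        refine h2.le.trans (Finset.sum_le_sum (fun k _ => ?_))
        rw [norm_smul, norm_smul, Real.norm_eq_abs, hη, one_mul,
          Real.norm_of_nonneg (Real.rpow_nonneg (hc k) _)]
        calc (c k ^ (r / p i) * ‖m k i‖) ^ p i ≤ (c k ^ (r / p i)) ^ p i := by
              refine Real.rpow_le_rpow ?_ ?_ (hp0 i).le
              · exact mul_nonneg (Real.rpow_nonneg (hc k) _) (norm_nonneg _)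
              · exact mul_le_of_le_one_right (Real.rpow_nonneg (hc k) _) (hm k i)
          _ = c k ^ r := by
              rw [← Real.rpow_mul (hc k), div_mul_cancel₀ _ (hp0 i).ne'])
    rw [← Real.rpow_sum_of_nonneg hA0 (fun i _ => by have := hp0 i; positivity), ← hr] at h1
    convert h1 using 4 with k hk
    rw [MultilinearMap.map_smul_univ, ← Real.rpow_sum_of_nonneg (hc k)
      (fun i _ => by have := hp0 i; positivity), hsum, Real.rpow_one]

theorem main_aux (hN : N ≠ 0) (hp : ∀ i, 1 < p i) (r : ℝ) [Fact (1 ≤ ENNReal.ofReal r)]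
    (hr0 : 0 < r) (hr : 1 / r = min 1 (∑ i, 1 / p i)) :
    Nonempty (LpT p ≃L[ℝ] lp (fun _ : ℕ => LpT p) (ENNReal.ofReal r)) := by
  have hp0 : ∀ i, 0 < p i := fun i => zero_lt_one.trans (hp i)
  have hrr : (ENNReal.ofReal r).toReal = r := ENNReal.toReal_ofReal hr0.le
  have hq : 0 < (ENNReal.ofReal r).toReal := by rwa [hrr]
  have hS := fun k => exists_map (V := LV p)
    (fun i => lpExt ℝ (toReal_pos' p hp i) (pair_inj k)) (fun i x => norm_lpExt_le _ _ x)
  have hP := fun k => exists_map (V := LV p)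
    (fun i => lpRes ℝ (toReal_pos' p hp i) (pair_inj k)) (fun i x => norm_lpRes_le _ _ x)
  choose S hS1 hS2 using hS
  choose P hP1 hP2 using hP
  -- orthogonality relations
  have hPS : ∀ k l x, P k (S l x) = if k = l then x else 0 := by
    intro k l x
    split_ifs with h
    · subst h
      have : (P k).comp (S k) = ContinuousLinearMap.id ℝ _ := by
        refine clm_ext _ _ (fun m => ?_)
        simp [hS1, hP1, res_ext]
      exact congrArg (fun T => T x) this
    · have : (P k).comp (S l) = 0 := by
        refine clm_ext _ _ (fun m => ?_)
        simp only [ContinuousLinearMap.comp_apply, hS1, hP1, res_ext, if_neg h]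
        exact (tprodM (LV p)).map_coord_zero ⟨0, Nat.pos_of_ne_zero hN⟩ rfl
      exact congrArg (fun T => T x) this
  -- the upper estimate
  have hJ : ∀ (F : Finset ℕ) (x : ℕ → LpT p),
      ‖∑ k ∈ F, S k (x k)‖ ≤ (∑ k ∈ F, ‖x k‖ ^ r) ^ (1 / r) := by
    intro F x
    obtain ⟨φ, hφ1, hφ2⟩ := exists_dual_vector'' ℝ (∑ k ∈ F, S k (x k))
    refine le_of_forall_pos_le_add (fun e he => ?_)
    set δ : ℝ := e / (F.card + 1) with hδ
    have hδ0 : 0 < δ := by positivity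
    choose m hm1 hm2 using fun k => approx hN (φ.comp (S k)) (x k) hδ0
    have h1 := elem_bound p hN hp r hr0 hr F (fun k => ‖x k‖) (fun k => norm_nonneg _) m hm1
    have h2 : ‖∑ k ∈ F, S k (x k)‖ = φ (∑ k ∈ F, S k (x k)) := hφ2.symm
    have h3 : φ (∑ k ∈ F, S k (x k)) ≤
        φ (∑ k ∈ F, ‖x k‖ • tprodM (LV p)
        (fun i => lpExt ℝ (toReal_pos' p hp i) (pair_inj k) (m k i))) + F.card * δ := by
      rw [map_sum, map_sum, ← nsmul_eq_mul, ← Finset.sum_const, ← Finset.sum_add_distrib]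
      refine Finset.sum_le_sum (fun k _ => ?_)
      have := hm2 k
      simp only [ContinuousLinearMap.comp_apply, hS1] at this
      rw [map_smul, smul_eq_mul]
      exact this
    have h4 : F.card * δ ≤ e := by
      rw [hδ, mul_div_assoc', div_le_iff₀ (by positivity)]
      nlinarith
    have h5 := (le_abs_self _).trans (φ.le_of_opNorm_le hφ1 (∑ k ∈ F, ‖x k‖ • tprodM (LV p)
        (fun i => lpExt ℝ (toReal_pos' p hp i) (pair_inj k) (m k i))))
    rw [one_mul] at h5
    exact h2.le.trans (h3.trans (add_le_add (h5.trans h1) h4))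
  -- the lower estimate
  have hsum : 1 ≤ ∑ i, r / p i := by
    have h1 : ∑ i, r / p i = r * ∑ i, 1 / p i := by
      rw [Finset.mul_sum]
      exact Finset.sum_congr rfl (fun i _ => by ring)
    have h2 : 1 / r ≤ ∑ i, 1 / p i := hr.le.trans (min_le_right _ _)
    rw [h1]
    rwa [div_le_iff₀' hr0] at h2
  have hQ : ∀ (F : Finset ℕ) (x : LpT p), ∑ k ∈ F, ‖P k x‖ ^ r ≤ ‖x‖ ^ r := by
    intro F x
    let T : LpT p →L[ℝ] lp (fun _ : ℕ => LpT p) (ENNReal.ofReal r) :=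
      ∑ k ∈ F, (lp.singleContinuousLinearMap ℝ (fun _ : ℕ => LpT p) (ENNReal.ofReal r) k).comp (P k)
    have hT : ∀ y, ‖T y‖ ^ r = ∑ k ∈ F, ‖P k y‖ ^ r := by
      intro y
      have h1 := lp.norm_sum_single (E := fun _ : ℕ => LpT p) hq (fun k => P k y) F
      rw [hrr] at h1
      have h0 : T y = ∑ k ∈ F, lp.single (E := fun _ : ℕ => LpT p) (ENNReal.ofReal r) k (P k y) := by
        simp [T]
      exact (congrArg (fun z => ‖z‖ ^ r) h0).trans h1
    have h2 := norm_clm_le' T zero_le_one (fun m hm => by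
      have h3 : ‖T (tprodM _ m)‖ ^ r ≤ 1 := by
        rw [hT]
        refine le_trans (Finset.sum_le_sum (fun k _ => ?_)) (holder_aux p hp r hr0 hsum F
          (fun k i => ‖lpRes ℝ (toReal_pos' p hp i) (pair_inj k) (m i)‖)
          (fun k i => norm_nonneg _) (fun i => ?_))
        · refine Real.rpow_le_rpow (norm_nonneg _) ?_ hr0.le
          rw [hP1]
          exact norm_tprodM_le _
        · have h4 := hasSum_rows (toReal_pos' p hp i) (m i)
          rw [toReal_ofReal'_s16 p hp i] at h4
          refine (sum_le_hasSum F (fun _ _ => by positivity) h4).trans ?_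
          exact Real.rpow_le_one (norm_nonneg _) (hm i) (hp0 i).le
      by_contra hlt
      push Not at hlt
      exact absurd h3 (not_le.mpr (Real.one_lt_rpow hlt hr0))) x
    rw [one_mul] at h2
    rw [← hT]
    exact Real.rpow_le_rpow (norm_nonneg _) h2 hr0.le
  -- the map `Q`
  let Q : LpT p →L[ℝ] lp (fun _ : ℕ => LpT p) (ENNReal.ofReal r) :=
    LinearMap.mkContinuous
      { toFun := fun x => ⟨fun k => P k x, memℓp_gen' (C := ‖x‖ ^ r) (fun F => by
          rw [hrr]
          exact hQ F x)⟩
        map_add' := fun x y => by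
          refine lp.ext (funext fun k => ?_)
          exact map_add (P k) x y
        map_smul' := fun a x => by
          refine lp.ext (funext fun k => ?_)
          exact map_smul (P k) a x } 1 (fun x => by
      rw [one_mul]
      refine lp.norm_le_of_forall_sum_le hq (norm_nonneg _) (fun F => ?_)
      change ∑ k ∈ F, ‖P k x‖ ^ (ENNReal.ofReal r).toReal ≤ ‖x‖ ^ (ENNReal.ofReal r).toReal
      rw [hrr]
      exact hQ F x)
  -- the map `J`
  have hsmb : ∀ z : lp (fun _ : ℕ => LpT p) (ENNReal.ofReal r), Summable (fun k => S k (z k)) := by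
    intro z
    have hz : Summable (fun k => ‖z k‖ ^ r) := by
      have := (lp.memℓp z).summable hq
      rwa [hrr] at this
    rw [summable_iff_vanishing_norm] at hz ⊢
    intro e he
    obtain ⟨s, hs⟩ := hz (e ^ r) (Real.rpow_pos_of_pos he _)
    refine ⟨s, fun t ht => (hJ t (fun k => z k)).trans_lt ?_⟩
    have h1 := (le_abs_self _).trans_lt (hs t ht)
    rw [one_div, Real.rpow_inv_lt_iff_of_pos
      (Finset.sum_nonneg (fun k _ => by positivity)) he.le hr0]
    exact h1
  let J : lp (fun _ : ℕ => LpT p) (ENNReal.ofReal r) →L[ℝ] LpT p :=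
    LinearMap.mkContinuous
      { toFun := fun z => ∑' k, S k (z k)
        map_add' := fun x y => by
          rw [← (hsmb x).tsum_add (hsmb y)]
          exact tsum_congr (fun k => map_add (S k) (x k) (y k))
        map_smul' := fun a x => by
          rw [RingHom.id_apply, ← (hsmb x).tsum_const_smul a]
          exact tsum_congr (fun k => map_smul (S k) a (x k)) } 1 (fun z => by
      rw [one_mul]
      refine le_of_tendsto (hsmb z).hasSum.norm (Filter.Eventually.of_forall fun F => ?_)
      refine (hJ F (fun k => z k)).trans ?_
      rw [one_div, Real.rpow_inv_le_iff_of_pos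
        (Finset.sum_nonneg (fun k _ => by positivity)) (norm_nonneg _) hr0]
      have := lp.sum_rpow_le_norm_rpow hq z F
      rwa [hrr] at this)
  refine decomposition hq Q J (fun z => lp.ext (funext fun k => ?_))
  change P k (∑' l, S l (z l)) = z k
  rw [(P k).map_tsum (hsmb z)]
  simp only [hPS]
  exact tsum_ite_eq' k _

end Main

/-- For `1 < pᵢ < ∞` and `1/r = min{1, ∑ᵢ 1/pᵢ}`, the projective tensor
product `X = ℓ_{p₁} ⊗̂ ⋯ ⊗̂ ℓ_{p_N}` is isomorphic to the `ℓ_r`-sum of countably many copies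
of itself. -/
theorem stmt16 {N : ℕ} (p : Fin N → ℝ) [∀ i, Fact (1 ≤ ENNReal.ofReal (p i))]
    (hp : ∀ i, 1 < p i) (r : ℝ) [Fact (1 ≤ ENNReal.ofReal r)]
    (hr : 1 / r = min 1 (∑ i, 1 / p i)) :
    Nonempty (LpT p ≃L[ℝ] lp (fun _ : ℕ => LpT p) (ENNReal.ofReal r)) := by
  have h1 : 1 ≤ ENNReal.ofReal r := Fact.out
  have hr1 : 1 ≤ r := by
    by_contra hlt
    push Not at hlt
    exact absurd h1 (not_le.mpr (by simpa using hlt))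
  have hr0 : 0 < r := zero_lt_one.trans_le hr1
  have hN : N ≠ 0 := by
    rintro rfl
    simp at hr
    exact hr0.ne' hr
  exact main_aux p hN hp r hr0 hr
end
end
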